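/- arXiv:math/0105043 — 2 statements merged into one kernel-verified Lean document; each statement's English description precedes it below -/
import Mathlib

section
/- Let λ > λ₀. For every positive integer m there exists ε_m > 0 such that for every ε ∈ (0, ε_m), equation (∗) has a solution u on [0, π] with u'(0) = 0, u'(π) = 0, u(π/2) = 0, u'(π/2) < 0, together with points π/2 < s₁ < t₁ < s₂ < t₂ < ⋯ < s_m < t_m = π such that s₁, …, s_m are precisely the local minimum points of u in (π/2, π], t₁, …, t_m are precisely the local maximum points of u in (π/2, π], and u'(t) > 0 and U̲(π/2) < u(t) < U̲(π) for all t ∈ (s_m, π). -/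
open Real Set

theorem exists_second_order_solution {F : ℝ → ℝ → ℝ} {M K : ℝ}
    (hcont : Continuous (Function.uncurry F)) (hM : ∀ t x, |F t x| ≤ M)
    (hK : ∀ t x x', |F t x - F t x'| ≤ K * |x - x'|) (b : ℝ) :
    ∃ y w : ℝ → ℝ, y 0 = b ∧ w 0 = 0 ∧ (∀ t, HasDerivAt y (w t) t) ∧ ContDiff ℝ 2 y ∧
      ∀ t ∈ Icc (0 : ℝ) π, HasDerivAt w (F t (y t)) t := by
  have hM0 : 0 ≤ M := (abs_nonneg _).trans (hM 0 0)
  have hK0 : 0 ≤ K := by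
    have := (abs_nonneg _).trans (hK 0 1 0)
    simpa using this
  let v : ℝ → ℝ × ℝ → ℝ × ℝ := fun t p => (p.2 / 4, 4 * F t p.1)
  have hPL : IsPicardLindelof v (tmin := -4) (tmax := 4) ⟨0, by norm_num, by norm_num⟩ (b, 0)
      (16 * M).toNNReal 0 (4 * M).toNNReal (4 * K + 1).toNNReal := by
    refine ⟨fun t _ => LipschitzWith.lipschitzOnWith ?_, fun x _ => ?_, fun t _ x hx => ?_, ?_⟩
    · refine LipschitzWith.of_dist_le_mul fun p p' => ?_
      rw [Real.coe_toNNReal _ (by positivity), Prod.dist_eq, Prod.dist_eq]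
      simp only [v, Real.dist_eq]
      have h1 := hK t p.1 p'.1
      have h2 : |p.1 - p'.1| ≤ max |p.1 - p'.1| |p.2 - p'.2| := le_max_left _ _
      have h3 : |p.2 - p'.2| ≤ max |p.1 - p'.1| |p.2 - p'.2| := le_max_right _ _
      have h4 : 0 ≤ |p.1 - p'.1| := abs_nonneg _
      refine max_le ?_ ?_
      · rw [← sub_div, abs_div, abs_of_pos (by norm_num : (0 : ℝ) < 4)]
        nlinarith
      · rw [← mul_sub, abs_mul, abs_of_pos (by norm_num : (0 : ℝ) < 4)]
        nlinarith
    · have : Continuous fun t => v t x := by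
        have h : Continuous fun t => F t x.1 :=
          hcont.comp (by fun_prop : Continuous fun t => (t, x.1))
        fun_prop
      exact this.continuousOn
    · rw [Real.coe_toNNReal _ (by positivity), Prod.norm_def]
      have hx' : ‖x.2‖ ≤ 16 * M := by
        have := (norm_snd_le (x - (b, 0))).trans (mem_closedBall_iff_norm.mp hx)
        rw [Real.coe_toNNReal _ (by positivity)] at this
        simpa using this
      have h1 := hM t x.1
      rw [Real.norm_eq_abs] at hx'
      simp only [v, Real.norm_eq_abs]
      refine max_le ?_ ?_
      · rw [abs_div, abs_of_pos (by norm_num : (0 : ℝ) < 4)]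
        linarith
      · rw [abs_mul, abs_of_pos (by norm_num : (0 : ℝ) < 4)]
        linarith
    · rw [Real.coe_toNNReal _ (by positivity), Real.coe_toNNReal _ (by positivity)]
      norm_num
      linarith
  obtain ⟨α, hα0, hα⟩ := hPL.exists_eq_forall_mem_Icc_hasDerivWithinAt₀
  simp only at hα0
  have hαc : ContinuousOn α (Icc (-4) 4) := fun t ht => (hα t ht).continuousWithinAt
  let e : ℝ → ℝ := fun t =>
    F t (IccExtend (by norm_num : (-4 : ℝ) ≤ 4) (domRestrict (Icc (-4) 4) α) t).1
  have hec : Continuous e :=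
    hcont.comp (continuous_id.prodMk (continuous_fst.comp hαc.domRestrict.Icc_extend'))
  let w : ℝ → ℝ := fun t => ∫ s in (0 : ℝ)..t, e s
  have hw : ∀ t, HasDerivAt w (e t) t := fun t =>
    intervalIntegral.integral_hasDerivAt_right (hec.intervalIntegrable _ _)
      (hec.stronglyMeasurableAtFilter _ _) hec.continuousAt
  have hwc : Continuous w := continuous_iff_continuousAt.mpr fun t => (hw t).continuousAt
  let y : ℝ → ℝ := fun t => b + ∫ s in (0 : ℝ)..t, w s
  have hy : ∀ t, HasDerivAt y (w t) t := fun t =>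
    (intervalIntegral.integral_hasDerivAt_right (hwc.intervalIntegrable _ _)
      (hwc.stronglyMeasurableAtFilter _ _) hwc.continuousAt).const_add b
  have hee : ∀ t ∈ Icc (-4 : ℝ) 4, e t = F t (α t).1 := fun t ht => by
    simp only [e, IccExtend_of_mem _ _ ht, domRestrict_apply]
  have hsub : ∀ {t}, t ∈ Ioo (-4 : ℝ) 4 → t ∈ Icc (-4 : ℝ) 4 := fun h => Ioo_subset_Icc_self h
  have hα' : ∀ t ∈ Ioo (-4 : ℝ) 4, HasDerivAt α (v t (α t)) t := fun t ht =>
    (hα t (hsub ht)).hasDerivAt (Icc_mem_nhds ht.1 ht.2)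
  have hα1 : ∀ t ∈ Ioo (-4 : ℝ) 4, HasDerivAt (fun t => (α t).1) ((α t).2 / 4) t := fun t ht =>
    (ContinuousLinearMap.fst ℝ ℝ ℝ).hasFDerivAt.comp_hasDerivAt t (hα' t ht)
  have hα2 : ∀ t ∈ Ioo (-4 : ℝ) 4, HasDerivAt (fun t => (α t).2) (4 * F t (α t).1) t := fun t ht =>
    (ContinuousLinearMap.snd ℝ ℝ ℝ).hasFDerivAt.comp_hasDerivAt t (hα' t ht)
  have h1 : EqOn (fun t => (α t).2) (fun t => 4 * w t) (Ioo (-4) 4) := by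
    refine isOpen_Ioo.eqOn_of_deriv_eq isPreconnected_Ioo (𝕜 := ℝ) (x := 0) ?_ ?_ ?_
      (by norm_num) ?_
    · intro t ht
      exact (hα2 t ht).differentiableAt.differentiableWithinAt
    · exact fun t _ => ((hw t).const_mul 4).differentiableAt.differentiableWithinAt
    · intro t ht
      rw [(hα2 t ht).deriv,
        ((hw t).const_mul 4).deriv, hee t (hsub ht)]
    · simp [hα0, w]
  have h2 : EqOn (fun t => (α t).1) y (Ioo (-4) 4) := by
    refine isOpen_Ioo.eqOn_of_deriv_eq isPreconnected_Ioo (𝕜 := ℝ) (x := 0) ?_ ?_ ?_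
      (by norm_num) ?_
    · intro t ht
      exact (hα1 t ht).differentiableAt.differentiableWithinAt
    · exact fun t _ => (hy t).differentiableAt.differentiableWithinAt
    · intro t ht
      rw [(hα1 t ht).deriv, (hy t).deriv]
      have := h1 ht
      simp only at this
      simp only [this]
      ring
    · simp [hα0, y]
  refine ⟨y, w, by simp [y], by simp [w], hy, ?_, fun t ht => ?_⟩
  · have hdy : deriv y = w := funext fun t => (hy t).deriv
    have hdw : deriv w = e := funext fun t => (hw t).deriv
    have h1' : ContDiff ℝ 1 w := by
      rw [contDiff_one_iff_deriv]
      exact ⟨fun t => (hw t).differentiableAt, hdw ▸ hec⟩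
    rw [show (2 : WithTop ℕ∞) = 1 + 1 by norm_num, contDiff_succ_iff_deriv]
    refine ⟨fun t => (hy t).differentiableAt, by simp, hdy ▸ h1'⟩
  · have ht' : t ∈ Ioo (-4 : ℝ) 4 := ⟨by linarith [ht.1], by linarith [ht.2, pi_lt_four]⟩
    have := hw t
    rw [hee t (hsub ht'), show (α t).1 = y t from h2 ht'] at this
    exact this

/-- Truncation of `v` to `[-(lam + 1), lam + 1]`. -/
noncomputable def clamp (lam v : ℝ) : ℝ := max (-(lam + 1)) (min v (lam + 1))

/-- The Duffing force, truncated far away from the relevant range of `v`. -/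
noncomputable def force (lam t v : ℝ) : ℝ := clamp lam v ^ 3 - lam * clamp lam v - cos t

theorem clamp_of_abs_le {lam v : ℝ} (h : |v| ≤ lam + 1) : clamp lam v = v := by
  rw [abs_le] at h
  rw [clamp, min_eq_left h.2, max_eq_right h.1]

theorem abs_clamp_le {lam : ℝ} (h : 0 ≤ lam) (v : ℝ) : |clamp lam v| ≤ lam + 1 :=
  abs_le.mpr ⟨le_max_left _ _, max_le (by linarith) (min_le_right _ _)⟩

theorem clamp_neg {lam : ℝ} (h : 0 ≤ lam) (v : ℝ) : clamp lam (-v) = -clamp lam v := by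
  unfold clamp
  rcases le_total v (lam + 1) with h1 | h1 <;> rcases le_total (-v) (lam + 1) with h2 | h2 <;>
    rcases le_total (-(lam + 1)) v with h3 | h3 <;>
    rcases le_total (-(lam + 1)) (-v) with h4 | h4 <;>
    simp only [min_eq_left, min_eq_right, max_eq_left, max_eq_right, h1, h2, h3, h4, neg_neg,
      neg_le_self_iff, show 0 ≤ lam + 1 by linarith] <;> linarith

theorem abs_clamp_sub_clamp_le (lam v v' : ℝ) : |clamp lam v - clamp lam v'| ≤ |v - v'| := by
  have h1 : |max (-(lam + 1)) (min v (lam + 1)) - max (-(lam + 1)) (min v' (lam + 1))| ≤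
      max |-(lam + 1) - -(lam + 1)| |min v (lam + 1) - min v' (lam + 1)| :=
    abs_max_sub_max_le_max _ _ _ _
  have h2 : |min v (lam + 1) - min v' (lam + 1)| ≤ max |v - v'| |lam + 1 - (lam + 1)| :=
    abs_min_sub_min_le_max _ _ _ _
  rw [sub_self, abs_zero, max_eq_right (abs_nonneg (min v (lam + 1) - _))] at h1
  rw [sub_self, abs_zero, max_eq_left (abs_nonneg (v - v'))] at h2
  exact h1.trans h2

theorem force_of_abs_le {lam v : ℝ} (h : |v| ≤ lam + 1) (t : ℝ) :
    force lam t v = v ^ 3 - lam * v - cos t := by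
  rw [force, clamp_of_abs_le h]

theorem continuous_force (lam : ℝ) : Continuous (Function.uncurry (force lam)) := by
  unfold force clamp Function.uncurry
  fun_prop

theorem abs_force_le {lam : ℝ} (h : 0 ≤ lam) (t v : ℝ) :
    |force lam t v| ≤ (lam + 1) ^ 3 + lam * (lam + 1) + 1 := by
  have h1 := abs_clamp_le h v
  have h2 := abs_cos_le_one t
  have h3 : |clamp lam v ^ 3| ≤ (lam + 1) ^ 3 := by
    rw [abs_pow]
    exact pow_le_pow_left₀ (abs_nonneg _) h1 3
  have h4 : |lam * clamp lam v| ≤ lam * (lam + 1) := by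
    rw [abs_mul, abs_of_nonneg h]
    exact mul_le_mul_of_nonneg_left h1 h
  unfold force
  rw [abs_le] at *
  constructor <;> linarith

theorem abs_force_sub_force_le {lam : ℝ} (h : 0 ≤ lam) (t v v' : ℝ) :
    |force lam t v - force lam t v'| ≤ (3 * (lam + 1) ^ 2 + lam) * |v - v'| := by
  have h1 := abs_clamp_le h v
  have h2 := abs_clamp_le h v'
  have h3 := abs_clamp_sub_clamp_le lam v v'
  unfold force
  set c := clamp lam v
  set c' := clamp lam v'
  have : c ^ 3 - lam * c - cos t - (c' ^ 3 - lam * c' - cos t) =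
    (c ^ 2 + c * c' + c' ^ 2 - lam) * (c - c') := by ring
  rw [this, abs_mul]
  refine mul_le_mul ?_ h3 (abs_nonneg _) (by positivity)
  rw [abs_le] at h1 h2
  rw [abs_le]
  constructor <;> nlinarith [sq_nonneg (c + c')]

theorem force_pi_sub_neg {lam : ℝ} (h : 0 ≤ lam) (t v : ℝ) :
    force lam (π - t) (-v) = -force lam t v := by
  unfold force
  rw [clamp_neg h, cos_pi_sub]
  ring

/-- `y` solves the truncated Duffing equation on `[0, π]` with velocity `w` and `w 0 = 0`. -/
structure IsShot (lam ε : ℝ) (y w : ℝ → ℝ) : Prop where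
  hy : ∀ t, HasDerivAt y (w t) t
  hw : ∀ t ∈ Icc 0 π, HasDerivAt w (force lam t (y t) / ε ^ 2) t
  smooth : ContDiff ℝ 2 y
  w0 : w 0 = 0

theorem exists_isShot {lam ε : ℝ} (hlam : 0 ≤ lam) (b : ℝ) :
    ∃ y w, IsShot lam ε y w ∧ y 0 = b := by
  obtain ⟨y, w, h1, h2, h3, h4, h5⟩ := exists_second_order_solution
    (F := fun t v => force lam t v / ε ^ 2)
    (M := ((lam + 1) ^ 3 + lam * (lam + 1) + 1) / ε ^ 2)
    (K := (3 * (lam + 1) ^ 2 + lam) / ε ^ 2)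
    ((continuous_force lam).div_const _)
    (fun t x => by
      rw [abs_div, abs_of_nonneg (sq_nonneg ε)]
      exact div_le_div_of_nonneg_right (abs_force_le hlam t x) (sq_nonneg ε))
    (fun t x x' => by
      rw [← sub_div, abs_div, abs_of_nonneg (sq_nonneg ε), div_mul_eq_mul_div]
      exact div_le_div_of_nonneg_right (abs_force_sub_force_le hlam t x x') (sq_nonneg ε)) b
  exact ⟨y, w, ⟨h3, h5, h4, h2⟩, h1⟩

namespace IsShot

variable {lam ε : ℝ} {y w y' w' : ℝ → ℝ}

theorem cont_y (h : IsShot lam ε y w) : Continuous y :=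
  continuous_iff_continuousAt.mpr fun t => (h.hy t).continuousAt

theorem deriv_y (h : IsShot lam ε y w) : deriv y = w := funext fun t => (h.hy t).deriv

theorem cont_w (h : IsShot lam ε y w) : Continuous w :=
  h.deriv_y ▸ h.smooth.continuous_deriv (by norm_num)

end IsShot

theorem lipschitzWith_phase {lam : ℝ} (hlam : 0 ≤ lam) (ε t : ℝ) :
    LipschitzWith (1 + (3 * (lam + 1) ^ 2 + lam) / ε ^ 2).toNNReal
      (fun p : ℝ × ℝ => (p.2, force lam t p.1 / ε ^ 2)) := by
  refine LipschitzWith.of_dist_le_mul fun p p' => ?_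
  rw [Real.coe_toNNReal _ (by positivity), Prod.dist_eq, Prod.dist_eq]
  simp only [Real.dist_eq]
  have h1 : 0 ≤ (3 * (lam + 1) ^ 2 + lam) / ε ^ 2 := by positivity
  have h2 : |p.1 - p'.1| ≤ max |p.1 - p'.1| |p.2 - p'.2| := le_max_left _ _
  have h3 : |p.2 - p'.2| ≤ max |p.1 - p'.1| |p.2 - p'.2| := le_max_right _ _
  have h4 : 0 ≤ |p.1 - p'.1| := abs_nonneg _
  have h5 : |force lam t p.1 / ε ^ 2 - force lam t p'.1 / ε ^ 2| ≤
      (3 * (lam + 1) ^ 2 + lam) / ε ^ 2 * |p.1 - p'.1| := by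
    rw [← sub_div, abs_div, abs_of_nonneg (sq_nonneg ε), div_mul_eq_mul_div]
    exact div_le_div_of_nonneg_right (abs_force_sub_force_le hlam t _ _) (sq_nonneg ε)
  refine max_le ?_ ?_ <;> nlinarith

theorem IsShot.hasDerivAt_phase {lam ε : ℝ} {y w : ℝ → ℝ} (h : IsShot lam ε y w) {t : ℝ}
    (ht : t ∈ Icc 0 π) :
    HasDerivAt (fun t => (y t, w t)) (w t, force lam t (y t) / ε ^ 2) t :=
  (h.hy t).prodMk (h.hw t ht)

/-- Continuous dependence on the initial value. -/
theorem exists_shot_dist_le {lam : ℝ} (hlam : 0 ≤ lam) (ε : ℝ) :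
    ∃ C > 0, ∀ y w y' w' : ℝ → ℝ, IsShot lam ε y w → IsShot lam ε y' w' → ∀ t ∈ Icc 0 π,
      |y t - y' t| ≤ C * |y 0 - y' 0| ∧ |w t - w' t| ≤ C * |y 0 - y' 0| := by
  set L := (1 + (3 * (lam + 1) ^ 2 + lam) / ε ^ 2).toNNReal with hL
  refine ⟨exp (L * π), exp_pos _, fun y w y' w' h h' t ht => ?_⟩
  have key := dist_le_of_trajectories_ODE
    (v := fun t p => (p.2, force lam t p.1 / ε ^ 2)) (fun t => lipschitzWith_phase hlam ε t)
    (h.cont_y.prodMk h.cont_w).continuousOn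
    (fun t ht => (h.hasDerivAt_phase (Ico_subset_Icc_self ht)).hasDerivWithinAt)
    (h'.cont_y.prodMk h'.cont_w).continuousOn
    (fun t ht => (h'.hasDerivAt_phase (Ico_subset_Icc_self ht)).hasDerivWithinAt) (le_refl _) t ht
  rw [Prod.dist_eq, Prod.dist_eq] at key
  simp only [h.w0, h'.w0, dist_self, Real.dist_eq, sub_zero] at key
  rw [max_eq_left (abs_nonneg (y 0 - y' 0))] at key
  have h2 : |y 0 - y' 0| * exp (L * t) ≤ exp (L * π) * |y 0 - y' 0| := by
    rw [mul_comm]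
    refine mul_le_mul_of_nonneg_right (exp_le_exp.mpr ?_) (abs_nonneg _)
    exact mul_le_mul_of_nonneg_left ht.2 L.coe_nonneg
  exact ⟨(le_max_left _ _).trans (key.trans h2), (le_max_right _ _).trans (key.trans h2)⟩

/-- A shot vanishing at `π / 2` is odd about `π / 2`. -/
theorem IsShot.odd {lam ε : ℝ} {y w : ℝ → ℝ} (hlam : 0 ≤ lam) (h : IsShot lam ε y w)
    (h0 : y (π / 2) = 0) {t : ℝ} (ht : t ∈ Icc 0 π) :
    y (π - t) = -y t ∧ w (π - t) = w t := by
  have hpi := pi_pos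
  have key := ODE_solution_unique_of_mem_Icc (a := 0) (b := π) (t₀ := π / 2)
    (f := fun t => (y t, w t)) (g := fun t => (-y (π - t), w (π - t))) (s := fun _ => univ)
    (v := fun t p => (p.2, force lam t p.1 / ε ^ 2))
    (fun t _ => (lipschitzWith_phase hlam ε t).lipschitzOnWith) ⟨by linarith, by linarith⟩
    (h.cont_y.prodMk h.cont_w).continuousOn
    (fun t ht => h.hasDerivAt_phase (Ioo_subset_Icc_self ht)) (fun _ _ => mem_univ _)
    ?_ ?_ (fun _ _ => mem_univ _) ?_
  · have := key ht
    simp only [Prod.mk.injEq] at this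
    exact ⟨by linarith [this.1], this.2.symm⟩
  · have h1 := h.cont_y
    have h2 := h.cont_w
    fun_prop
  · intro t ht
    have ht' : π - t ∈ Icc 0 π := ⟨by linarith [ht.2], by linarith [ht.1]⟩
    have h1 := ((h.hy (π - t)).comp_const_sub π t).neg
    have h2 := (h.hw (π - t) ht').comp_const_sub π t
    have h3 : force lam t (-y (π - t)) = -force lam (π - t) (y (π - t)) := by
      rw [← force_pi_sub_neg hlam, sub_sub_cancel]
    simp only [h3]
    rw [neg_div]
    rw [neg_neg] at h1
    exact h1.prodMk h2
  · simp only [sub_half, h0, neg_zero]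

/-- `U` is the smooth branch of negative roots of `x³ - lam x = cos t` with `3 x² > lam`. -/
structure IsLowRoot (lam : ℝ) (U : ℝ → ℝ) : Prop where
  root : ∀ t, U t ^ 3 - lam * U t = cos t
  neg : ∀ t, U t < 0
  steep : ∀ t, 0 < 3 * U t ^ 2 - lam
  deriv : ∀ t, HasDerivAt U (-sin t / (3 * U t ^ 2 - lam)) t

theorem exists_isLowRoot {lam : ℝ} (h0 : 0 < lam) (h : 27 < 4 * lam ^ 3) :
    ∃ U, IsLowRoot lam U := by
  obtain ⟨r, hr, hr2⟩ : ∃ r, 0 < r ∧ 3 * r ^ 2 = lam :=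
    ⟨√(lam / 3), sqrt_pos.mpr (by positivity), by rw [sq_sqrt (by positivity)]; ring⟩
  have hr3 : 1 < 2 * r ^ 3 := by
    have h1 : 1 < (2 * r ^ 3) ^ 2 := by
      have : lam ^ 3 = 27 * (r ^ 3) ^ 2 := by rw [← hr2]; ring
      nlinarith
    exact (one_lt_sq_iff₀ (by positivity)).mp h1
  have hk : ∀ t, -1 < cos t / (2 * r ^ 3) ∧ cos t / (2 * r ^ 3) < 1 := fun t => by
    rw [lt_div_iff₀ (by linarith), div_lt_iff₀ (by linarith)]
    constructor <;> linarith [neg_one_le_cos t, cos_le_one t]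
  set A : ℝ → ℝ := fun t => π / 3 - arcsin (cos t / (2 * r ^ 3)) / 3 with hA
  have hA1 : ∀ t, 1 / 2 < sin (A t) := fun t => by
    rw [← sin_pi_div_six]
    have h1 := arcsin_lt_pi_div_two.mpr (hk t).2
    have h2 := neg_pi_div_two_lt_arcsin.mpr (hk t).1
    have := pi_pos
    exact sin_lt_sin_of_lt_of_le_pi_div_two (by linarith) (by simp only [hA]; linarith)
      (by simp only [hA]; linarith)
  have hA3 : ∀ t, 3 * sin (A t) - 4 * sin (A t) ^ 3 = cos t / (2 * r ^ 3) := fun t => by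
    rw [← sin_three_mul, show 3 * A t = π - arcsin (cos t / (2 * r ^ 3)) by simp only [hA]; ring,
      sin_pi_sub, sin_arcsin (hk t).1.le (hk t).2.le]
  have hroot : ∀ t, (-2 * r * sin (A t)) ^ 3 - lam * (-2 * r * sin (A t)) = cos t := fun t => by
    have := hA3 t
    rw [eq_div_iff (by positivity)] at this
    rw [← hr2, ← this]
    ring
  have hsteep : ∀ t, 0 < 3 * (-2 * r * sin (A t)) ^ 2 - lam := fun t => by
    have := hA1 t
    have h4 : 0 < 4 * sin (A t) ^ 2 - 1 := by nlinarith
    calc 0 < 3 * r ^ 2 * (4 * sin (A t) ^ 2 - 1) := by positivity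
      _ = _ := by rw [← hr2]; ring
  refine ⟨fun t => -2 * r * sin (A t), hroot, fun t => ?_, hsteep, fun t => ?_⟩
  · have := hA1 t
    have : 0 < r * sin (A t) := by positivity
    linarith
  · have hd : DifferentiableAt ℝ (fun t => -2 * r * sin (A t)) t := by
      have h1 : DifferentiableAt ℝ (fun t => arcsin (cos t / (2 * r ^ 3))) t :=
        DifferentiableAt.comp (g := arcsin) t
          (differentiableAt_arcsin.mpr ⟨(hk t).1.ne', (hk t).2.ne⟩)
          (by fun_prop : DifferentiableAt ℝ (fun t => cos t / (2 * r ^ 3)) t)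
      simp only [hA]
      fun_prop
    have h1 := hd.hasDerivAt
    have h2 := (h1.pow 3).sub (h1.const_mul lam)
    have h3 : HasDerivAt cos _ t := h2.congr_of_eventuallyEq (Filter.Eventually.of_forall
      fun s => (hroot s).symm)
    have h4 := h3.unique (hasDerivAt_cos t)
    have h5 : -sin t / (3 * (-2 * r * sin (A t)) ^ 2 - lam) =
        deriv (fun t => -2 * r * sin (A t)) t := by
      rw [div_eq_iff (hsteep t).ne', ← h4]
      push_cast
      ring
    rw [h5]
    exact h1

namespace IsLowRoot

variable {lam : ℝ} {U : ℝ → ℝ}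

theorem cont (h : IsLowRoot lam U) : Continuous U :=
  continuous_iff_continuousAt.mpr fun t => (h.deriv t).continuousAt

theorem antitoneOn (h : IsLowRoot lam U) : AntitoneOn U (Icc 0 π) :=
  antitoneOn_of_hasDerivWithinAt_nonpos (convex_Icc _ _) h.cont.continuousOn
    (fun t _ => (h.deriv t).hasDerivWithinAt) fun t ht => by
      rw [interior_Icc] at ht
      exact div_nonpos_of_nonpos_of_nonneg (neg_nonpos.mpr (sin_pos_of_mem_Ioo ht).le)
        (h.steep t).le

theorem le_zero_val (h : IsLowRoot lam U) {t : ℝ} (ht : t ∈ Icc 0 (π / 2)) : U t ≤ U 0 := by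
  have := pi_pos
  exact h.antitoneOn ⟨le_rfl, this.le⟩ ⟨ht.1, by linarith [ht.2]⟩ ht.1

theorem sq_le (h : IsLowRoot lam U) {t : ℝ} (ht : t ∈ Icc 0 (π / 2)) : U t ^ 2 ≤ lam := by
  have h1 : 0 ≤ cos t := cos_nonneg_of_mem_Icc ⟨by linarith [ht.1, pi_pos], ht.2⟩
  have h2 := h.root t
  have h3 := h.neg t
  by_contra! h4
  nlinarith

theorem steep_mono (h : IsLowRoot lam U) {t : ℝ} (ht : t ∈ Icc 0 (π / 2)) :
    3 * U 0 ^ 2 - lam ≤ 3 * U t ^ 2 - lam := by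
  have h1 := h.le_zero_val ht
  have h2 := h.neg 0
  nlinarith

theorem at_pi_div_two (h : IsLowRoot lam U) : U (π / 2) = -√lam := by
  have h1 := h.root (π / 2)
  have h2 := h.neg (π / 2)
  rw [cos_pi_div_two] at h1
  have h3 : U (π / 2) ^ 2 = lam := by
    have : U (π / 2) * (U (π / 2) ^ 2 - lam) = 0 := by linarith
    rcases mul_eq_zero.mp this with h | h <;> linarith
  rw [← h3, sqrt_sq_eq_abs, abs_of_neg h2, neg_neg]

theorem zero_eq_least (h : IsLowRoot lam U) {v : ℝ} (hv : v ^ 3 - lam * v - 1 = 0)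
    (hleast : ∀ y : ℝ, y ^ 3 - lam * y - 1 = 0 → v ≤ y) : U 0 = v := by
  have h1 := h.root 0
  rw [cos_zero] at h1
  have h2 : v ≤ U 0 := hleast _ (by linarith)
  rcases h2.eq_or_lt with h2 | h2
  · exact h2.symm
  · exfalso
    have h3 := h.steep 0
    have h4 := h.neg 0
    have h5 : (v - U 0) * (v ^ 2 + U 0 * v + U 0 ^ 2 - lam) = 0 := by linarith
    rcases mul_eq_zero.mp h5 with h | h <;> nlinarith

end IsLowRoot

theorem twentyseven_lt_of_lt {lam : ℝ} (h : (3 : ℝ) / (2 : ℝ) ^ ((2 : ℝ) / 3) < lam) :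
    0 < lam ∧ 27 < 4 * lam ^ 3 := by
  have h1 : (0 : ℝ) < 2 ^ ((2 : ℝ) / 3) := by positivity
  have h2 : ((2 : ℝ) ^ ((2 : ℝ) / 3)) ^ 3 = 4 := by
    rw [← rpow_natCast, ← rpow_mul (by norm_num)]
    norm_num
  have h0 : (0 : ℝ) < 3 / 2 ^ ((2 : ℝ) / 3) := by positivity
  refine ⟨h0.trans h, ?_⟩
  have h3 := pow_lt_pow_left₀ h h0.le (n := 3) (by norm_num)
  rw [div_pow, h2] at h3
  linarith

theorem le_of_hasDerivAt_nonneg {f f' : ℝ → ℝ} {a b : ℝ} (hab : a ≤ b)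
    (hf : ∀ t ∈ Icc a b, HasDerivAt f (f' t) t) (h : ∀ t ∈ Ioo a b, 0 ≤ f' t) : f a ≤ f b := by
  refine monotoneOn_of_hasDerivWithinAt_nonneg (f' := f') (convex_Icc a b)
    (fun t ht => (hf t ht).continuousAt.continuousWithinAt) (fun t ht => ?_) (fun t ht => ?_)
    (left_mem_Icc.mpr hab) (right_mem_Icc.mpr hab) hab
  · exact (hf t (interior_subset ht)).hasDerivWithinAt
  · exact h t (by rwa [interior_Icc] at ht)

theorem lt_of_hasDerivAt_pos {f f' : ℝ → ℝ} {a b : ℝ} (hab : a < b)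
    (hf : ∀ t ∈ Icc a b, HasDerivAt f (f' t) t) (h : ∀ t ∈ Ioo a b, 0 < f' t) : f a < f b := by
  refine strictMonoOn_of_hasDerivWithinAt_pos (f' := f') (convex_Icc a b)
    (fun t ht => (hf t ht).continuousAt.continuousWithinAt) (fun t ht => ?_) (fun t ht => ?_)
    (left_mem_Icc.mpr hab.le) (right_mem_Icc.mpr hab.le) hab
  · exact (hf t (interior_subset ht)).hasDerivWithinAt
  · exact h t (by rwa [interior_Icc] at ht)

theorem mul_sub_le_of_hasDerivAt {f f' : ℝ → ℝ} {a b c : ℝ} (hab : a ≤ b)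
    (hf : ∀ t ∈ Icc a b, HasDerivAt f (f' t) t) (h : ∀ t ∈ Ioo a b, c ≤ f' t) :
    c * (b - a) ≤ f b - f a := by
  have := le_of_hasDerivAt_nonneg (f := fun t => f t - c * t) (f' := fun t => f' t - c * 1) hab
    (fun t ht => (hf t ht).sub ((hasDerivAt_id t).const_mul c))
    (fun t ht => by linarith [h t ht])
  linarith

theorem sign_near_of_hasDerivAt_pos {f : ℝ → ℝ} {f' s : ℝ} (h : HasDerivAt f f' s) (h0 : f s = 0)
    (h' : 0 < f') :
    ∃ δ > 0, (∀ t ∈ Ioo s (s + δ), 0 < f t) ∧ ∀ t ∈ Ioo (s - δ) s, f t < 0 := by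
  have h1 := eventually_nhdsWithin_sign_eq_of_deriv_pos (by rw [h.deriv]; exact h') h0
  obtain ⟨δ, hδ, h2⟩ := Metric.eventually_nhds_iff.mp h1
  refine ⟨δ, hδ, fun t ht => ?_, fun t ht => ?_⟩
  · have h3 : SignType.sign (f t) = SignType.sign (t - s) := h2 (by
      rw [Real.dist_eq, abs_lt]; constructor <;> linarith [ht.1, ht.2])
    rwa [sign_pos (sub_pos.mpr ht.1), sign_eq_one_iff] at h3
  · have h3 : SignType.sign (f t) = SignType.sign (t - s) := h2 (by
      rw [Real.dist_eq, abs_lt]; constructor <;> linarith [ht.1, ht.2])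
    rwa [sign_neg (sub_neg.mpr ht.2), sign_eq_neg_one_iff] at h3

theorem nonneg_of_hasDerivAt_of_le_left {f : ℝ → ℝ} {f' a s : ℝ} (h : HasDerivAt f f' s)
    (has : a < s) (hle : ∀ t ∈ Ioo a s, f t ≤ f s) : 0 ≤ f' := by
  by_contra! hneg
  obtain ⟨δ, hδ, -, h2⟩ := sign_near_of_hasDerivAt_pos (h.const_sub (f s)) (sub_self _)
    (neg_pos.mpr hneg)
  have h3 : max a (s - δ) < s := max_lt has (by linarith)
  have h4 := h2 ((max a (s - δ) + s) / 2) ⟨by linarith [le_max_right a (s - δ)], by linarith⟩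
  have h5 := hle ((max a (s - δ) + s) / 2) ⟨by linarith [le_max_left a (s - δ)], by linarith⟩
  linarith

theorem nonneg_of_hasDerivAt_of_le_right {f : ℝ → ℝ} {f' b s : ℝ} (h : HasDerivAt f f' s)
    (hsb : s < b) (hle : ∀ t ∈ Ioo s b, f s ≤ f t) : 0 ≤ f' := by
  by_contra! hneg
  obtain ⟨δ, hδ, h2, -⟩ := sign_near_of_hasDerivAt_pos (h.const_sub (f s)) (sub_self _)
    (neg_pos.mpr hneg)
  have h3 : s < min b (s + δ) := lt_min hsb (by linarith)
  have h4 := h2 ((min b (s + δ) + s) / 2) ⟨by linarith, by linarith [min_le_right b (s + δ)]⟩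
  have h5 := hle ((min b (s + δ) + s) / 2) ⟨by linarith, by linarith [min_le_left b (s + δ)]⟩
  linarith

theorem exists_first_nonpos {g : ℝ → ℝ} (hg : Continuous g) {a b t : ℝ} (ht : t ∈ Icc a b)
    (h : g t ≤ 0) : ∃ s ∈ Icc a b, g s ≤ 0 ∧ ∀ r ∈ Ico a s, 0 < g r := by
  obtain ⟨s, hs, hs'⟩ := (isCompact_Icc.inter_right (isClosed_le hg continuous_const)
    : IsCompact (Icc a b ∩ {r | g r ≤ 0})).exists_isLeast ⟨t, ht, h⟩
  refine ⟨s, hs.1, hs.2, fun r hr => ?_⟩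
  by_contra! hr'
  exact absurd (hs' ⟨⟨hr.1, hr.2.le.trans hs.1.2⟩, hr'⟩) (not_le.mpr hr.2)

theorem exists_last_nonpos {g : ℝ → ℝ} (hg : Continuous g) {a b t : ℝ} (ht : t ∈ Icc a b)
    (h : g t ≤ 0) : ∃ s ∈ Icc a b, g s ≤ 0 ∧ ∀ r ∈ Ioc s b, 0 < g r := by
  obtain ⟨s, hs, hs'⟩ := (isCompact_Icc.inter_right (isClosed_le hg continuous_const)
    : IsCompact (Icc a b ∩ {r | g r ≤ 0})).exists_isGreatest ⟨t, ht, h⟩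
  refine ⟨s, hs.1, hs.2, fun r hr => ?_⟩
  by_contra! hr'
  exact absurd (hs' ⟨⟨hs.1.1.trans hr.1.le, hr.2⟩, hr'⟩) (not_le.mpr hr.1)

theorem nonneg_of_pos_left {g : ℝ → ℝ} (hg : Continuous g) {a s : ℝ} (has : a < s)
    (h : ∀ r ∈ Ioo a s, 0 ≤ g r) : 0 ≤ g s := by
  have h1 : closure (Ioo a s) ⊆ {r | 0 ≤ g r} :=
    closure_minimal h (isClosed_le continuous_const hg)
  rw [closure_Ioo has.ne] at h1
  exact h1 (right_mem_Icc.mpr has.le)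

theorem nonneg_of_pos_right {g : ℝ → ℝ} (hg : Continuous g) {b s : ℝ} (hsb : s < b)
    (h : ∀ r ∈ Ioo s b, 0 ≤ g r) : 0 ≤ g s := by
  have h1 : closure (Ioo s b) ⊆ {r | 0 ≤ g r} :=
    closure_minimal h (isClosed_le continuous_const hg)
  rw [closure_Ioo hsb.ne] at h1
  exact h1 (left_mem_Icc.mpr hsb.le)

theorem pos_near_right {g : ℝ → ℝ} (hg : Continuous g) {s : ℝ} (h : 0 < g s) :
    ∃ δ > 0, ∀ t ∈ Ioo s (s + δ), 0 < g t := by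
  obtain ⟨δ, hδ, h2⟩ := Metric.eventually_nhds_iff.mp
    (hg.continuousAt.eventually (isOpen_Ioi.mem_nhds h) : ∀ᶠ t in nhds s, 0 < g t)
  refine ⟨δ, hδ, fun t ht => h2 ?_⟩
  rw [Real.dist_eq, abs_lt]
  constructor <;> linarith [ht.1, ht.2]

/-- Continuous induction for the positivity of a continuous function. -/
theorem pos_of_step {g : ℝ → ℝ} (hg : Continuous g) {s b : ℝ}
    (hnear : ∃ δ > 0, ∀ t ∈ Ioo s (s + δ), 0 < g t)
    (hstep : ∀ t ∈ Ioc s b, (∀ r ∈ Ioo s t, 0 < g r) → 0 < g t) : ∀ t ∈ Ioc s b, 0 < g t := by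
  intro t ht
  by_contra! h
  obtain ⟨δ, hδ, h1⟩ := hnear
  rcases lt_or_ge t (s + δ) with h2 | h2
  · exact absurd (h1 t ⟨ht.1, h2⟩) (not_lt.mpr h)
  obtain ⟨r, hr, hr1, hr2⟩ := exists_first_nonpos hg (a := s + δ / 2) (b := b)
    ⟨by linarith, ht.2⟩ h
  refine absurd (hstep r ⟨by linarith [hr.1], hr.2⟩ fun x hx => ?_) (not_lt.mpr hr1)
  rcases lt_or_ge x (s + δ / 2) with h3 | h3
  · exact h1 x ⟨hx.1, by linarith⟩
  · exact hr2 x ⟨h3, hx.2⟩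

/-- The energy of a shot, normalised to vanish at rest on the low root. -/
noncomputable def energy (lam ε : ℝ) (U y w : ℝ → ℝ) (t : ℝ) : ℝ :=
  ε ^ 2 * w t ^ 2 / 2 - (y t - U t) ^ 2 * ((y t + U t) ^ 2 - 2 * (lam - U t ^ 2)) / 4

/-- The quadratic cofactor of `y - U` in the Duffing force. -/
noncomputable def cofactor (lam : ℝ) (U y : ℝ → ℝ) (t : ℝ) : ℝ :=
  y t ^ 2 + U t * y t + U t ^ 2 - lam

theorem mem_Icc_zero_pi {t : ℝ} (ht : t ∈ Icc 0 (π / 2)) : t ∈ Icc 0 π :=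
  ⟨ht.1, by linarith [ht.2, pi_pos]⟩

theorem lt_and_lt_neg_of_sq_lt {u v : ℝ} (hu : u < 0) (h : v ^ 2 < u ^ 2) : u < v ∧ v < -u := by
  have h1 : |v| < -u := abs_lt_of_sq_lt_sq (by rwa [neg_sq]) (by linarith)
  rwa [abs_lt, neg_neg] at h1

section

variable {lam ε : ℝ} {U y w : ℝ → ℝ}

theorem force_eq_mul_cofactor (hU : IsLowRoot lam U) {t : ℝ} (hy : |y t| ≤ lam + 1) :
    force lam t (y t) = (y t - U t) * cofactor lam U y t := by
  rw [force_of_abs_le hy, ← hU.root t, cofactor]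
  ring

theorem IsShot.hasDerivAt_energy (h : IsShot lam ε y w) (hε : 0 < ε) (hU : IsLowRoot lam U) {t : ℝ}
    (ht : t ∈ Icc 0 π) (hy : |y t| ≤ lam + 1) :
    HasDerivAt (energy lam ε U y w) (-((y t - U t) * sin t)) t := by
  have h1 : energy lam ε U y w = fun t => ε ^ 2 * w t ^ 2 / 2 - y t ^ 4 / 4 + lam * y t ^ 2 / 2 +
      y t * cos t + (U t ^ 4 / 4 - lam * U t ^ 2 / 2 - U t * cos t) := by
    funext t
    rw [energy, ← hU.root t]
    ring
  have hw := h.hw t ht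
  rw [force_of_abs_le hy] at hw
  have hy' := h.hy t
  have hU' := hU.deriv t
  have h2 := ((((((hw.pow 2).const_mul (ε ^ 2)).div_const 2).sub ((hy'.pow 4).div_const 4)).add
    (((hy'.pow 2).const_mul lam).div_const 2)).add (hy'.mul (hasDerivAt_cos t))).add
    ((((hU'.pow 4).div_const 4).sub (((hU'.pow 2).const_mul lam).div_const 2)).sub
    (hU'.mul (hasDerivAt_cos t)))
  rw [h1]
  refine HasDerivAt.congr_deriv h2 ?_
  have h3 := hU.root t
  have h4 : ε ^ 2 * ((y t ^ 3 - lam * y t - cos t) / ε ^ 2) = y t ^ 3 - lam * y t - cos t :=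
    mul_div_cancel₀ _ (by positivity)
  generalize -sin t / (3 * U t ^ 2 - lam) = V
  push_cast
  linear_combination w t * h4 + V * h3

theorem IsShot.cont_energy (h : IsShot lam ε y w) (hU : IsLowRoot lam U) :
    Continuous (energy lam ε U y w) := by
  have := h.cont_y
  have := h.cont_w
  have := hU.cont
  unfold energy
  fun_prop

theorem IsShot.cont_cofactor (h : IsShot lam ε y w) (hU : IsLowRoot lam U) :
    Continuous (cofactor lam U y) := by
  have := h.cont_y
  have := hU.cont
  unfold cofactor
  fun_prop

theorem abs_le_of_sq_lt (hlam : 0 < lam) (hU : IsLowRoot lam U) {t : ℝ} (ht : t ∈ Icc 0 (π / 2))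
    (hy : y t ^ 2 ≤ U t ^ 2) : |y t| ≤ lam + 1 := by
  have := hU.sq_le ht
  exact abs_le_of_sq_le_sq (by nlinarith) (by linarith)

/-- Below the value `U 0` the cofactor is bounded below. -/
theorem steep_le_cofactor (hU : IsLowRoot lam U) {t : ℝ} (ht : t ∈ Icc 0 (π / 2))
    (hy : y t ≤ U 0) : 3 * U 0 ^ 2 - lam ≤ cofactor lam U y t := by
  have h1 := hU.le_zero_val ht
  have h2 := hU.neg 0
  unfold cofactor
  nlinarith

/-- Below the low root the truncated force is negative. -/
theorem force_neg (hlam : 0 < lam) (hU : IsLowRoot lam U) {t v : ℝ} (ht : t ∈ Icc 0 (π / 2))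
    (hv : v < U t) : force lam t v < 0 := by
  have h1 := hU.neg t
  have h2 := hU.sq_le ht
  have h3 := hU.steep t
  have h4 : -(lam + 1) < U t := by nlinarith
  have h5 : clamp lam v < U t := by
    rw [clamp, min_eq_left (by linarith)]
    exact max_lt h4 hv
  have h6 : force lam t v =
      (clamp lam v - U t) * (clamp lam v ^ 2 + clamp lam v * U t + U t ^ 2 - lam) := by
    rw [force, ← hU.root t]
    ring
  rw [h6]
  refine mul_neg_of_neg_of_pos (by linarith) ?_
  nlinarith

/-- `s` is the first critical point of a shot, seen as the launching time of its oscillations. -/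
structure Launch (lam ε : ℝ) (U y w : ℝ → ℝ) (s : ℝ) : Prop where
  nonneg : 0 ≤ s
  le : s ≤ π / 2
  w_neg : ∀ t ∈ Ioo 0 s, w t < 0
  w_zero : w s = 0
  gap_pos : 0 < s → U s < y s
  start : s = 0 → y 0 = U 0
  low : ∀ t ∈ Icc 0 s, y t ≤ U 0
  sq_lt : ∀ t ∈ Ioc s (π / 2), y t ^ 2 < U t ^ 2
  energy_ge : -(ε ^ 2 / (3 * U 0 ^ 2 - lam) ^ 2) ≤ energy lam ε U y w s
  energy_le : energy lam ε U y w s ≤ 0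

theorem Launch.le_y {s : ℝ} (h : Launch lam ε U y w s) : U s ≤ y s := by
  rcases h.nonneg.eq_or_lt with h1 | h1
  · rw [← h1, h.start h1.symm]
  · exact (h.gap_pos h1).le

theorem Launch.sq_le {s : ℝ} (h : Launch lam ε U y w s) (hU : IsLowRoot lam U) {t : ℝ}
    (ht : t ∈ Icc s (π / 2)) : y t ^ 2 ≤ U t ^ 2 := by
  rcases ht.1.eq_or_lt with h1 | h1
  · have h2 := h.le_y
    have h3 := h.low s ⟨h.nonneg, le_rfl⟩
    have h4 := hU.neg 0
    subst h1
    nlinarith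
  · exact (h.sq_lt t ⟨h1, ht.2⟩).le

theorem Launch.lt_y {s : ℝ} (h : Launch lam ε U y w s) (hU : IsLowRoot lam U) {t : ℝ}
    (ht : t ∈ Ioc s (π / 2)) : U t < y t ∧ y t < -U t := by
  exact lt_and_lt_neg_of_sq_lt (hU.neg t) (h.sq_lt t ht)

theorem energy_lt_of_sq_lt (h : IsShot lam ε y w) (hlam : 0 < lam) (hε : 0 < ε)
    (hU : IsLowRoot lam U) {s t : ℝ} (hs : 0 ≤ s) (hst : s < t) (ht : t ≤ π / 2)
    (hle : ∀ r ∈ Icc s t, y r ^ 2 ≤ U r ^ 2) (hlt : ∀ r ∈ Ioo s t, y r ^ 2 < U r ^ 2) :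
    energy lam ε U y w t < energy lam ε U y w s := by
  have key := lt_of_hasDerivAt_pos (f := fun t => -energy lam ε U y w t)
    (f' := fun t => (y t - U t) * sin t) hst
    (fun r hr => by
      have hr' : r ∈ Icc 0 (π / 2) := ⟨hs.trans hr.1, hr.2.trans ht⟩
      have := (h.hasDerivAt_energy hε hU (mem_Icc_zero_pi hr')
        (abs_le_of_sq_lt hlam hU hr' (hle r hr))).neg
      rwa [neg_neg] at this)
    (fun r hr => by
      have h1 := lt_and_lt_neg_of_sq_lt (hU.neg r) (hlt r hr)
      exact mul_pos (by linarith) (sin_pos_of_mem_Ioo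
        ⟨by linarith [hr.1], by linarith [hr.2, pi_pos]⟩))
  linarith

theorem sq_lt_of_near (h : IsShot lam ε y w) (hlam : 0 < lam) (hε : 0 < ε)
    (hU : IsLowRoot lam U) {s : ℝ} (hs : 0 ≤ s) (hE : energy lam ε U y w s ≤ 0)
    (hnear : ∃ δ > 0, ∀ t ∈ Ioo s (s + δ), 0 < U t ^ 2 - y t ^ 2) :
    ∀ t ∈ Ioc s (π / 2), y t ^ 2 < U t ^ 2 := by
  have hc : Continuous fun t => U t ^ 2 - y t ^ 2 := by
    have := h.cont_y
    have := hU.cont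
    fun_prop
  have hs0 : 0 ≤ U s ^ 2 - y s ^ 2 := by
    obtain ⟨δ, hδ, h1⟩ := hnear
    exact nonneg_of_pos_right hc (lt_add_of_pos_right s hδ) fun r hr => (h1 r hr).le
  intro t ht
  refine sub_pos.mp (pos_of_step hc hnear (fun t ht hlt => ?_) t ht)
  have ht0 : 0 ≤ U t ^ 2 - y t ^ 2 := nonneg_of_pos_left hc ht.1 fun r hr => (hlt r hr).le
  have hEt := energy_lt_of_sq_lt h hlam hε hU hs ht.1 ht.2 (fun r hr => by
    rcases hr.1.eq_or_lt with h1 | h1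
    · rw [← h1]; linarith
    rcases hr.2.eq_or_lt with h2 | h2
    · rw [h2]; linarith
    · linarith [hlt r ⟨h1, h2⟩]) (fun _ hr => by linarith [hlt _ hr])
  refine lt_of_le_of_ne ht0 fun heq => ?_
  have h2 := hU.sq_le (⟨by linarith [ht.1], ht.2⟩ : t ∈ Icc 0 (π / 2))
  have h3 : 0 ≤ energy lam ε U y w t := by
    have h4 : (y t - U t) ^ 2 * (y t + U t) ^ 2 = 0 := by
      rw [← mul_pow, show (y t - U t) * (y t + U t) = 0 by linarith]
      norm_num
    have h5 : energy lam ε U y w t =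
        (ε * w t) ^ 2 / 2 + (y t - U t) ^ 2 * (lam - U t ^ 2) / 2 := by
      unfold energy
      linear_combination -h4 / 4
    rw [h5]
    have : 0 ≤ lam - U t ^ 2 := by linarith
    positivity
  linarith

theorem Launch.energy_lt {s : ℝ} (hL : Launch lam ε U y w s) (h : IsShot lam ε y w) (hlam : 0 < lam)
    (hε : 0 < ε) (hU : IsLowRoot lam U) {a b : ℝ} (ha : s ≤ a) (hab : a < b) (hb : b ≤ π / 2) :
    energy lam ε U y w b < energy lam ε U y w a :=
  energy_lt_of_sq_lt h hlam hε hU (hL.nonneg.trans ha) hab hb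
    (fun _ hr => hL.sq_le hU ⟨ha.trans hr.1, hr.2.trans hb⟩)
    (fun r hr => hL.sq_lt r ⟨ha.trans_lt hr.1, hr.2.le.trans hb⟩)

theorem Launch.energy_neg {s : ℝ} (hL : Launch lam ε U y w s) (h : IsShot lam ε y w)
    (hlam : 0 < lam)
    (hε : 0 < ε) (hU : IsLowRoot lam U) {t : ℝ} (ht : t ∈ Ioc s (π / 2)) :
    energy lam ε U y w t < 0 :=
  (hL.energy_lt h hlam hε hU le_rfl ht.1 ht.2).trans_le hL.energy_le

end

section

variable {lam ε : ℝ} {U y w : ℝ → ℝ}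

theorem launch_of_eq (h : IsShot lam ε y w) (hlam : 0 < lam) (hε : 0 < ε) (hU : IsLowRoot lam U)
    (h0 : y 0 = U 0) : Launch lam ε U y w 0 := by
  have hpi := pi_pos
  have hE : energy lam ε U y w 0 = 0 := by simp [energy, h0, h.w0]
  refine ⟨le_rfl, by positivity, fun t ht => absurd (ht.1.trans ht.2) (lt_irrefl _), h.w0,
    fun h => absurd h (lt_irrefl _), fun _ => h0, fun t ht => ?_, ?_, ?_, hE.le⟩
  · rw [Icc_self, mem_singleton_iff] at ht
    rw [ht, h0]
  · refine sq_lt_of_near h hlam hε hU le_rfl hE.le ?_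
    have hmem : (0 : ℝ) ∈ Icc 0 (π / 2) := ⟨le_rfl, by positivity⟩
    have hw := h.hw 0 (mem_Icc_zero_pi hmem)
    rw [force_eq_mul_cofactor hU (abs_le_of_sq_lt hlam hU hmem (by rw [h0])), h0, sub_self,
      zero_mul, zero_div] at hw
    have hD : ∀ t, HasDerivAt (fun t => y t - U t) (w t + sin t / (3 * U t ^ 2 - lam)) t :=
        fun t => by
      have := (h.hy t).sub (hU.deriv t)
      rwa [neg_div, sub_neg_eq_add] at this
    have hD' := hw.add ((hasDerivAt_sin 0).div
      ((((hU.deriv 0).pow 2).const_mul 3).sub_const lam) (hU.steep 0).ne')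
    simp only [sin_zero, cos_zero, zero_mul, sub_zero, one_mul, zero_add] at hD'
    have hpos := hU.steep 0
    obtain ⟨δ, hδ, h1, -⟩ := sign_near_of_hasDerivAt_pos hD' (by simp [h.w0]) (by positivity)
    have hcont : Continuous fun t => -U t - y t := by
      have := h.cont_y
      have := hU.cont
      fun_prop
    obtain ⟨δ', hδ', h2⟩ := pos_near_right hcont (s := 0) (by rw [h0]; linarith [hU.neg 0])
    refine ⟨min δ δ', lt_min hδ hδ', fun t ht => ?_⟩
    have h3 : t < δ := by linarith [ht.2, min_le_left δ δ']
    have h4 := h2 t ⟨ht.1, by linarith [ht.2, min_le_right δ δ']⟩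
    have h5 := lt_of_hasDerivAt_pos ht.1 (fun r _ => hD r)
      (fun r hr => h1 r ⟨hr.1, by linarith [hr.2]⟩)
    rw [h0, sub_self] at h5
    nlinarith
  · rw [hE, neg_nonpos]
    positivity

theorem neg_sqrt_le_lowRoot (hU : IsLowRoot lam U) {t : ℝ} (ht : t ∈ Icc 0 (π / 2)) :
    -√lam ≤ U t := by
  have := abs_le_sqrt (hU.sq_le ht)
  rw [abs_le] at this
  exact this.1

theorem neg_sqrt_lt_lowRoot_zero (hlam : 0 < lam) (hU : IsLowRoot lam U) : -√lam < U 0 := by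
  refine (neg_sqrt_le_lowRoot hU ⟨le_rfl, by linarith [pi_pos]⟩).lt_of_ne fun heq => ?_
  have h1 := hU.root 0
  rw [cos_zero, ← heq] at h1
  have h2 := sq_sqrt hlam.le
  have h3 : (-√lam) ^ 3 - lam * -√lam = 0 := by linear_combination (-√lam) * h2
  linarith

theorem launch_of_lt (h : IsShot lam ε y w) (hlam : 0 < lam) (hε : 0 < ε) (hU : IsLowRoot lam U)
    (h0 : y 0 < U 0) :
    (∀ t ∈ Ioc 0 (π / 2), w t < 0) ∨ ∃ s, 0 < s ∧ Launch lam ε U y w s := by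
  have hpi := pi_pos
  have hε2 : 0 < ε ^ 2 := by positivity
  by_cases hall : ∀ t ∈ Ioc 0 (π / 2), w t < 0
  · exact Or.inl hall
  refine Or.inr ?_
  push Not at hall
  obtain ⟨t0, ht0, hwt0⟩ := hall
  have hmem : (0 : ℝ) ∈ Icc 0 (π / 2) := ⟨le_rfl, by positivity⟩
  have hcnw : Continuous fun t => -w t := h.cont_w.neg
  obtain ⟨δ, hδ, h1, -⟩ := sign_near_of_hasDerivAt_pos (h.hw 0 (mem_Icc_zero_pi hmem)).neg
    (by simp [h.w0]) (by
      have := div_neg_of_neg_of_pos (force_neg hlam hU hmem h0) hε2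
      linarith)
  simp only [zero_add, Pi.neg_apply] at h1
  have hδt : δ / 2 ≤ t0 := by
    by_contra! hlt
    have := h1 t0 ⟨ht0.1, by linarith⟩
    linarith
  obtain ⟨s, hs, hs1, hs2⟩ := exists_first_nonpos hcnw (a := δ / 2) (b := π / 2) ⟨hδt, ht0.2⟩
    (by linarith)
  have hs0 : 0 < s := by linarith [hs.1]
  have hmems : s ∈ Icc 0 (π / 2) := ⟨hs0.le, hs.2⟩
  have hwneg : ∀ t ∈ Ioo 0 s, w t < 0 := fun t ht => by
    rcases lt_or_ge t (δ / 2) with h3 | h3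
    · linarith [h1 t ⟨ht.1, by linarith⟩]
    · linarith [hs2 t ⟨h3, ht.2⟩]
  have hws : w s = 0 := by
    have := nonneg_of_pos_left hcnw hs0 fun r hr => by linarith [hwneg r hr]
    linarith
  have hlow' : ∀ a ∈ Icc 0 s, ∀ b ∈ Icc 0 s, a ≤ b → y b ≤ y a := fun a ha b hb hab => by
    have := le_of_hasDerivAt_nonneg (f := fun t => -y t) (f' := fun t => -w t) hab
      (fun t _ => (h.hy t).neg)
      (fun t ht => by linarith [hwneg t ⟨ha.1.trans_lt ht.1, ht.2.trans_le hb.2⟩])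
    linarith
  have hlow : ∀ t ∈ Icc 0 s, y t ≤ U 0 := fun t ht =>
    (hlow' 0 ⟨le_rfl, hs0.le⟩ t ht ht.1).trans h0.le
  have hD : ∀ t, HasDerivAt (fun t => y t - U t) (w t + sin t / (3 * U t ^ 2 - lam)) t :=
      fun t => by
    have := (h.hy t).sub (hU.deriv t)
    rwa [neg_div, sub_neg_eq_add] at this
  have hDc : Continuous fun t => y t - U t := h.cont_y.sub hU.cont
  have hforce : 0 ≤ force lam s (y s) := by
    have := nonneg_of_hasDerivAt_of_le_left (h.hw s (mem_Icc_zero_pi hmems)) hs0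
      (fun t ht => by rw [hws]; exact (hwneg t ht).le)
    by_contra! hneg
    exact absurd this (not_le.mpr (div_neg_of_neg_of_pos hneg hε2))
  have hgap : U s < y s := by
    by_contra! hle
    rcases hle.lt_or_eq with hlt | heq
    · exact absurd hforce (not_le.mpr (force_neg hlam hU hmems hlt))
    · have hsin : 0 < sin s := sin_pos_of_pos_of_lt_pi hs0 (by linarith [hs.2])
      obtain ⟨d, hd, -, h3⟩ := sign_near_of_hasDerivAt_pos (hD s) (by simp [heq])
        (by rw [hws, zero_add]; exact div_pos hsin (hU.steep s))
      set a := max 0 (s - d) with ha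
      have has : a < s := max_lt hs0 (by linarith)
      set m := (a + s) / 2 with hm
      have ha0 : 0 ≤ a := le_max_left _ _
      have had : s - d ≤ a := le_max_right _ _
      have := lt_of_hasDerivAt_pos (f := fun t => -w t) (a := m) (b := s) (by linarith)
        (fun t ht => (h.hw t (mem_Icc_zero_pi ⟨by linarith [ht.1], ht.2.trans hs.2⟩)).neg)
        (fun t ht => by
          have h4 := force_neg hlam hU (t := t) (v := y t)
            ⟨by linarith [ht.1], by linarith [ht.2, hs.2]⟩
            (by linarith [h3 t ⟨by linarith [ht.1], ht.2⟩])
          have := div_neg_of_neg_of_pos h4 hε2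
          linarith)
      have h5 := hwneg m ⟨by linarith, by linarith⟩
      linarith
  have hU0 := hU.neg 0
  have hk := hU.steep 0
  have hUs := hU.le_zero_val hmems
  have hE : energy lam ε U y w s ≤ 0 := by
    have h2 := hlow s ⟨hs0.le, le_rfl⟩
    have h3 : 0 ≤ (y s + U s) ^ 2 - 2 * (lam - U s ^ 2) := by nlinarith
    have h4 : 0 ≤ (y s - U s) ^ 2 * ((y s + U s) ^ 2 - 2 * (lam - U s ^ 2)) := by positivity
    simp only [energy, hws]
    linarith
  refine ⟨s, hs0, hs0.le, hs.2, hwneg, hws, fun _ => hgap, fun h => absurd h hs0.ne', hlow,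
    sq_lt_of_near h hlam hε hU hs0.le hE ?_, ?_, hE⟩
  · obtain ⟨d, hd, h2⟩ := pos_near_right (g := fun t => U t ^ 2 - y t ^ 2)
      (by
        have := h.cont_y
        have := hU.cont
        fun_prop) (s := s) (by nlinarith [hlow s ⟨hs0.le, le_rfl⟩])
    exact ⟨d, hd, h2⟩
  · obtain ⟨r, hr, hr1, hr2⟩ := exists_last_nonpos hDc (a := 0) (b := s) (t := 0)
      ⟨le_rfl, hs0.le⟩ (by linarith)
    have hrs : r < s := by
      refine hr.2.lt_of_ne fun heq => ?_
      rw [heq] at hr1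
      linarith
    have hr0 : y r - U r = 0 := by
      refine le_antisymm hr1 (nonneg_of_pos_right hDc hrs fun x hx => (hr2 x ⟨hx.1, hx.2.le⟩).le)
    have hmem' : ∀ t ∈ Icc r s, t ∈ Icc 0 (π / 2) := fun t ht =>
      ⟨hr.1.trans ht.1, ht.2.trans hs.2⟩
    have hDnn : ∀ t ∈ Icc r s, 0 ≤ y t - U t := fun t ht => by
      rcases ht.1.eq_or_lt with h3 | h3
      · rw [← h3, hr0]
      · exact (hr2 t ⟨h3, ht.2⟩).le
    have hlow2 : ∀ t ∈ Icc r s, y t ≤ U 0 := fun t ht => hlow t ⟨hr.1.trans ht.1, ht.2⟩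
    have habs : ∀ t ∈ Icc r s, |y t| ≤ lam + 1 := fun t ht =>
      abs_le_of_sq_lt hlam hU (hmem' t ht) (by nlinarith [hDnn t ht, hlow2 t ht, hU.neg t])
    have hwr : -(1 / (3 * U 0 ^ 2 - lam)) ≤ w r := by
      have h3 := nonneg_of_hasDerivAt_of_le_right (hD r) hrs fun x hx => by
        rw [hr0]; exact (hr2 x ⟨hx.1, hx.2.le⟩).le
      have h4 : sin r / (3 * U r ^ 2 - lam) ≤ 1 / (3 * U 0 ^ 2 - lam) :=
        div_le_div₀ zero_le_one (sin_le_one r) hk (hU.steep_mono (hmem' r ⟨le_rfl, hrs.le⟩))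
      linarith
    have key := le_of_hasDerivAt_nonneg
      (f := fun t => energy lam ε U y w t + ε ^ 2 / (3 * U 0 ^ 2 - lam) * w t)
      (f' := fun t => -((y t - U t) * sin t) +
        ε ^ 2 / (3 * U 0 ^ 2 - lam) * (force lam t (y t) / ε ^ 2)) hrs.le
      (fun t ht => (h.hasDerivAt_energy hε hU (mem_Icc_zero_pi (hmem' t ht)) (habs t ht)).add
        ((h.hw t (mem_Icc_zero_pi (hmem' t ht))).const_mul _))
      (fun t ht => by
        have ht' := Ioo_subset_Icc_self ht
        have h3 : ε ^ 2 / (3 * U 0 ^ 2 - lam) * (force lam t (y t) / ε ^ 2) =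
            (y t - U t) * (cofactor lam U y t / (3 * U 0 ^ 2 - lam)) := by
          rw [force_eq_mul_cofactor hU (habs t ht')]
          field_simp
        have h4 : 1 ≤ cofactor lam U y t / (3 * U 0 ^ 2 - lam) := by
          rw [one_le_div hk]
          exact steep_le_cofactor hU (hmem' t ht') (hlow2 t ht')
        rw [h3]
        nlinarith [hDnn t ht', sin_le_one t])
    have hEr : 0 ≤ energy lam ε U y w r := by
      rw [energy, hr0]
      have : 0 ≤ ε ^ 2 * w r ^ 2 / 2 := by positivity
      linarith
    simp only [hws, mul_zero, add_zero] at key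
    have h5 : ε ^ 2 / (3 * U 0 ^ 2 - lam) * -(1 / (3 * U 0 ^ 2 - lam)) ≤
        ε ^ 2 / (3 * U 0 ^ 2 - lam) * w r := mul_le_mul_of_nonneg_left hwr (by positivity)
    have h6 : ε ^ 2 / (3 * U 0 ^ 2 - lam) * -(1 / (3 * U 0 ^ 2 - lam)) =
        -(ε ^ 2 / (3 * U 0 ^ 2 - lam) ^ 2) := by
      field_simp
    linarith

theorem Launch.y_le {s : ℝ} (hL : Launch lam ε U y w s) (h : IsShot lam ε y w) : y s ≤ y 0 := by
  have := le_of_hasDerivAt_nonneg (f := fun t => -y t) (f' := fun t => -w t) hL.nonneg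
    (fun t _ => (h.hy t).neg) (fun t ht => by linarith [hL.w_neg t ht])
  linarith

theorem not_launch_of_eq_neg_sqrt (h : IsShot lam ε y w) (hlam : 0 < lam) (hU : IsLowRoot lam U)
    (h0 : y 0 = -√lam) (s : ℝ) : ¬ Launch lam ε U y w s := by
  intro hL
  rcases hL.nonneg.eq_or_lt with h1 | h1
  · have := hL.start h1.symm
    linarith [neg_sqrt_lt_lowRoot_zero hlam hU]
  · have := hL.gap_pos h1
    have := neg_sqrt_le_lowRoot hU ⟨h1.le, hL.le⟩
    linarith [hL.y_le h]

theorem cofactor_pos_of_w_neg (h : IsShot lam ε y w) (hU : IsLowRoot lam U) (h0 : y 0 ≤ U 0)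
    (hw : ∀ t ∈ Ioc 0 (π / 2), w t < 0) : ∀ t ∈ Icc 0 (π / 2), 0 < cofactor lam U y t := by
  intro t ht
  have := le_of_hasDerivAt_nonneg (f := fun t => -y t) (f' := fun t => -w t) ht.1
    (fun t _ => (h.hy t).neg)
    (fun r hr => by linarith [hw r ⟨hr.1, by linarith [hr.2, ht.2]⟩])
  exact (hU.steep 0).trans_le (steep_le_cofactor hU ht (by linarith))

theorem exists_launch_or (h : IsShot lam ε y w) (hlam : 0 < lam) (hε : 0 < ε) (hU : IsLowRoot lam U)
    (h0 : y 0 ≤ U 0) :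
    (∀ t ∈ Icc 0 (π / 2), 0 < cofactor lam U y t) ∨ ∃ s, Launch lam ε U y w s := by
  rcases h0.eq_or_lt with h1 | h1
  · exact Or.inr ⟨0, launch_of_eq h hlam hε hU h1⟩
  · rcases launch_of_lt h hlam hε hU h1 with h2 | ⟨s, -, hs⟩
    · exact Or.inl (cofactor_pos_of_w_neg h hU h0 h2)
    · exact Or.inr ⟨s, hs⟩

end

/-- Near a zero of the cofactor `y² + u y + u² - lam` the potential is bounded below. -/
theorem potential_barrier {lam k u y : ℝ} (hlam : 0 < lam) (hk : 0 < k) (hk' : k ≤ 3 * u ^ 2 - lam)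
    (hu : u < 0) (hul : u ^ 2 ≤ lam) (hy : u < y) (hy' : y < -u)
    (hq : |y ^ 2 + u * y + u ^ 2 - lam| ≤ k / (24 * (lam + 1)) * (lam - u ^ 2)) :
    y ≤ 0 ∧ k ^ 3 / (1728 * lam) ≤ (y - u) ^ 2 * ((y + u) ^ 2 - 2 * (lam - u ^ 2)) / 4 := by
  set q := y ^ 2 + u * y + u ^ 2 - lam with hqd
  set e := lam - u ^ 2 with he
  have he0 : 0 ≤ e := by linarith
  have hk2 : k ≤ 2 * lam := by linarith
  have hc1 : k / (24 * (lam + 1)) ≤ 1 := by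
    rw [div_le_one (by positivity)]
    linarith
  have hce : k / (24 * (lam + 1)) * e ≤ k / 24 := by
    rw [div_mul_eq_mul_div, div_le_div_iff₀ (by positivity) (by norm_num)]
    nlinarith [sq_nonneg u]
  rw [abs_le] at hq
  have hq1 : -e ≤ q := by nlinarith
  have hq2 : -(k / 24) ≤ q := by linarith
  have hq3 : q ≤ k / 24 := by linarith
  have hy0 : y ≤ 0 := by
    have h1 : 0 ≤ (y + u) * y := by nlinarith
    by_contra! hpos
    nlinarith
  refine ⟨hy0, ?_⟩
  have hD : (y - u) * (-2 * u - y) = 3 * u ^ 2 - lam - q := by rw [hqd]; ring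
  have hDa : k / 2 ≤ (y - u) * (-3 * u) := by nlinarith
  have hP : k / 12 ≤ (y + u) ^ 2 - 2 * e := by
    have h1 : (y + u) ^ 2 - 2 * e = 3 * u ^ 2 - lam + u * (y - u) + q := by rw [hqd, he]; ring
    have h2 : (-u) * (y - u) * 2 ≤ 3 * u ^ 2 - lam - q := by nlinarith
    linarith
  have hD2 : k ^ 2 / (36 * lam) ≤ (y - u) ^ 2 := by
    rw [div_le_iff₀ (by positivity)]
    have h1 : (k / 2) ^ 2 ≤ ((y - u) * (-3 * u)) ^ 2 := pow_le_pow_left₀ (by positivity) hDa 2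
    nlinarith [sq_nonneg (y - u)]
  calc k ^ 3 / (1728 * lam) = k ^ 2 / (36 * lam) * (k / 12) / 4 := by field_simp; norm_num
    _ ≤ _ := by gcongr

/-- The nonlinear balance used to control the loss of energy along a shot. -/
theorem gap_mul_le {lam k u y E W : ℝ} (hlam : 0 < lam) (hk : 0 < k) (hk' : k ≤ 3 * u ^ 2 - lam)
    (hu : u < 0) (hul : u ^ 2 ≤ lam) (hy : u < y) (hy' : y < -u)
    (hE' : -(k ^ 3 / (3456 * lam)) ≤ E) (hW : 0 ≤ W)
    (h : E = W / 2 - (y - u) ^ 2 * ((y + u) ^ 2 - 2 * (lam - u ^ 2)) / 4) :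
    (lam - u ^ 2) * (y - u) ≤ (24 * (lam + 1) / k + 2 * lam * √lam / (k ^ 3 / (1728 * lam))) *
      (|(y - u) * (y ^ 2 + u * y + u ^ 2 - lam)| + W) := by
  have hD : 0 < y - u := by linarith
  have hη : 0 < k ^ 3 / (1728 * lam) := by positivity
  have hs := sqrt_nonneg lam
  have he : 0 ≤ lam - u ^ 2 := by linarith
  have huabs := abs_le.mp (abs_le_sqrt hul)
  have hF : 0 ≤ |(y - u) * (y ^ 2 + u * y + u ^ 2 - lam)| := abs_nonneg _
  rw [add_mul]
  by_cases hq : |y ^ 2 + u * y + u ^ 2 - lam| ≤ k / (24 * (lam + 1)) * (lam - u ^ 2)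
  · have h1 := (potential_barrier hlam hk hk' hu hul hy hy' hq).2
    have h2 : k ^ 3 / (3456 * lam) * 2 = k ^ 3 / (1728 * lam) := by field_simp; norm_num
    have h3 : k ^ 3 / (1728 * lam) ≤ W := by linarith
    have h4 : 2 * lam * √lam ≤ 2 * lam * √lam / (k ^ 3 / (1728 * lam)) * W := by
      rw [div_mul_eq_mul_div, le_div_iff₀ hη]
      gcongr
    have h5 : (lam - u ^ 2) * (y - u) ≤ lam * (2 * √lam) :=
      mul_le_mul (by linarith [sq_nonneg u]) (by linarith) hD.le hlam.le
    have h6 : 0 ≤ 24 * (lam + 1) / k * (|(y - u) * (y ^ 2 + u * y + u ^ 2 - lam)| + W) := by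
      positivity
    have h7 : 0 ≤ 2 * lam * √lam / (k ^ 3 / (1728 * lam)) *
      |(y - u) * (y ^ 2 + u * y + u ^ 2 - lam)| := by positivity
    linarith
  · push Not at hq
    have h1 : (lam - u ^ 2) ≤ 24 * (lam + 1) / k * |y ^ 2 + u * y + u ^ 2 - lam| := by
      rw [div_mul_eq_mul_div, div_lt_iff₀ (by positivity)] at hq
      rw [div_mul_eq_mul_div, le_div_iff₀ hk]
      linarith
    have h2 : (lam - u ^ 2) * (y - u) ≤
        24 * (lam + 1) / k * |(y - u) * (y ^ 2 + u * y + u ^ 2 - lam)| := by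
      rw [abs_mul, abs_of_pos hD]
      nlinarith
    have h3 : 0 ≤ 24 * (lam + 1) / k * W := by positivity
    have h4 : 0 ≤ 2 * lam * √lam / (k ^ 3 / (1728 * lam)) *
      (|(y - u) * (y ^ 2 + u * y + u ^ 2 - lam)| + W) := by positivity
    linarith

theorem one_sub_inv_sq_le {z : ℝ} (hz : 0 ≤ z) : 1 - 1 / (1 + z) ^ 2 ≤ 2 * z := by
  rw [sub_le_iff_le_add, ← sub_le_iff_le_add', le_div_iff₀ (by positivity)]
  nlinarith [mul_nonneg hz hz, mul_nonneg (mul_nonneg hz hz) hz]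

/-- Quantitative control of the energy between consecutive zeros of the cofactor. -/
structure IsDrift (lam : ℝ) (U : ℝ → ℝ) (η C : ℝ) (Ψ : ℝ → ℝ) : Prop where
  η_pos : 0 < η
  C_pos : 0 < C
  Ψ_nonneg : ∀ t ∈ Icc 0 (π / 2), 0 ≤ Ψ t
  Ψ_le : ∀ t ∈ Icc 0 (π / 2), Ψ t ≤ η / 4
  barrier : ∀ {ε s : ℝ} {y w : ℝ → ℝ}, 0 < ε → IsShot lam ε y w → Launch lam ε U y w s →
    ∀ t ∈ Ioc s (π / 2), -η ≤ energy lam ε U y w t → cofactor lam U y t = 0 →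
      y t ≤ 0 ∧ 2 * η ≤ ε ^ 2 * w t ^ 2
  balance : ∃ K > 0, ∀ {ε s : ℝ} {y w : ℝ → ℝ}, Launch lam ε U y w s →
    ∀ t ∈ Ioc s (π / 2), -η ≤ energy lam ε U y w t → (lam - U t ^ 2) * (y t - U t) ≤
      K * (|(y t - U t) * cofactor lam U y t| + ε ^ 2 * w t ^ 2)
  drift : ∀ {ε s : ℝ} {y w : ℝ → ℝ}, 0 < ε → IsShot lam ε y w → Launch lam ε U y w s →
    ∀ p r, s ≤ p → p ≤ r → r ≤ π / 2 → (∀ t ∈ Ioo p r, -η ≤ energy lam ε U y w t) →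
      ∀ σ : ℝ, |σ| = 1 → (∀ t ∈ Ioo p r, 0 ≤ σ * cofactor lam U y t) →
        energy lam ε U y w p + Ψ p - C * ε ≤ energy lam ε U y w r + Ψ r

section

variable {lam ε : ℝ} {U y w : ℝ → ℝ}

theorem Launch.mem {s : ℝ} (hL : Launch lam ε U y w s) {t : ℝ} (ht : t ∈ Icc s (π / 2)) :
    t ∈ Icc 0 (π / 2) := ⟨hL.nonneg.trans ht.1, ht.2⟩

theorem Launch.abs_y_le {s : ℝ} (hL : Launch lam ε U y w s) (hU : IsLowRoot lam U) {t : ℝ}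
    (ht : t ∈ Icc s (π / 2)) : |y t| ≤ √lam :=
  abs_le_sqrt ((hL.sq_le hU ht).trans (hU.sq_le (hL.mem ht)))

theorem Launch.energy_nonpos {s : ℝ} (hL : Launch lam ε U y w s) (h : IsShot lam ε y w)
    (hlam : 0 < lam) (hε : 0 < ε) (hU : IsLowRoot lam U) {t : ℝ} (ht : t ∈ Icc s (π / 2)) :
    energy lam ε U y w t ≤ 0 := by
  rcases ht.1.eq_or_lt with h1 | h1
  · rw [← h1]; exact hL.energy_le
  · exact (hL.energy_neg h hlam hε hU ⟨h1, ht.2⟩).le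

theorem Launch.abs_w_le {s : ℝ} (hL : Launch lam ε U y w s) (h : IsShot lam ε y w)
    (hlam : 0 < lam) (hε : 0 < ε) (hU : IsLowRoot lam U) {t : ℝ} (ht : t ∈ Icc s (π / 2)) :
    ε * |w t| ≤ lam := by
  have h1 := hL.energy_nonpos h hlam hε hU ht
  have h2 := hL.sq_le hU ht
  have h3 := hU.sq_le (hL.mem ht)
  unfold energy at h1
  have h4 : (ε * |w t|) ^ 2 = ε ^ 2 * w t ^ 2 := by rw [mul_pow, sq_abs]
  have h5 : (y t - U t) ^ 2 * (y t + U t) ^ 2 = (U t ^ 2 - y t ^ 2) ^ 2 := by ring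
  have h6 : 0 ≤ (y t - U t) ^ 2 * (lam - U t ^ 2) := mul_nonneg (sq_nonneg _) (by linarith)
  have h7 : (U t ^ 2 - y t ^ 2) ^ 2 ≤ lam ^ 2 :=
    pow_le_pow_left₀ (by linarith) (by linarith [sq_nonneg (y t)]) 2
  refine le_of_sq_le_sq ?_ hlam.le
  nlinarith [sq_nonneg lam]

end

theorem exists_isDrift {lam : ℝ} {U : ℝ → ℝ} (hlam : 0 < lam) (hU : IsLowRoot lam U) :
    ∃ η C Ψ, IsDrift lam U η C Ψ := by
  set k := 3 * U 0 ^ 2 - lam with hk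
  have hk0 : 0 < k := hU.steep 0
  have hsl : 0 < √lam := sqrt_pos.mpr hlam
  set η := k ^ 3 / (3456 * lam) with hη
  have hη0 : 0 < η := by positivity
  set N := 8 * √lam / η with hN
  have hN0 : 0 < N := by positivity
  set C₁ := 24 * (lam + 1) / k + 2 * lam * √lam / (k ^ 3 / (1728 * lam)) with hC₁
  have hC₁0 : 0 < C₁ := by positivity
  set C₃ := 2 * N * √lam * C₁ with hC₃
  have hC₃0 : 0 < C₃ := by positivity
  set B := √lam + 1 with hB
  have hB0 : 0 < B := by positivity
  have hcos : ∀ t ∈ Icc 0 (π / 2), 0 ≤ cos t := fun t ht =>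
    cos_nonneg_of_mem_Icc ⟨by linarith [ht.1, pi_pos], ht.2⟩
  have hη2 : k ^ 3 / (1728 * lam) = 2 * η := by rw [hη]; field_simp; norm_num
  refine ⟨η, 4 * C₃ * B * lam, fun t => 2 * √lam / N / (1 + N * cos t), hη0, by positivity,
    fun t ht => ?_, fun t ht => ?_, ?_, ⟨C₁, hC₁0, ?_⟩, ?_⟩
  · have := hcos t ht
    positivity
  · have h1 := hcos t ht
    have h2 : 2 * √lam / N = η / 4 := by rw [hN]; field_simp; norm_num
    rw [h2, div_le_iff₀ (by positivity)]
    have : 0 ≤ N * cos t := by positivity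
    nlinarith
  · intro ε s y w hε h hL t ht hE hq
    have ht' : t ∈ Icc 0 (π / 2) := hL.mem ⟨ht.1.le, ht.2⟩
    have h1 := lt_and_lt_neg_of_sq_lt (hU.neg t) (hL.sq_lt t ht)
    have h2 := hU.sq_le ht'
    have h3 := potential_barrier hlam hk0 (hU.steep_mono ht') (hU.neg t) h2 h1.1 h1.2
      (y := y t) (by
        unfold cofactor at hq
        rw [hq, abs_zero]
        exact mul_nonneg (by positivity) (by linarith))
    rw [hη2] at h3
    refine ⟨h3.1, ?_⟩
    unfold energy at hE
    linarith [h3.2]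
  · intro ε s y w hL t ht hE
    have ht' : t ∈ Icc 0 (π / 2) := hL.mem ⟨ht.1.le, ht.2⟩
    have h1 := lt_and_lt_neg_of_sq_lt (hU.neg t) (hL.sq_lt t ht)
    exact gap_mul_le hlam hk0 (hU.steep_mono ht') (hU.neg t) (hU.sq_le ht') h1.1 h1.2 hE
      (by positivity) rfl
  · intro ε s y w hε h hL p r hsp hpr hr hE σ hσ hq
    set f : ℝ → ℝ := fun t => (y t - U t) * cofactor lam U y t with hf
    have hmem : ∀ t ∈ Icc p r, t ∈ Icc s (π / 2) := fun t ht => ⟨hsp.trans ht.1, ht.2.trans hr⟩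
    have hσ2 : σ ^ 2 = 1 := by rw [← sq_abs, hσ, one_pow]
    have hΨ : ∀ t ∈ Icc p r, HasDerivAt (fun t => 2 * √lam / N / (1 + N * cos t))
        (2 * √lam * sin t / (1 + N * cos t) ^ 2) t := fun t ht => by
      have h1 := hcos t (hL.mem (hmem t ht))
      have h2 := (((hasDerivAt_cos t).const_mul N).const_add 1).inv
        (by positivity : 1 + N * cos t ≠ 0)
      have h3 := h2.const_mul (2 * √lam / N)
      refine (h3.congr_deriv ?_)
      field_simp
    have hw : ∀ t ∈ Icc p r, HasDerivAt (fun t => ε ^ 2 * ((y t + σ * B) * w t))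
        (ε ^ 2 * w t ^ 2 + (y t + σ * B) * f t) t := fun t ht => by
      have ht' := hL.mem (hmem t ht)
      have h1 := h.hw t (mem_Icc_zero_pi ht')
      rw [force_eq_mul_cofactor hU (abs_le_of_sq_lt hlam hU ht' (hL.sq_le hU (hmem t ht)))] at h1
      have h2 := (((h.hy t).add_const (σ * B)).mul h1).const_mul (ε ^ 2)
      refine h2.congr_deriv ?_
      simp only [hf]
      field_simp
    have key := le_of_hasDerivAt_nonneg
      (f := fun t => energy lam ε U y w t + 2 * √lam / N / (1 + N * cos t) +
        C₃ * (ε ^ 2 * ((y t + σ * B) * w t)))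
      (f' := fun t => -((y t - U t) * sin t) + 2 * √lam * sin t / (1 + N * cos t) ^ 2 +
        C₃ * (ε ^ 2 * w t ^ 2 + (y t + σ * B) * f t)) hpr
      (fun t ht => ((h.hasDerivAt_energy hε hU (mem_Icc_zero_pi (hL.mem (hmem t ht)))
        (abs_le_of_sq_lt hlam hU (hL.mem (hmem t ht)) (hL.sq_le hU (hmem t ht)))).add
        (hΨ t ht)).add ((hw t ht).const_mul C₃))
      (fun t ht => by
        have htc := Ioo_subset_Icc_self ht
        have ht' := hL.mem (hmem t htc)
        have hts : t ∈ Ioc s (π / 2) := ⟨hsp.trans_lt ht.1, ht.2.le.trans hr⟩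
        have h1 := lt_and_lt_neg_of_sq_lt (hU.neg t) (hL.sq_lt t hts)
        have h2 := hU.sq_le ht'
        have hU1 := abs_le.mp (abs_le_sqrt h2)
        have hc := hcos t ht'
        have hsin : 0 ≤ sin t := sin_nonneg_of_mem_Icc (mem_Icc_zero_pi ht')
        have hbal := gap_mul_le hlam hk0 (hU.steep_mono ht') (hU.neg t) h2 h1.1 h1.2
          (E := energy lam ε U y w t) (W := ε ^ 2 * w t ^ 2) (hE t ht) (by positivity) rfl
        rw [← hC₁] at hbal
        have hfabs : |(y t - U t) * (y t ^ 2 + U t * y t + U t ^ 2 - lam)| = σ * f t := by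
          have h4 : 0 ≤ σ * f t := by
            have := mul_nonneg (by linarith [h1.1] : 0 ≤ y t - U t) (hq t ht)
            simp only [hf]
            linarith
          rw [← abs_of_nonneg h4, abs_mul σ, hσ, one_mul]
          rfl
        rw [hfabs] at hbal
        have hF : σ * f t ≤ (y t + σ * B) * f t := by
          have h4 := hL.abs_y_le hU (hmem t htc)
          have h5 : (y t + σ * B) * f t - σ * f t = (√lam + y t * σ) * (σ * f t) := by
            rw [hB]
            linear_combination (-(y t * f t)) * hσ2
          have h6 : |y t * σ| ≤ √lam := by rw [abs_mul, hσ, mul_one]; exact h4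
          have h7 := mul_nonneg (by linarith [(abs_le.mp h6).1] : 0 ≤ √lam + y t * σ)
            (hfabs ▸ abs_nonneg _ : 0 ≤ σ * f t)
          linarith
        have hD : (y t - U t) * sin t - 2 * √lam * sin t / (1 + N * cos t) ^ 2 ≤
            2 * N * √lam * ((lam - U t ^ 2) * (y t - U t)) := by
          have h4 := one_sub_inv_sq_le (mul_nonneg hN0.le hc)
          have h5 : (y t - U t) * sin t - 2 * √lam * sin t / (1 + N * cos t) ^ 2 ≤
              (y t - U t) * sin t * (1 - 1 / (1 + N * cos t) ^ 2) := by
            have h6 : (y t - U t) * (sin t / (1 + N * cos t) ^ 2) ≤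
                2 * √lam * (sin t / (1 + N * cos t) ^ 2) :=
              mul_le_mul_of_nonneg_right (by linarith) (by positivity)
            rw [mul_div_assoc, mul_sub, mul_one, mul_assoc (y t - U t), mul_one_div]
            linarith
          have h7 : (y t - U t) * sin t * (1 - 1 / (1 + N * cos t) ^ 2) ≤
              (y t - U t) * sin t * (2 * (N * cos t)) :=
            mul_le_mul_of_nonneg_left h4 (mul_nonneg (by linarith) hsin)
          have h8 : (y t - U t) * sin t * (2 * (N * cos t)) ≤
              (y t - U t) * 1 * (2 * (N * cos t)) := by
            have : 0 ≤ y t - U t := by linarith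
            have := sin_le_one t
            gcongr
          have h9 : cos t ≤ √lam * (lam - U t ^ 2) := by
            rw [← hU.root t]
            have : U t ^ 3 - lam * U t = (-U t) * (lam - U t ^ 2) := by ring
            rw [this]
            exact mul_le_mul_of_nonneg_right (by linarith) (by linarith)
          have h10 : (y t - U t) * 1 * (2 * (N * cos t)) ≤
              (y t - U t) * 1 * (2 * (N * (√lam * (lam - U t ^ 2)))) := by
            have : 0 ≤ y t - U t := by linarith
            gcongr
          linarith
        have hlast : 2 * N * √lam * ((lam - U t ^ 2) * (y t - U t)) ≤
            C₃ * (σ * f t + ε ^ 2 * w t ^ 2) := by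
          rw [hC₃, mul_assoc (2 * N * √lam) C₁]
          exact mul_le_mul_of_nonneg_left hbal (by positivity)
        have h11 := mul_le_mul_of_nonneg_left hF hC₃0.le
        linarith)
    have hend : ∀ t ∈ Icc p r, |C₃ * (ε ^ 2 * ((y t + σ * B) * w t))| ≤ 2 * C₃ * B * lam * ε :=
      fun t ht => by
        have h4 := hL.abs_y_le hU (hmem t ht)
        have h5 := hL.abs_w_le h hlam hε hU (hmem t ht)
        have h6 : |y t + σ * B| ≤ 2 * B := by
          refine (abs_add_le _ _).trans ?_
          rw [abs_mul, hσ, abs_of_pos hB0]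
          linarith
        rw [abs_mul, abs_of_pos hC₃0, abs_mul, abs_of_pos (by positivity : 0 < ε ^ 2), abs_mul]
        calc C₃ * (ε ^ 2 * (|y t + σ * B| * |w t|)) = C₃ * ε * (|y t + σ * B| * (ε * |w t|)) := by
              ring
          _ ≤ C₃ * ε * (2 * B * lam) := by gcongr
          _ = _ := by ring
    have e1 := (abs_le.mp (hend p ⟨le_rfl, hpr⟩)).1
    have e2 := (abs_le.mp (hend r ⟨hpr, le_rfl⟩)).2
    linarith

/-- `ε` is small enough to follow `N` oscillations. -/
structure IsSmall (lam : ℝ) (U : ℝ → ℝ) (η C : ℝ) (N : ℕ) (ε : ℝ) : Prop where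
  pos : 0 < ε
  budget : ε ^ 2 / (3 * U 0 ^ 2 - lam) ^ 2 + (N + 1) * C * ε ≤ η / 4
  slope : 9 * lam * ε ^ 2 < 2 * η * U 0 ^ 2 * (3 * U 0 ^ 2 - lam) ^ 2

/-- The cofactor has exactly `n` zeros `z 1 < ⋯ < z n` between the launching time `s = z 0` and
`z n`, and the energy stays above the barrier. -/
structure RootChain (lam ε : ℝ) (U y w : ℝ → ℝ) (η C : ℝ) (Ψ : ℝ → ℝ) (s : ℝ) (n : ℕ)
    (z : ℕ → ℝ) : Prop where
  zero : z 0 = s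
  lt : ∀ i < n, z i < z (i + 1)
  le : z n ≤ π / 2
  root : ∀ i < n, cofactor lam U y (z (i + 1)) = 0
  sign : ∀ i < n, ∀ t ∈ Ioo (z i) (z (i + 1)), 0 < (-1) ^ i * cofactor lam U y t
  near : z n < π / 2 → ∃ δ > 0, ∀ t ∈ Ioo (z n) (z n + δ), 0 < (-1) ^ n * cofactor lam U y t
  energy_ge : -η ≤ energy lam ε U y w (z n)
  energy_loss : energy lam ε U y w s - n * (C * ε) ≤ energy lam ε U y w (z n) + Ψ (z n)

section

variable {lam ε η C : ℝ} {U y w Ψ : ℝ → ℝ} {s : ℝ} {N n : ℕ} {z : ℕ → ℝ}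

theorem RootChain.le_of_le (hz : RootChain lam ε U y w η C Ψ s n z) {i j : ℕ} (hij : i ≤ j)
    (hj : j ≤ n) : z i ≤ z j := by
  induction j, hij using Nat.le_induction with
  | base => exact le_rfl
  | succ j _ ih => exact (ih (by omega)).trans (hz.lt j (by omega)).le

theorem RootChain.start_le (hz : RootChain lam ε U y w η C Ψ s n z) {i : ℕ} (hi : i ≤ n) :
    s ≤ z i :=
  hz.zero ▸ hz.le_of_le (Nat.zero_le i) hi

theorem IsShot.hasDerivAt_cofactor (h : IsShot lam ε y w) (hU : IsLowRoot lam U) (t : ℝ) :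
    HasDerivAt (cofactor lam U y) ((2 * y t + U t) * w t +
      (y t + 2 * U t) * (-sin t / (3 * U t ^ 2 - lam))) t := by
  have hy := h.hy t
  have hU' := hU.deriv t
  have h1 := (((hy.pow 2).add (hU'.mul hy)).add (hU'.pow 2)).sub_const lam
  refine HasDerivAt.congr_deriv h1 ?_
  push_cast
  ring

/-- Zeros of the cofactor above the energy barrier are transversal. -/
theorem exists_deriv_cofactor_mul_neg (hd : IsDrift lam U η C Ψ) (hlam : 0 < lam)
    (hU : IsLowRoot lam U) (hs : IsSmall lam U η C N ε) (h : IsShot lam ε y w)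
    (hL : Launch lam ε U y w s) {t : ℝ} (ht : t ∈ Ioc s (π / 2))
    (hE : -η ≤ energy lam ε U y w t) (hq : cofactor lam U y t = 0) :
    ∃ q', HasDerivAt (cofactor lam U y) q' t ∧ q' * w t < 0 := by
  refine ⟨_, h.hasDerivAt_cofactor hU t, ?_⟩
  obtain ⟨hy, hw⟩ := hd.barrier hs.pos h hL t ht hE hq
  have ht' := hL.mem ⟨ht.1.le, ht.2⟩
  have hε := hs.pos
  have hU0 := hU.neg 0
  have hUt := hU.le_zero_val ht'
  have hk := hU.steep 0
  have hkt := hU.steep_mono ht'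
  set A := 2 * y t + U t with hA
  set B := (y t + 2 * U t) * (-sin t / (3 * U t ^ 2 - lam)) with hB
  have hAU : A ≤ U 0 := by linarith
  have hB2 : B ^ 2 * (3 * U 0 ^ 2 - lam) ^ 2 ≤ 9 * lam := by
    have h1 : (y t + 2 * U t) ^ 2 ≤ 9 * lam := by
      have h2 := hU.sq_le ht'
      have h3 := hL.sq_le hU ⟨ht.1.le, ht.2⟩
      nlinarith [sq_nonneg (y t - U t)]
    have h2 : (-sin t / (3 * U t ^ 2 - lam)) ^ 2 * (3 * U 0 ^ 2 - lam) ^ 2 ≤ 1 := by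
      rw [div_pow, div_mul_eq_mul_div, div_le_one (by nlinarith), neg_sq]
      have h3 : (3 * U 0 ^ 2 - lam) ^ 2 ≤ (3 * U t ^ 2 - lam) ^ 2 := pow_le_pow_left₀ hk.le hkt 2
      nlinarith [sin_sq_le_one t, sq_nonneg (3 * U 0 ^ 2 - lam)]
    calc B ^ 2 * (3 * U 0 ^ 2 - lam) ^ 2 = (y t + 2 * U t) ^ 2 *
          ((-sin t / (3 * U t ^ 2 - lam)) ^ 2 * (3 * U 0 ^ 2 - lam) ^ 2) := by rw [hB]; ring
      _ ≤ 9 * lam * 1 := by gcongr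
      _ = _ := by ring
  have hAB : B ^ 2 < (A * w t) ^ 2 := by
    have h1 : U 0 ^ 2 ≤ A ^ 2 := by nlinarith
    have h2 : B ^ 2 * (3 * U 0 ^ 2 - lam) ^ 2 * ε ^ 2 <
        (A * w t) ^ 2 * (3 * U 0 ^ 2 - lam) ^ 2 * ε ^ 2 := by
      calc B ^ 2 * (3 * U 0 ^ 2 - lam) ^ 2 * ε ^ 2 ≤ 9 * lam * ε ^ 2 := by gcongr
        _ < 2 * η * U 0 ^ 2 * (3 * U 0 ^ 2 - lam) ^ 2 := hs.slope
        _ ≤ ε ^ 2 * w t ^ 2 * A ^ 2 * (3 * U 0 ^ 2 - lam) ^ 2 := by gcongr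
        _ = _ := by ring
    have h3 := lt_of_mul_lt_mul_right h2 (by positivity)
    exact lt_of_mul_lt_mul_right h3 (by positivity)
  have hlt := sq_lt_sq.mp hAB
  rw [abs_mul A (w t), abs_of_neg (by linarith : A < 0)] at hlt
  have hw0 : 0 < |w t| := by
    rw [abs_pos]
    rintro h0
    rw [h0] at hw
    linarith [hd.η_pos]
  have h4 : B * w t ≤ |B| * |w t| := by rw [← abs_mul]; exact le_abs_self _
  have h5 : |B| * |w t| < -A * |w t| * |w t| := mul_lt_mul_of_pos_right hlt hw0
  have h6 : |w t| * |w t| = w t * w t := abs_mul_abs_self _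
  rw [mul_assoc, h6] at h5
  linarith

theorem energy_ge_of_sign (hd : IsDrift lam U η C Ψ) (hlam : 0 < lam) (hε : 0 < ε)
    (hU : IsLowRoot lam U) (h : IsShot lam ε y w) (hL : Launch lam ε U y w s) {p r σ : ℝ}
    (hp : s ≤ p) (hpr : p ≤ r) (hr : r ≤ π / 2) (hσ : |σ| = 1)
    (hb : -(η / 2) ≤ energy lam ε U y w p + Ψ p - C * ε) (hEp : -η ≤ energy lam ε U y w p)
    (hq : ∀ t ∈ Ioo p r, 0 ≤ σ * cofactor lam U y t) : -η ≤ energy lam ε U y w r := by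
  by_contra! hneg
  obtain ⟨x, hx, hxE⟩ := intermediate_value_Icc' hpr (h.cont_energy hU).continuousOn
    (⟨hneg.le, hEp⟩ : -η ∈ Icc (energy lam ε U y w r) (energy lam ε U y w p))
  have h1 := hd.drift hε h hL p x hp hx.1 (hx.2.trans hr) (fun t ht => by
    rw [← hxE]
    exact (hL.energy_lt h hlam hε hU (hp.trans ht.1.le) ht.2 (hx.2.trans hr)).le) σ hσ
    (fun t ht => hq t ⟨ht.1, ht.2.trans_le hx.2⟩)
  have h2 := hd.Ψ_le x ⟨hL.nonneg.trans (hp.trans hx.1), hx.2.trans hr⟩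
  have := hd.η_pos
  linarith

theorem exists_next_root_or (hd : IsDrift lam U η C Ψ) (hlam : 0 < lam) (hε : 0 < ε)
    (hU : IsLowRoot lam U) (h : IsShot lam ε y w) (hL : Launch lam ε U y w s) {p σ : ℝ}
    (hp : s ≤ p) (hpr : p < π / 2) (hσ : |σ| = 1)
    (hb : -(η / 2) ≤ energy lam ε U y w p + Ψ p - C * ε) (hEp : -η ≤ energy lam ε U y w p)
    (hnear : ∃ δ > 0, ∀ t ∈ Ioo p (p + δ), 0 < σ * cofactor lam U y t) :
    (∃ r ∈ Ioc p (π / 2), cofactor lam U y r = 0 ∧ (∀ t ∈ Ioo p r, 0 < σ * cofactor lam U y t) ∧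
      -η ≤ energy lam ε U y w r ∧
      energy lam ε U y w p + Ψ p - C * ε ≤ energy lam ε U y w r + Ψ r) ∨
    ((∀ t ∈ Ioc p (π / 2), 0 < σ * cofactor lam U y t) ∧ -η ≤ energy lam ε U y w (π / 2)) := by
  by_cases hall : ∀ t ∈ Ioc p (π / 2), 0 < σ * cofactor lam U y t
  · exact Or.inr ⟨hall, energy_ge_of_sign hd hlam hε hU h hL hp hpr.le le_rfl hσ hb hEp
      fun t ht => (hall t ⟨ht.1, ht.2.le⟩).le⟩
  left
  push Not at hall
  obtain ⟨t0, ht0, hq0⟩ := hall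
  obtain ⟨δ, hδ, hnear⟩ := hnear
  have hc : Continuous fun t => σ * cofactor lam U y t :=
    continuous_const.mul (h.cont_cofactor hU)
  have hδt : p + δ / 2 ≤ t0 := by
    by_contra! hlt
    have := hnear t0 ⟨ht0.1, by linarith⟩
    linarith
  obtain ⟨r, hr, hr1, hr2⟩ := exists_first_nonpos hc (a := p + δ / 2) (b := π / 2) ⟨hδt, ht0.2⟩ hq0
  have hpr' : p < r := by linarith [hr.1]
  have hsg : ∀ t ∈ Ioo p r, 0 < σ * cofactor lam U y t := fun t ht => by
    rcases lt_or_ge t (p + δ / 2) with h1 | h1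
    · exact hnear t ⟨ht.1, by linarith⟩
    · exact hr2 t ⟨h1, ht.2⟩
  have hz : σ * cofactor lam U y r = 0 :=
    le_antisymm hr1 (nonneg_of_pos_left hc hpr' fun t ht => (hsg t ht).le)
  have hσ0 : σ ≠ 0 := by rintro rfl; simp at hσ
  have hE := energy_ge_of_sign hd hlam hε hU h hL hp hpr'.le hr.2 hσ hb hEp
    fun t ht => (hsg t ht).le
  refine ⟨r, ⟨hpr', hr.2⟩, (mul_eq_zero.mp hz).resolve_left hσ0, hsg, hE, ?_⟩
  exact hd.drift hε h hL p r hp hpr'.le hr.2 (fun t ht => hE.trans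
    (hL.energy_lt h hlam hε hU (hp.trans ht.1.le) ht.2 hr.2).le) σ hσ fun t ht => (hsg t ht).le

theorem Launch.cofactor_pos (hL : Launch lam ε U y w s) (hU : IsLowRoot lam U) {t : ℝ}
    (ht : t ∈ Icc 0 s) : 0 < cofactor lam U y t :=
  (hU.steep 0).trans_le (steep_le_cofactor hU ⟨ht.1, ht.2.trans hL.le⟩ (hL.low t ht))

theorem rootChain_zero (hd : IsDrift lam U η C Ψ) (hU : IsLowRoot lam U)
    (hs : IsSmall lam U η C N ε) (h : IsShot lam ε y w) (hL : Launch lam ε U y w s) :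
    RootChain lam ε U y w η C Ψ s 0 fun _ => s := by
  have hη := hd.η_pos
  have hC := hd.C_pos
  have hε := hs.pos
  have hb := hs.budget
  have hCN : 0 ≤ (N + 1) * C * ε := by positivity
  refine ⟨rfl, fun i hi => absurd hi (Nat.not_lt_zero i), hL.le,
    fun i hi => absurd hi (Nat.not_lt_zero i), fun i hi => absurd hi (Nat.not_lt_zero i),
    fun _ => ?_, by linarith [hL.energy_ge], ?_⟩
  · simp only [pow_zero, one_mul]
    exact pos_near_right (h.cont_cofactor hU) (hL.cofactor_pos hU ⟨hL.nonneg, le_rfl⟩)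
  · have := hd.Ψ_nonneg s ⟨hL.nonneg, hL.le⟩
    simp only [Nat.cast_zero, zero_mul]
    linarith

theorem RootChain.succ_or (hz : RootChain lam ε U y w η C Ψ s n z) (hd : IsDrift lam U η C Ψ)
    (hlam : 0 < lam) (hU : IsLowRoot lam U) (hs : IsSmall lam U η C N ε) (hn : n ≤ N)
    (h : IsShot lam ε y w) (hL : Launch lam ε U y w s) (hlt : z n < π / 2) :
    (∃ r, z n < r ∧ RootChain lam ε U y w η C Ψ s (n + 1) fun i => if i ≤ n then z i else r) ∨
    ((∀ t ∈ Ioc (z n) (π / 2), 0 < (-1) ^ n * cofactor lam U y t) ∧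
      -η ≤ energy lam ε U y w (π / 2)) := by
  have hσ : |((-1 : ℝ)) ^ n| = 1 := by simp
  have hb : -(η / 2) ≤ energy lam ε U y w (z n) + Ψ (z n) - C * ε := by
    have h1 := hz.energy_loss
    have h2 := hL.energy_ge
    have h3 := hs.budget
    have h4 : (n : ℝ) * (C * ε) ≤ N * (C * ε) :=
      mul_le_mul_of_nonneg_right (by exact_mod_cast hn) (mul_pos hd.C_pos hs.pos).le
    linarith [hd.η_pos]
  rcases exists_next_root_or hd hlam hs.pos hU h hL (hz.start_le le_rfl) hlt hσ hb hz.energy_ge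
    (hz.near hlt) with ⟨r, hr, hr0, hsg, hE, hloss⟩ | h1
  · refine Or.inl ⟨r, hr.1, ⟨by simp [hz.zero], fun i hi => ?_, by simp [hr.2], fun i hi => ?_,
      fun i hi => ?_, fun hlt' => ?_, by simpa using hE, ?_⟩⟩
    · rcases Nat.lt_succ_iff_lt_or_eq.mp hi with h2 | rfl
      · rw [if_pos h2.le, if_pos (by omega)]
        exact hz.lt i h2
      · rw [if_pos le_rfl, if_neg (by omega)]
        exact hr.1
    · rcases Nat.lt_succ_iff_lt_or_eq.mp hi with h2 | rfl
      · rw [if_pos (by omega)]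
        exact hz.root i h2
      · rw [if_neg (by omega)]
        exact hr0
    · rcases Nat.lt_succ_iff_lt_or_eq.mp hi with h2 | rfl
      · rw [if_pos h2.le, if_pos (by omega)]
        exact hz.sign i h2
      · rw [if_pos le_rfl, if_neg (by omega)]
        exact hsg
    · simp only [if_neg (show ¬ n + 1 ≤ n by omega)]
      have hrs : r ∈ Ioc s (π / 2) := ⟨(hz.start_le le_rfl).trans_lt hr.1, hr.2⟩
      obtain ⟨q', hq', hq'w⟩ := exists_deriv_cofactor_mul_neg hd hlam hU hs h hL hrs hE hr0
      have hσq : 0 ≤ -((-1) ^ n * q') := by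
        refine nonneg_of_hasDerivAt_of_le_left ((hq'.const_mul ((-1) ^ n)).neg) hr.1 fun t ht => ?_
        simp only [Pi.neg_apply]
        rw [hr0]
        linarith [hsg t ht]
      have hq'0 : q' ≠ 0 := by rintro rfl; simp at hq'w
      have hσq' : 0 < (-1) ^ (n + 1) * q' := by
        have : (-1 : ℝ) ^ n ≠ 0 := by simp
        have h3 : (-1 : ℝ) ^ n * q' ≠ 0 := mul_ne_zero this hq'0
        rw [pow_succ]
        exact lt_of_le_of_ne (by linarith) (by
          intro h4
          apply h3
          linarith)
      obtain ⟨δ, hδ, h4, -⟩ := sign_near_of_hasDerivAt_pos (hq'.const_mul ((-1) ^ (n + 1)))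
        (by rw [hr0, mul_zero]) hσq'
      exact ⟨δ, hδ, h4⟩
    · simp only [if_neg (show ¬ n + 1 ≤ n by omega)]
      have := hz.energy_loss
      push_cast
      linarith
  · exact Or.inr h1

/-- Either the cofactor has at least `N` zeros, or it has fewer and the energy never crosses the
barrier. -/
theorem exists_rootChain_or (hd : IsDrift lam U η C Ψ) (hlam : 0 < lam) (hU : IsLowRoot lam U)
    (hs : IsSmall lam U η C N ε) (h : IsShot lam ε y w) (hL : Launch lam ε U y w s) :
    (∃ z, RootChain lam ε U y w η C Ψ s N z) ∨
    ∃ n z, n < N ∧ RootChain lam ε U y w η C Ψ s n z ∧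
      (∀ t ∈ Ioc (z n) (π / 2), 0 < (-1) ^ n * cofactor lam U y t) ∧
      -η ≤ energy lam ε U y w (π / 2) := by
  have key : ∀ m ≤ N, (∃ z, RootChain lam ε U y w η C Ψ s m z) ∨
    ∃ n z, n < N ∧ RootChain lam ε U y w η C Ψ s n z ∧
      (∀ t ∈ Ioc (z n) (π / 2), 0 < (-1) ^ n * cofactor lam U y t) ∧
      -η ≤ energy lam ε U y w (π / 2) := by
    intro m hm
    induction m with
    | zero => exact Or.inl ⟨_, rootChain_zero hd hU hs h hL⟩
    | succ m ih =>
      rcases ih (by omega) with ⟨z, hz⟩ | h1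
      · rcases hz.le.eq_or_lt with heq | hlt
        · exact Or.inr ⟨m, z, hm, hz, fun t ht => absurd ht.2 (not_le.mpr (heq ▸ ht.1)),
            heq ▸ hz.energy_ge⟩
        · rcases hz.succ_or hd hlam hU hs (by omega) h hL hlt with ⟨r, -, hr⟩ | h2
          · exact Or.inl ⟨_, hr⟩
          · exact Or.inr ⟨m, z, hm, hz, h2⟩
      · exact Or.inr h1
  exact key N le_rfl

end

section

variable {ε B M c p r : ℝ} {y w f : ℝ → ℝ}

theorem virial_abs_le (hε : 0 < ε) (hB : 0 ≤ B) {a b x : ℝ} (ha : |a| ≤ B) (hx : |x| ≤ B + 1)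
    (hb : ε * |b| ≤ M) : |ε ^ 2 * ((a + x) * b)| ≤ (2 * B + 1) * M * ε := by
  have h1 : |a + x| ≤ 2 * B + 1 := (abs_add_le _ _).trans (by linarith)
  rw [abs_mul, abs_of_pos (by positivity : 0 < ε ^ 2), abs_mul]
  calc ε ^ 2 * (|a + x| * |b|) = |a + x| * (ε * |b|) * ε := by ring
    _ ≤ (2 * B + 1) * M * ε := by gcongr

theorem hasDerivAt_virial (hε : 0 < ε) {t x : ℝ} (hy : HasDerivAt y (w t) t)
    (hw : HasDerivAt w (f t / ε ^ 2) t) :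
    HasDerivAt (fun t => ε ^ 2 * ((y t + x) * w t)) (ε ^ 2 * w t ^ 2 + (y t + x) * f t) t := by
  refine (((hy.add_const x).mul hw).const_mul (ε ^ 2)).congr_deriv ?_
  field_simp

/-- A concave arc of a bounded oscillation is short. -/
theorem mul_sub_le_of_force_nonpos (hε : 0 < ε) (hpr : p ≤ r)
    (hy : ∀ t ∈ Icc p r, HasDerivAt y (w t) t)
    (hw : ∀ t ∈ Icc p r, HasDerivAt w (f t / ε ^ 2) t) (hB : ∀ t ∈ Icc p r, |y t| ≤ B)
    (hM : ∀ t ∈ Icc p r, ε * |w t| ≤ M) (hf : ∀ t ∈ Ioo p r, f t ≤ 0)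
    (hc : ∀ t ∈ Ioo p r, c ≤ |f t| + ε ^ 2 * w t ^ 2) :
    c * (r - p) ≤ 2 * (2 * B + 1) * M * ε := by
  have hp : p ∈ Icc p r := ⟨le_rfl, hpr⟩
  have hr : r ∈ Icc p r := ⟨hpr, le_rfl⟩
  have hB0 : 0 ≤ B := (abs_nonneg _).trans (hB p hp)
  have hx : |-(B + 1)| ≤ B + 1 := by rw [abs_neg, abs_of_pos (by linarith)]
  have key := mul_sub_le_of_hasDerivAt (c := c) hpr
    (fun t ht => hasDerivAt_virial (x := -(B + 1)) hε (hy t ht) (hw t ht)) fun t ht => by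
      have h1 := hc t ht
      have h2 := hf t ht
      rw [abs_of_nonpos h2] at h1
      nlinarith [(abs_le.mp (hB t (Ioo_subset_Icc_self ht))).2]
  have e1 := (abs_le.mp (virial_abs_le hε hB0 (hB p hp) hx (hM p hp))).1
  have e2 := (abs_le.mp (virial_abs_le hε hB0 (hB r hr) hx (hM r hr))).2
  linarith

/-- A convex arc of a bounded oscillation above a decreasing barrier is short. -/
theorem false_of_force_nonneg {δ A c₀ : ℝ} {U V : ℝ → ℝ} (hδ : 0 < δ) (hpr : p < r) (hA : 0 < A)
    (hc : 0 < c) (hc₀ : 0 < c₀) (hy : ∀ t ∈ Icc p r, HasDerivAt y (w t) t)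
    (hw : ∀ t ∈ Icc p r, HasDerivAt w (f t / (δ ^ 2) ^ 2) t)
    (hU : ∀ t ∈ Icc p r, HasDerivAt U (V t) t) (hB : ∀ t ∈ Icc p r, |y t| ≤ B)
    (hM : ∀ t ∈ Icc p r, δ ^ 2 * |w t| ≤ M) (hf : ∀ t ∈ Ioo p r, 0 ≤ f t)
    (hV : ∀ t ∈ Icc p r, V t ≤ -c₀) (hUy : ∀ t ∈ Icc p r, U t ≤ y t)
    (hbal : ∀ t ∈ Ioo p r, c * (y t - U t) ≤ f t + (δ ^ 2) ^ 2 * w t ^ 2)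
    (hwA : ∀ t ∈ Icc p r, δ ^ 2 * |w t| ≤ A * (y t - U t))
    (h₁ : 2 * (2 * B + 1) * M * δ ^ 2 < c * c₀ / 16 * (r - p) ^ 2)
    (h₂ : 8 * B * δ < r - p) (h₃ : 2 * A * δ < c) (h₄ : 16 * A * δ < c * c₀ * (r - p)) :
    False := by
  have hε : 0 < δ ^ 2 := by positivity
  have hmono : ∀ a b, p ≤ a → a ≤ b → b ≤ r → w a ≤ w b := fun a b ha hab hb =>
    le_of_hasDerivAt_nonneg hab (fun t ht => hw t ⟨ha.trans ht.1, ht.2.trans hb⟩) fun t ht =>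
      div_nonneg (hf t ⟨ha.trans_lt ht.1, ht.2.trans_le hb⟩) (by positivity)
  have hp : p ∈ Icc p r := ⟨le_rfl, hpr.le⟩
  have hr : r ∈ Icc p r := ⟨hpr.le, le_rfl⟩
  have hB0 : 0 ≤ B := (abs_nonneg _).trans (hB p hp)
  obtain ⟨m, hm⟩ : ∃ m, m = (p + r) / 2 := ⟨_, rfl⟩
  have hmI : m ∈ Icc p r := ⟨by linarith, by linarith⟩
  rcases le_or_gt (-(c₀ / 2)) (w m) with h5 | h5
  · have hD : ∀ t ∈ Icc m r, c₀ / 2 * (t - m) ≤ y t - U t := fun t ht => by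
      have h6 := mul_sub_le_of_hasDerivAt (f := fun t => y t - U t) (c := c₀ / 2) ht.1
        (fun x hx => (hy x ⟨hmI.1.trans hx.1, hx.2.trans ht.2⟩).sub
          (hU x ⟨hmI.1.trans hx.1, hx.2.trans ht.2⟩)) fun x hx => by
            have h7 := hmono m x hmI.1 hx.1.le (hx.2.le.trans ht.2)
            have h8 := hV x ⟨hmI.1.trans hx.1.le, hx.2.le.trans ht.2⟩
            linarith
      have h7 := hUy m hmI
      linarith
    have hx : |B + 1| ≤ B + 1 := by rw [abs_of_pos (by linarith)]
    have key := le_of_hasDerivAt_nonneg (a := m) (b := r)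
      (f := fun t => (δ ^ 2) ^ 2 * ((y t + (B + 1)) * w t) - c * c₀ / 4 * (t - m) ^ 2)
      (f' := fun t => (δ ^ 2) ^ 2 * w t ^ 2 + (y t + (B + 1)) * f t - c * c₀ / 4 * (2 * (t - m)))
      hmI.2 (fun t ht => (hasDerivAt_virial hε (hy t ⟨hmI.1.trans ht.1, ht.2⟩)
        (hw t ⟨hmI.1.trans ht.1, ht.2⟩)).sub ((((hasDerivAt_id t).sub_const m).pow 2).const_mul
          (c * c₀ / 4) |>.congr_deriv (by simp))) fun t ht => by
        have ht' : t ∈ Ioo p r := ⟨hmI.1.trans_lt ht.1, ht.2⟩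
        have h6 := hbal t ht'
        have h7 := mul_le_mul_of_nonneg_left (hD t (Ioo_subset_Icc_self ht)) hc.le
        have h8 := (abs_le.mp (hB t (Ioo_subset_Icc_self ht'))).1
        have h9 := mul_nonneg (by linarith : 0 ≤ y t + B) (hf t ht')
        linarith
    have e1 := (abs_le.mp (virial_abs_le hε hB0 (hB m hmI) hx (hM m hmI))).1
    have e2 := (abs_le.mp (virial_abs_le hε hB0 (hB r hr) hx (hM r hr))).2
    have e3 : r - m = (r - p) / 2 := by rw [hm]; ring
    simp only [sub_self] at key
    rw [e3] at key
    linarith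
  · obtain ⟨x, hx⟩ : ∃ x, x = (3 * p + r) / 4 := ⟨_, rfl⟩
    have hxI : x ∈ Icc p m := ⟨by linarith, by linarith⟩
    have hxp : x - p = (r - p) / 4 := by rw [hx]; ring
    have hxm : m - x = (r - p) / 4 := by rw [hx, hm]; ring
    rcases le_or_gt (w x) (-(1 / δ)) with h6 | h6
    · have key := mul_sub_le_of_hasDerivAt (f := fun t => -y t) (c := 1 / δ) hxI.1
        (fun t ht => (hy t ⟨ht.1, ht.2.trans (hxI.2.trans hmI.2)⟩).neg) fun t ht => by
          have := hmono t x ht.1.le ht.2.le (hxI.2.trans hmI.2)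
          linarith
      have h7 := (abs_le.mp (hB p hp)).2
      have h8 := (abs_le.mp (hB x ⟨hxI.1, hxI.2.trans hmI.2⟩)).1
      rw [hxp, one_div_mul_eq_div, div_le_iff₀ hδ] at key
      nlinarith
    · have key := mul_sub_le_of_hasDerivAt (c := c * c₀ / (4 * A * δ ^ 2)) hxI.2
        (fun t ht => hw t ⟨hxI.1.trans ht.1, ht.2.trans hmI.2⟩) fun t ht => by
          have ht' : t ∈ Ioo p r := ⟨hxI.1.trans_lt ht.1, ht.2.trans_le hmI.2⟩
          have h7 := hmono t m ht'.1.le ht.2.le hmI.2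
          have h8 := hmono x t hxI.1 ht.1.le ht'.2.le
          have h9 := hbal t ht'
          have h10 := hwA t (Ioo_subset_Icc_self ht')
          have h11 : |w t| = -w t := abs_of_neg (by linarith)
          have h12 : δ ^ 2 * |w t| ≤ δ := by
            have : δ * |w t| ≤ 1 := by
              rw [h11, ← le_div_iff₀' hδ]
              linarith
            nlinarith
          have h13 : (δ ^ 2) ^ 2 * w t ^ 2 = δ ^ 2 * |w t| * (δ ^ 2 * |w t|) := by
            rw [h11]; ring
          have h14 : c₀ / 2 ≤ |w t| := by rw [h11]; linarith
          have h15 := mul_le_mul_of_nonneg_left h10 hc.le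
          have h16 : δ ^ 2 * |w t| * (δ ^ 2 * |w t|) ≤ δ ^ 2 * |w t| * δ := by gcongr
          have h17 : δ ^ 2 * |w t| * (2 * A * δ) ≤ δ ^ 2 * |w t| * c := by gcongr
          have h18 : δ ^ 2 * (c₀ / 2) * c ≤ δ ^ 2 * |w t| * c := by gcongr
          rw [div_le_div_iff₀ (by positivity) (by positivity)]
          have h19 : c * c₀ * δ ^ 2 ≤ 4 * A * f t := by nlinarith
          nlinarith [mul_le_mul_of_nonneg_right h19 hε.le]
      rw [hxm, div_mul_eq_mul_div, div_le_iff₀ (by positivity)] at key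
      have h7 : w m - w x < 1 / δ := by linarith
      have h8 : (w m - w x) * δ ≤ 1 := by rw [← le_div_iff₀ hδ]; exact h7.le
      nlinarith [mul_le_mul_of_nonneg_left h8 (by positivity : 0 ≤ 4 * A * δ)]

end

theorem eventually_lt_right_of_zero {g : ℝ → ℝ} {b : ℝ} (hg : Continuous g) (h : g 0 < b) :
    ∀ᶠ ε in nhdsWithin 0 (Ioi 0), g ε < b :=
  (hg.continuousAt.eventually_lt continuousAt_const h).filter_mono nhdsWithin_le_nhds

section

variable {lam ε η C : ℝ} {U y w Ψ : ℝ → ℝ} {s : ℝ} {n : ℕ} {z : ℕ → ℝ}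

theorem eventually_isSmall (hd : IsDrift lam U η C Ψ) (hU : IsLowRoot lam U) (N : ℕ) :
    ∀ᶠ ε in nhdsWithin 0 (Ioi 0), IsSmall lam U η C N ε := by
  have hη := hd.η_pos
  have hk := hU.steep 0
  have hU0 := pow_pos (neg_pos.mpr (hU.neg 0)) 2
  rw [neg_sq] at hU0
  have h1 := eventually_lt_right_of_zero (b := η / 4)
    (g := fun ε => ε ^ 2 / (3 * U 0 ^ 2 - lam) ^ 2 + (N + 1) * C * ε) (by fun_prop)
    (by simp; positivity)
  have h2 := eventually_lt_right_of_zero (b := 2 * η * U 0 ^ 2 * (3 * U 0 ^ 2 - lam) ^ 2)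
    (g := fun ε => 9 * lam * ε ^ 2) (by fun_prop)
    (by simpa using mul_pos (mul_pos (by positivity) hU0) (pow_pos hk 2))
  filter_upwards [h1, h2, self_mem_nhdsWithin] with ε h1 h2 h3
  exact ⟨h3, h1.le, h2⟩

theorem Launch.eps_mul_abs_w_le (hL : Launch lam ε U y w s) (h : IsShot lam ε y w) (hlam : 0 < lam)
    (hε : 0 < ε) (hU : IsLowRoot lam U) {t : ℝ} (ht : t ∈ Ioc s (π / 2)) :
    ε * |w t| ≤ √(2 * lam) * (y t - U t) := by
  have ht' : t ∈ Icc s (π / 2) := ⟨ht.1.le, ht.2⟩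
  have h1 := hL.energy_nonpos h hlam hε hU ht'
  have h2 := hL.sq_le hU ht'
  have h3 := hU.sq_le (hL.mem ht')
  have hD := (hL.lt_y hU ht).1
  unfold energy at h1
  have h4 : (ε * |w t|) ^ 2 = ε ^ 2 * w t ^ 2 := by rw [mul_pow, sq_abs]
  have h5 : (y t + U t) ^ 2 - 2 * (lam - U t ^ 2) ≤ 4 * lam := by
    nlinarith [sq_nonneg (y t - U t)]
  have h6 := mul_le_mul_of_nonneg_left h5 (sq_nonneg (y t - U t))
  refine le_of_sq_le_sq ?_ (mul_nonneg (sqrt_nonneg _) (by linarith))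
  rw [h4, mul_pow, sq_sqrt (by positivity)]
  linarith

theorem half_le_sin_and_cos {t : ℝ} (ht : t ∈ Icc (π / 6) (π / 3)) :
    1 / 2 ≤ sin t ∧ 1 / 2 ≤ cos t := by
  have := pi_pos
  constructor
  · rw [← sin_pi_div_six]
    exact sin_le_sin_of_le_of_le_pi_div_two (by linarith) (by linarith [ht.2]) ht.1
  · rw [← cos_pi_div_three]
    exact cos_le_cos_of_nonneg_of_le_pi (by linarith [ht.1]) (by linarith) ht.2

/-- Above the energy barrier the cofactor changes sign on every fixed window. -/
theorem eventually_not_forall_cofactor (hd : IsDrift lam U η C Ψ) (hlam : 0 < lam)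
    (hU : IsLowRoot lam U) {L : ℝ} (hL0 : 0 < L) : ∀ᶠ ε in nhdsWithin 0 (Ioi 0),
      ∀ {y w : ℝ → ℝ} {s : ℝ}, IsShot lam ε y w → Launch lam ε U y w s → s < π / 6 →
        -η ≤ energy lam ε U y w (π / 2) → ∀ p, π / 6 ≤ p → p + L ≤ π / 3 → ∀ σ : ℝ, |σ| = 1 →
          ¬ ∀ t ∈ Ioo p (p + L), 0 < σ * cofactor lam U y t := by
  obtain ⟨K, hK, hbal⟩ := hd.balance
  have hsl : 0 < √lam := sqrt_pos.mpr hlam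
  have hk := hU.steep 0
  set k := 3 * U 0 ^ 2 - lam with hkd
  obtain ⟨c, hc⟩ : ∃ c, c = 1 / (2 * √lam) / K := ⟨_, rfl⟩
  have hc0 : 0 < c := by rw [hc]; positivity
  obtain ⟨c₀, hc₀⟩ : ∃ c₀, c₀ = 1 / (4 * lam) := ⟨_, rfl⟩
  have hc₀0 : 0 < c₀ := by rw [hc₀]; positivity
  have hA : 0 < √(2 * lam) := sqrt_pos.mpr (by positivity)
  have g1 := eventually_lt_right_of_zero (b := c * c₀ / 16 * L ^ 2)
    (g := fun ε => 2 * (2 * √lam + 1) * lam * √ε ^ 2) (by fun_prop) (by simp; positivity)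
  have g2 := eventually_lt_right_of_zero (b := L) (g := fun ε => 8 * √lam * √ε) (by fun_prop)
    (by simpa)
  have g3 := eventually_lt_right_of_zero (b := c) (g := fun ε => 2 * √(2 * lam) * √ε)
    (by fun_prop) (by simpa)
  have g4 := eventually_lt_right_of_zero (b := c * c₀ * L) (g := fun ε => 16 * √(2 * lam) * √ε)
    (by fun_prop) (by simp; positivity)
  have g5 := eventually_lt_right_of_zero (b := c * (k / (3 * √lam)) * L)
    (g := fun ε => 2 * (2 * √lam + 1) * lam * ε) (by fun_prop) (by simp; positivity)
  filter_upwards [g1, g2, g3, g4, g5, self_mem_nhdsWithin]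
    with ε g1 g2 g3 g4 g5 hε y w s h hL hs hE p hp hr σ hσ hq
  have hε : 0 < ε := hε
  have hpi := pi_pos
  have hpr : p < p + L := by linarith
  have hw6 : ∀ t ∈ Icc p (p + L), t ∈ Icc (π / 6) (π / 3) := fun t ht =>
    ⟨hp.trans ht.1, ht.2.trans hr⟩
  have hts : ∀ t ∈ Icc p (p + L), t ∈ Ioc s (π / 2) := fun t ht =>
    ⟨by linarith [ht.1], by linarith [ht.2]⟩
  have hts' : ∀ t ∈ Icc p (p + L), t ∈ Icc s (π / 2) := fun t ht => Ioc_subset_Icc_self (hts t ht)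
  have hw : ∀ t ∈ Icc p (p + L),
      HasDerivAt w ((y t - U t) * cofactor lam U y t / ε ^ 2) t := fun t ht => by
    have ht' := hL.mem (hts' t ht)
    have h1 := h.hw t (mem_Icc_zero_pi ht')
    rwa [force_eq_mul_cofactor hU (abs_le_of_sq_lt hlam hU ht' (hL.sq_le hU (hts' t ht)))] at h1
  have hD : ∀ t ∈ Icc p (p + L), 0 < y t - U t := fun t ht => by
    linarith [(hL.lt_y hU (hts t ht)).1]
  have hUabs : ∀ t ∈ Icc p (p + L), -√lam ≤ U t := fun t ht =>
    (abs_le.mp (abs_le_sqrt (hU.sq_le (hL.mem (hts' t ht))))).1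
  have hb : ∀ t ∈ Icc p (p + L), c * (y t - U t) ≤
      |(y t - U t) * cofactor lam U y t| + ε ^ 2 * w t ^ 2 := fun t ht => by
    have h1 := hbal hL t (hts t ht) (by
      rcases (hts t ht).2.eq_or_lt with h2 | h2
      · rwa [h2]
      · exact hE.trans (hL.energy_lt h hlam hε hU (hts t ht).1.le h2 le_rfl).le)
    have h2 : 1 / (2 * √lam) ≤ lam - U t ^ 2 := by
      rw [div_le_iff₀ (by positivity)]
      have h3 := (half_le_sin_and_cos (hw6 t ht)).2
      rw [← hU.root t] at h3
      have h4 : 0 ≤ lam - U t ^ 2 := by linarith [hU.sq_le (hL.mem (hts' t ht))]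
      nlinarith [hUabs t ht]
    rw [hc, div_mul_eq_mul_div, div_le_iff₀' hK]
    exact (mul_le_mul_of_nonneg_right h2 (hD t ht).le).trans h1
  have hyB : ∀ t ∈ Icc p (p + L), |y t| ≤ √lam := fun t ht => hL.abs_y_le hU (hts' t ht)
  have hwM : ∀ t ∈ Icc p (p + L), ε * |w t| ≤ lam := fun t ht =>
    hL.abs_w_le h hlam hε hU (hts' t ht)
  have hpL : p + L - p = L := by ring
  rcases eq_or_eq_neg_of_abs_eq hσ with rfl | rfl
  · have hδ : √ε ^ 2 = ε := sq_sqrt hε.le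
    refine false_of_force_nonneg (A := √(2 * lam)) (B := √lam) (M := lam) (c := c) (c₀ := c₀)
      (sqrt_pos.mpr hε) hpr hA hc0 hc₀0 (fun t _ => h.hy t) (by rwa [hδ]) (fun t _ => hU.deriv t)
      hyB (by rwa [hδ]) (fun t ht => ?_) (fun t ht => ?_)
      (fun t ht => by linarith [hD t ht]) (fun t ht => ?_) (fun t ht => ?_)
      (by rwa [hpL]) (by rwa [hpL]) g3 (by rwa [hpL])
    · have := hq t ht
      exact mul_nonneg (hD t (Ioo_subset_Icc_self ht)).le (by linarith)
    · have h1 := (half_le_sin_and_cos (hw6 t ht)).1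
      have h2 := hU.steep t
      have h3 := hU.sq_le (hL.mem (hts' t ht))
      rw [hc₀, neg_div, neg_le_neg_iff, div_le_div_iff₀ (by positivity) h2]
      nlinarith
    · have h1 := hb t (Ioo_subset_Icc_self ht)
      rw [hδ]
      rwa [abs_of_nonneg (mul_nonneg (hD t (Ioo_subset_Icc_self ht)).le
        (by linarith [hq t ht]))] at h1
    · rw [hδ]
      exact hL.eps_mul_abs_w_le h hlam hε hU (hts t ht)
  · have key := mul_sub_le_of_force_nonpos (c := c * (k / (3 * √lam))) hε hpr.le
      (fun t _ => h.hy t) hw hyB hwM (fun t ht => ?_) (fun t ht => ?_)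
    · rw [hpL] at key
      linarith
    · have := hq t ht
      exact mul_nonpos_of_nonneg_of_nonpos (hD t (Ioo_subset_Icc_self ht)).le (by linarith)
    · have ht' := Ioo_subset_Icc_self ht
      refine le_trans ?_ (hb t ht')
      refine mul_le_mul_of_nonneg_left ?_ hc0.le
      rw [div_le_iff₀ (by positivity)]
      have h1 := hq t ht
      have h2 := hU.steep_mono (hL.mem (hts' t ht'))
      have h3 : cofactor lam U y t =
        (y t - U t) ^ 2 + 3 * U t * (y t - U t) + (3 * U t ^ 2 - lam) := by unfold cofactor; ring
      nlinarith [hUabs t ht', hD t ht', sq_nonneg (y t - U t)]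

/-- The shot from the low root oscillates arbitrarily often. -/
theorem eventually_exists_rootChain (hd : IsDrift lam U η C Ψ) (hlam : 0 < lam)
    (hU : IsLowRoot lam U) (N : ℕ) : ∀ᶠ ε in nhdsWithin 0 (Ioi 0),
      ∀ {y w : ℝ → ℝ}, IsShot lam ε y w → Launch lam ε U y w 0 →
        ∃ z, RootChain lam ε U y w η C Ψ 0 N z := by
  have hpi := pi_pos
  obtain ⟨L, hL⟩ : ∃ L, L = π / 6 / (N + 1) := ⟨_, rfl⟩
  have hL0 : 0 < L := by rw [hL]; positivity
  have hNL : (N + 1) * L = π / 6 := by rw [hL]; field_simp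
  filter_upwards [eventually_isSmall hd hU N, eventually_not_forall_cofactor hd hlam hU hL0]
    with ε hs hwin y w h hL
  refine (exists_rootChain_or hd hlam hU hs h hL).resolve_right ?_
  rintro ⟨n, z, hn, hz, hsg, hE⟩
  have hjL : ∀ j : ℕ, j ≤ n → π / 6 + j * L + L ≤ π / 3 := fun j hj => by
    have : (j : ℝ) + 1 ≤ N + 1 := by exact_mod_cast (by omega : j + 1 ≤ N + 1)
    nlinarith
  have h0 : ∀ j : ℕ, π / 6 ≤ π / 6 + j * L := fun j => by
    have : 0 ≤ j * L := by positivity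
    linarith
  have hle : ∀ j ≤ n, z j ≤ π / 6 + j * L := by
    intro j
    induction j with
    | zero => intro _; rw [hz.zero]; simp; positivity
    | succ j ih =>
      intro hj
      by_contra! hlt
      push_cast at hlt
      exact hwin h hL (by positivity) hE (π / 6 + j * L) (h0 j) (hjL j (by omega)) ((-1) ^ j)
        (by simp) fun t ht => hz.sign j (by omega) t
          ⟨(ih (by omega)).trans_lt ht.1, by linarith [ht.2]⟩
  exact hwin h hL (by positivity) hE (π / 6 + n * L) (h0 n) (hjL n le_rfl) ((-1) ^ n)
    (by simp) fun t ht => hsg t ⟨(hle n le_rfl).trans_lt ht.1, by linarith [ht.2, hjL n le_rfl]⟩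

end

section

variable {lam ε η C : ℝ} {U y w Ψ : ℝ → ℝ} {s : ℝ} {N n : ℕ} {z : ℕ → ℝ}

theorem RootChain.exists_eq_of_root (hz : RootChain lam ε U y w η C Ψ s n z)
    (hL : Launch lam ε U y w s) (hU : IsLowRoot lam U) {t : ℝ} (ht : t ∈ Icc 0 (z n))
    (hq : cofactor lam U y t = 0) : ∃ i < n, t = z (i + 1) := by
  by_contra! hne
  have hlt : ∀ j ≤ n, z j < t := by
    intro j
    induction j with
    | zero =>
      intro _
      rw [hz.zero]
      by_contra! hts
      exact (hL.cofactor_pos hU ⟨ht.1, hts⟩).ne' hq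
    | succ j ih =>
      intro hj
      by_contra! hle
      have h1 := hz.sign j (by omega) t
        ⟨ih (by omega), lt_of_le_of_ne hle (hne j (by omega))⟩
      rw [hq, mul_zero] at h1
      exact lt_irrefl _ h1
  exact absurd ht.2 (not_le.mpr (hlt n le_rfl))

/-- A shot whose cofactor has `N` zeros carries a chain of length `N`. -/
theorem exists_rootChain_of_roots (hd : IsDrift lam U η C Ψ) (hlam : 0 < lam) (hU : IsLowRoot lam U)
    (hs : IsSmall lam U η C N ε) (hN : 0 < N) (h : IsShot lam ε y w) (h0 : y 0 ≤ U 0) {ζ : ℕ → ℝ}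
    (hζ : ∀ i < N, ζ i ∈ Icc 0 (π / 2)) (hlt : ∀ i, i + 1 < N → ζ i < ζ (i + 1))
    (hroot : ∀ i < N, cofactor lam U y (ζ i) = 0) :
    ∃ s z, Launch lam ε U y w s ∧ RootChain lam ε U y w η C Ψ s N z := by
  rcases exists_launch_or h hlam hs.pos hU h0 with h1 | ⟨s, hL⟩
  · exact absurd (hroot 0 hN) (h1 _ (hζ 0 hN)).ne'
  rcases exists_rootChain_or hd hlam hU hs h hL with ⟨z, hz⟩ | ⟨n, z, hn, hz, hsg, -⟩
  · exact ⟨s, z, hL, hz⟩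
  exfalso
  have hmem : ∀ i < N, ∃ j < n, ζ i = z (j + 1) := fun i hi => by
    refine hz.exists_eq_of_root hL hU ⟨(hζ i hi).1, ?_⟩ (hroot i hi)
    by_contra! hzt
    have h2 := hsg (ζ i) ⟨hzt, (hζ i hi).2⟩
    rw [hroot i hi, mul_zero] at h2
    exact lt_irrefl _ h2
  have hmono : ∀ i j, i < j → j < N → ζ i < ζ j := by
    intro i j hij
    induction j, hij using Nat.le_induction with
    | base => exact fun hj => hlt i hj
    | succ j _ ih => exact fun hj => (ih (by omega)).trans (hlt j hj)
  have hsub : (Finset.range N).image ζ ⊆ (Finset.range n).image fun j => z (j + 1) := fun x hx => by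
    obtain ⟨i, hi, rfl⟩ := Finset.mem_image.mp hx
    obtain ⟨j, hj, hj'⟩ := hmem i (Finset.mem_range.mp hi)
    exact Finset.mem_image.mpr ⟨j, Finset.mem_range.mpr hj, hj'.symm⟩
  have hcard := Finset.card_le_card hsub
  rw [Finset.card_image_of_injOn, Finset.card_range] at hcard
  · have := Finset.card_image_le (s := Finset.range n) (f := fun j => z (j + 1))
    rw [Finset.card_range] at this
    omega
  · intro i hi j hj hij
    have hi' := Finset.mem_range.mp (Finset.mem_coe.mp hi)
    have hj' := Finset.mem_range.mp (Finset.mem_coe.mp hj)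
    rcases lt_trichotomy i j with h3 | h3 | h3
    · exact absurd hij (hmono i j h3 hj').ne
    · exact h3
    · exact absurd (Eq.symm hij) (hmono j i h3 hi').ne

/-- `N + 1` alternating signs of the cofactor. -/
def HasAlternation (lam : ℝ) (U y : ℝ → ℝ) (N : ℕ) (x : ℕ → ℝ) : Prop :=
  (∀ i < N, x i < x (i + 1)) ∧ (∀ i ≤ N, x i ∈ Icc 0 (π / 2)) ∧
    ∀ i ≤ N, 0 < (-1) ^ i * cofactor lam U y (x i)

theorem exists_rootChain_of_alternation (hd : IsDrift lam U η C Ψ) (hlam : 0 < lam)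
    (hU : IsLowRoot lam U) (hs : IsSmall lam U η C N ε) (hN : 0 < N) (h : IsShot lam ε y w)
    (h0 : y 0 ≤ U 0) {x : ℕ → ℝ} (hx : HasAlternation lam U y N x) :
    ∃ s z, Launch lam ε U y w s ∧ RootChain lam ε U y w η C Ψ s N z := by
  obtain ⟨hx1, hx2, hx3⟩ := hx
  have hex : ∀ i, ∃ ζ, i < N → ζ ∈ Ioo (x i) (x (i + 1)) ∧ cofactor lam U y ζ = 0 := by
    intro i
    by_cases hi : i < N
    · have h1 := hx3 i hi.le
      have h2 := hx3 (i + 1) hi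
      have hc : ContinuousOn (fun t => (-1) ^ i * cofactor lam U y t) (Icc (x i) (x (i + 1))) :=
        (continuous_const.mul (h.cont_cofactor hU)).continuousOn
      rw [pow_succ] at h2
      obtain ⟨ζ, hζ, hζ0⟩ := intermediate_value_Ioo' (hx1 i hi).le hc
        (show (0 : ℝ) ∈ Ioo _ _ from ⟨by linarith, h1⟩)
      exact ⟨ζ, fun _ => ⟨hζ, (mul_eq_zero.mp hζ0).resolve_left (by simp)⟩⟩
    · exact ⟨0, fun h => absurd h hi⟩
  choose ζ hζ using hex
  exact exists_rootChain_of_roots hd hlam hU hs hN h h0 (ζ := ζ)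
    (fun i hi => ⟨(hx2 i hi.le).1.trans (hζ i hi).1.1.le,
      (hζ i hi).1.2.le.trans (hx2 (i + 1) hi).2⟩)
    (fun i hi => (hζ i (by omega)).1.2.trans (hζ (i + 1) hi).1.1) fun i hi => (hζ i hi).2

theorem RootChain.exists_alternation_of_lt (hz : RootChain lam ε U y w η C Ψ s N z)
    (hL : Launch lam ε U y w s) (hlt : z N < π / 2) : ∃ x, HasAlternation lam U y N x := by
  obtain ⟨δ, hδ, hnear⟩ := hz.near hlt
  obtain ⟨p, hp1, hp2⟩ := exists_between (lt_min hlt (by linarith : z N < z N + δ))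
  rw [lt_min_iff] at hp2
  have hnn : ∀ i ≤ N, 0 ≤ z i := fun i hi => hL.nonneg.trans (hz.start_le hi)
  refine ⟨fun i => if i < N then (z i + z (i + 1)) / 2 else p, fun i hi => ?_, fun i hi => ?_,
    fun i hi => ?_⟩
  · have h1 := hz.lt i hi
    simp only [if_pos hi]
    split_ifs with h2
    · have := hz.lt (i + 1) h2
      linarith
    · have : i + 1 = N := by omega
      rw [this] at h1 ⊢
      linarith
  · simp only
    split_ifs with h2
    · have h3 := hz.lt i h2
      have h4 := hz.le_of_le (i := i + 1) h2 le_rfl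
      exact ⟨by linarith [hnn i hi], by linarith⟩
    · exact ⟨by linarith [hnn N le_rfl], hp2.1.le⟩
  · simp only
    split_ifs with h2
    · have h3 := hz.lt i h2
      exact hz.sign i h2 _ ⟨by linarith, by linarith⟩
    · have : i = N := by omega
      rw [this]
      exact hnear p ⟨hp1, hp2.2⟩

theorem RootChain.exists_alternation (hz : RootChain lam ε U y w η C Ψ s (N + 1) z)
    (hL : Launch lam ε U y w s) : ∃ x, HasAlternation lam U y N x := by
  refine ⟨fun i => (z i + z (i + 1)) / 2, fun i hi => ?_, fun i hi => ?_, fun i hi => ?_⟩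
  · have h1 := hz.lt i (by omega)
    have h2 := hz.lt (i + 1) (by omega)
    simp only
    linarith
  · have h1 := hz.lt i (by omega)
    have h2 := hL.nonneg.trans (hz.start_le (i := i) (by omega))
    have h3 := hz.le_of_le (i := i + 1) (j := N + 1) (by omega) le_rfl
    have h4 := hz.le
    exact ⟨by linarith, by linarith⟩
  · have h1 := hz.lt i (by omega)
    exact hz.sign i (by omega) _ ⟨by linarith, by linarith⟩

end

/-- The derivative of the cofactor along a shot. -/
noncomputable def cofactorDeriv (lam : ℝ) (U y w : ℝ → ℝ) (t : ℝ) : ℝ :=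
  (2 * y t + U t) * w t + (y t + 2 * U t) * (-sin t / (3 * U t ^ 2 - lam))

section

variable {lam ε η C : ℝ} {U Ψ : ℝ → ℝ} {N : ℕ} {Y W : ℝ → ℝ → ℝ}

theorem continuous_family (hlam : 0 < lam) (h : ∀ b, IsShot lam ε (Y b) (W b))
    (h0 : ∀ b, Y b 0 = b) :
    Continuous (fun p : ℝ × Icc 0 (π / 2) => Y p.1 p.2) ∧
      Continuous (fun p : ℝ × Icc 0 (π / 2) => W p.1 p.2) := by
  obtain ⟨K, hK, hdist⟩ := exists_shot_dist_le hlam.le ε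
  have hd := fun (t : Icc 0 (π / 2)) a b =>
    hdist (Y a) (W a) (Y b) (W b) (h a) (h b) t (mem_Icc_zero_pi t.2)
  simp only [h0] at hd
  constructor
  · refine continuous_prod_of_continuous_lipschitzWith _ ⟨K, hK.le⟩
      (fun b => (h b).cont_y.comp continuous_subtype_val)
      fun t => LipschitzWith.of_dist_le_mul fun a b => (hd t a b).1
  · refine continuous_prod_of_continuous_lipschitzWith _ ⟨K, hK.le⟩
      (fun b => (h b).cont_w.comp continuous_subtype_val)
      fun t => LipschitzWith.of_dist_le_mul fun a b => (hd t a b).2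

theorem HasAlternation.eventually (hlam : 0 < lam) (h : ∀ b, IsShot lam ε (Y b) (W b))
    (h0 : ∀ b, Y b 0 = b) {b : ℝ} {x : ℕ → ℝ} (hx : HasAlternation lam U (Y b) N x) :
    ∀ᶠ a in nhds b, HasAlternation lam U (Y a) N x := by
  have hY := (continuous_family hlam h h0).1
  have key : ∀ i ∈ Finset.range (N + 1),
      ∀ᶠ a in nhds b, 0 < (-1) ^ i * cofactor lam U (Y a) (x i) := fun i hi => by
    have hi' : i ≤ N := Nat.lt_succ_iff.mp (Finset.mem_range.mp hi)
    have hc : Continuous fun a => Y a (x i) :=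
      hY.comp (continuous_id.prodMk (continuous_const (y := (⟨x i, hx.2.1 i hi'⟩ : Icc 0 (π / 2)))))
    have hc' : Continuous fun a => (-1) ^ i * cofactor lam U (Y a) (x i) := by
      unfold cofactor
      fun_prop
    exact continuousAt_const.eventually_lt hc'.continuousAt (hx.2.2 i hi')
  filter_upwards [(Filter.eventually_all_finset _).mpr key] with a ha
  exact ⟨hx.1, hx.2.1, fun i hi => ha i (Finset.mem_range.mpr (Nat.lt_succ_iff.mpr hi))⟩

theorem continuous_along (hlam : 0 < lam) (hU : IsLowRoot lam U)
    (h : ∀ b, IsShot lam ε (Y b) (W b)) (h0 : ∀ b, Y b 0 = b) {X : Type*} [TopologicalSpace X]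
    {β : X → ℝ} {g : X → Icc 0 (π / 2)} (hβ : Continuous β) (hg : Continuous g) :
    Continuous (fun x => cofactor lam U (Y (β x)) (g x)) ∧
      Continuous (fun x => cofactorDeriv lam U (Y (β x)) (W (β x)) (g x)) ∧
      Continuous (fun x => energy lam ε U (Y (β x)) (W (β x)) (g x)) := by
  obtain ⟨hYc, hWc⟩ := continuous_family hlam h h0
  have h1 : Continuous fun x => Y (β x) (g x) := hYc.comp (hβ.prodMk hg)
  have h2 : Continuous fun x => W (β x) (g x) := hWc.comp (hβ.prodMk hg)
  have h3 : Continuous fun x => U (g x) := hU.cont.comp (continuous_subtype_val.comp hg)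
  have h4 : ∀ x, 3 * U (g x) ^ 2 - lam ≠ 0 := fun x => (hU.steep _).ne'
  have h5 : Continuous fun x => sin (g x) := continuous_sin.comp (continuous_subtype_val.comp hg)
  refine ⟨?_, ?_, ?_⟩
  · exact (((h1.pow 2).add (h3.mul h1)).add (h3.pow 2)).sub continuous_const
  · exact (((h1.const_mul 2).add h3).mul h2).add ((h1.add (h3.const_mul 2)).mul
      (h5.neg.div (((h3.pow 2).const_mul 3).sub continuous_const) h4))
  · exact (((h2.pow 2).const_mul _).div_const 2).sub ((((h1.sub h3).pow 2).mul
      (((h1.add h3).pow 2).sub ((continuous_const.sub (h3.pow 2)).const_mul 2))).div_const 4)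

/-- Among the initial values whose shots carry a chain of length `N` there is a least one. -/
theorem exists_isLeast_rootChain (hd : IsDrift lam U η C Ψ) (hlam : 0 < lam) (hU : IsLowRoot lam U)
    (hs : IsSmall lam U η C N ε) (hN : 0 < N) (h : ∀ b, IsShot lam ε (Y b) (W b))
    (h0 : ∀ b, Y b 0 = b)
    (hne : ∃ s z, Launch lam ε U (Y (U 0)) (W (U 0)) s ∧
      RootChain lam ε U (Y (U 0)) (W (U 0)) η C Ψ s N z) :
    ∃ b, IsLeast {b ∈ Icc (-√lam) (U 0) | ∃ s z, Launch lam ε U (Y b) (W b) s ∧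
      RootChain lam ε U (Y b) (W b) η C Ψ s N z} b := by
  have hpi := pi_pos
  let S : Set (Icc (-√lam) (U 0) × (ℕ → Icc 0 (π / 2)) × (ℕ → Icc 0 (π / 2))) := {x | ∀ i,
    (i < N → cofactor lam U (Y x.1) (x.2.1 i) = 0 ∧
    -η ≤ energy lam ε U (Y x.1) (W x.1) (x.2.1 i)) ∧ (i + 1 < N → x.2.1 i ≤ x.2.2 i ∧
      x.2.2 i ≤ x.2.1 (i + 1) ∧ cofactorDeriv lam U (Y x.1) (W x.1) (x.2.2 i) = 0)}
  have hS : IsClosed S := by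
    simp only [S, ofPred_forall, ofPred_and]
    refine isClosed_iInter fun i => ?_
    refine IsClosed.inter (isClosed_iInter fun _ => ?_) (isClosed_iInter fun _ => ?_)
    · exact (isClosed_eq (continuous_along hlam hU h h0 (by fun_prop) (by fun_prop)).1
        continuous_const).inter
        (isClosed_le continuous_const
          (continuous_along hlam hU h h0 (by fun_prop) (by fun_prop)).2.2)
    · exact (isClosed_le (by fun_prop) (by fun_prop)).inter
        ((isClosed_le (by fun_prop) (by fun_prop)).inter
          (isClosed_eq (continuous_along hlam hU h h0 (by fun_prop) (by fun_prop)).2.1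
            continuous_const))
  have himg : {b ∈ Icc (-√lam) (U 0) | ∃ s z, Launch lam ε U (Y b) (W b) s ∧
      RootChain lam ε U (Y b) (W b) η C Ψ s N z} = (fun x => (x.1 : ℝ)) '' S := by
    ext b
    constructor
    · rintro ⟨hb, s, z, hL, hz⟩
      have hmem : ∀ i ≤ N, z i ∈ Icc 0 (π / 2) := fun i hi =>
        ⟨hL.nonneg.trans (hz.start_le hi), (hz.le_of_le hi le_rfl).trans hz.le⟩
      have hex : ∀ i, ∃ ζ : Icc 0 (π / 2), i < N → (ζ : ℝ) = z (i + 1) := fun i => by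
        by_cases hi : i < N
        · exact ⟨⟨z (i + 1), hmem _ hi⟩, fun _ => rfl⟩
        · exact ⟨⟨0, le_rfl, by positivity⟩, fun h => absurd h hi⟩
      have hex' : ∀ i, ∃ ξ : Icc 0 (π / 2), i + 1 < N → z (i + 1) ≤ ξ ∧ ξ ≤ z (i + 1 + 1) ∧
          cofactorDeriv lam U (Y b) (W b) ξ = 0 := fun i => by
        by_cases hi : i + 1 < N
        · have h1 := hmem (i + 1) hi.le
          have h2 := hmem (i + 1 + 1) hi
          obtain ⟨ξ, hξ, hξ0⟩ := exists_hasDerivAt_eq_zero (hz.lt (i + 1) hi)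
            ((h b).cont_cofactor hU).continuousOn
            ((hz.root i (by omega)).trans (hz.root (i + 1) hi).symm)
            fun t _ => (h b).hasDerivAt_cofactor hU t
          exact ⟨⟨ξ, h1.1.trans hξ.1.le, hξ.2.le.trans h2.2⟩, fun _ => ⟨hξ.1.le, hξ.2.le, hξ0⟩⟩
        · exact ⟨⟨0, le_rfl, by positivity⟩, fun h => absurd h hi⟩
      choose ζ hζ using hex
      choose ξ hξ using hex'
      refine ⟨(⟨b, hb⟩, ζ, ξ), fun i => ⟨fun hi => ?_, fun hi => ?_⟩, rfl⟩
      · simp only [hζ i hi]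
        refine ⟨hz.root i hi, hz.energy_ge.trans ?_⟩
        rcases (hz.le_of_le (i := i + 1) hi le_rfl).eq_or_lt with h1 | h1
        · rw [h1]
        · exact (hL.energy_lt (h b) hlam hs.pos hU (hz.start_le hi) h1 hz.le).le
      · obtain ⟨h1, h2, h3⟩ := hξ i hi
        refine ⟨?_, ?_, h3⟩
        · rw [← Subtype.coe_le_coe, hζ i (by omega)]
          exact h1
        · rw [← Subtype.coe_le_coe, hζ (i + 1) hi]
          exact h2
    · rintro ⟨⟨⟨b, hb⟩, ζ, ξ⟩, hx, rfl⟩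
      simp only [S, mem_ofPred_eq] at hx ⊢
      have hy0 : Y b 0 ≤ U 0 := by rw [h0]; exact hb.2
      refine ⟨hb, exists_rootChain_of_roots hd hlam hU hs hN (h b) hy0 (ζ := fun i => ζ i)
        (fun i _ => (ζ i).2) (fun i hi => ?_) fun i hi => ((hx i).1 hi).1⟩
      obtain ⟨h1, h2, h3⟩ := (hx i).2 hi
      obtain ⟨h4, h5⟩ := (hx i).1 (by omega)
      refine Subtype.coe_lt_coe.mpr (lt_of_le_of_ne (h1.trans h2) fun heq => ?_)
      have h6 : ξ i = ζ i := le_antisymm (heq ▸ h2) h1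
      rw [h6] at h3
      rcases exists_launch_or (h b) hlam hs.pos hU hy0 with h7 | ⟨s, hL⟩
      · exact (h7 _ (ζ i).2).ne' h4
      · have h8 : s < ζ i := by
          by_contra! hle
          exact (hL.cofactor_pos hU ⟨(ζ i).2.1, hle⟩).ne' h4
        obtain ⟨q', hq', hq'w⟩ :=
          exists_deriv_cofactor_mul_neg hd hlam hU hs (h b) hL ⟨h8, (ζ i).2.2⟩ h5 h4
        rw [hq'.unique ((h b).hasDerivAt_cofactor hU _)] at hq'w
        unfold cofactorDeriv at h3
        rw [h3, zero_mul] at hq'w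
        exact lt_irrefl _ hq'w
  rw [himg]
  refine (hS.isCompact.image (by fun_prop)).exists_isLeast ?_
  rw [← himg]
  exact ⟨U 0, ⟨neg_sqrt_le_lowRoot hU ⟨le_rfl, by positivity⟩, le_rfl⟩, hne⟩

/-- Some shot below the low root has its `N`-th zero of the cofactor exactly at `π / 2`. -/
theorem exists_rootChain_end_eq (hd : IsDrift lam U η C Ψ) (hlam : 0 < lam) (hU : IsLowRoot lam U)
    (hs : IsSmall lam U η C N ε) (hN : 0 < N)
    (hmany : ∀ {y w : ℝ → ℝ}, IsShot lam ε y w → Launch lam ε U y w 0 →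
      ∃ z, RootChain lam ε U y w η C Ψ 0 (N + 1) z) :
    ∃ y w s z, IsShot lam ε y w ∧ y 0 < U 0 ∧ Launch lam ε U y w s ∧
      RootChain lam ε U y w η C Ψ s N z ∧ z N = π / 2 := by
  choose Y W h h0 using fun b => exists_isShot (ε := ε) hlam.le b
  have hL0 : Launch lam ε U (Y (U 0)) (W (U 0)) 0 :=
    launch_of_eq (h _) hlam hs.pos hU (h0 _)
  obtain ⟨z₀, hz₀⟩ := hmany (h (U 0)) hL0
  obtain ⟨x₀, hx₀⟩ := hz₀.exists_alternation hL0
  obtain ⟨b, ⟨hb, s, z, hL, hz⟩, hmin⟩ := exists_isLeast_rootChain hd hlam hU hs hN h h0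
    (exists_rootChain_of_alternation hd hlam hU hs hN (h _) (h0 _).le hx₀)
  have hbl : -√lam < b := lt_of_le_of_ne hb.1 fun heq =>
    not_launch_of_eq_neg_sqrt (h b) hlam hU ((h0 b).trans heq.symm) s hL
  have hno : ∀ x, ¬ HasAlternation lam U (Y b) N x := fun x hx => by
    obtain ⟨a, ha, hax, hab⟩ := (((hx.eventually hlam h h0).filter_mono
      nhdsWithin_le_nhds).and (Filter.eventually_of_mem (Ioo_mem_nhdsLT hbl) fun _ => id)).exists
    have hmem := hmin ⟨⟨hax.le, hab.le.trans hb.2⟩,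
      exists_rootChain_of_alternation hd hlam hU hs hN (h a) ((h0 a).le.trans
        (hab.le.trans hb.2)) ha⟩
    exact absurd hab (not_lt.mpr hmem)
  refine ⟨Y b, W b, s, z, h b, ?_, hL, hz, ?_⟩
  · rw [h0]
    refine lt_of_le_of_ne hb.2 fun heq => hno x₀ (heq ▸ hx₀)
  · by_contra hne
    obtain ⟨x, hx⟩ := hz.exists_alternation_of_lt hL (lt_of_le_of_ne hz.le hne)
    exact hno x hx

end

section

variable {lam ε η C : ℝ} {U y w Ψ : ℝ → ℝ} {s : ℝ} {N n : ℕ} {z : ℕ → ℝ}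

theorem RootChain.w_pos_of_root (hz : RootChain lam ε U y w η C Ψ s n z)
    (hd : IsDrift lam U η C Ψ) (hlam : 0 < lam) (hU : IsLowRoot lam U)
    (hs : IsSmall lam U η C N ε) (h : IsShot lam ε y w) (hL : Launch lam ε U y w s) {i : ℕ}
    (hi : i < n) : 0 < (-1) ^ i * w (z (i + 1)) := by
  have hlt := hz.lt i hi
  have hzs : z (i + 1) ∈ Ioc s (π / 2) := ⟨(hz.start_le hi.le).trans_lt hlt,
    (hz.le_of_le (i := i + 1) hi le_rfl).trans hz.le⟩
  have hE : -η ≤ energy lam ε U y w (z (i + 1)) := by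
    refine hz.energy_ge.trans ?_
    rcases (hz.le_of_le (i := i + 1) hi le_rfl).eq_or_lt with h1 | h1
    · rw [h1]
    · exact (hL.energy_lt h hlam hs.pos hU hzs.1.le h1 hz.le).le
  have hr := hz.root i hi
  obtain ⟨q', hq', hq'w⟩ := exists_deriv_cofactor_mul_neg hd hlam hU hs h hL hzs hE hr
  have h1 : 0 ≤ -((-1) ^ i * q') := by
    refine nonneg_of_hasDerivAt_of_le_left ((hq'.const_mul ((-1) ^ i)).neg) hlt fun t ht => ?_
    simp only [Pi.neg_apply]
    rw [hr]
    linarith [hz.sign i hi t ht]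
  have h2 : ((-1) ^ i * q') * ((-1) ^ i * w (z (i + 1))) = q' * w (z (i + 1)) := by
    have : ((-1 : ℝ) ^ i) * (-1) ^ i = 1 := by rw [← mul_pow]; norm_num
    linear_combination q' * w (z (i + 1)) * this
  rw [← h2] at hq'w
  by_contra! h3
  have := mul_nonneg_of_nonpos_of_nonpos (by linarith : (-1) ^ i * q' ≤ 0) h3
  linarith

theorem RootChain.w_lt (hz : RootChain lam ε U y w η C Ψ s n z) (hlam : 0 < lam) (hε : 0 < ε)
    (hU : IsLowRoot lam U) (h : IsShot lam ε y w) (hL : Launch lam ε U y w s) {i : ℕ} (hi : i < n)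
    {a b : ℝ} (ha : z i ≤ a) (hab : a < b) (hb : b ≤ z (i + 1)) :
    (-1) ^ i * w a < (-1) ^ i * w b := by
  have hmem : ∀ t ∈ Icc a b, t ∈ Icc s (π / 2) := fun t ht =>
    ⟨(hz.start_le hi.le).trans (ha.trans ht.1),
      (ht.2.trans hb).trans ((hz.le_of_le (i := i + 1) hi le_rfl).trans hz.le)⟩
  refine lt_of_hasDerivAt_pos (f := fun t => (-1) ^ i * w t) hab
    (fun t ht => (h.hw t (mem_Icc_zero_pi (hL.mem (hmem t ht)))).const_mul ((-1) ^ i))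
    fun t ht => ?_
  have ht1 := hmem t (Ioo_subset_Icc_self ht)
  have ht2 : t ∈ Ioo (z i) (z (i + 1)) := ⟨ha.trans_lt ht.1, ht.2.trans_le hb⟩
  have ht3 : t ∈ Ioc s (π / 2) := ⟨(hz.start_le hi.le).trans_lt ht2.1, ht1.2⟩
  rw [force_eq_mul_cofactor hU (abs_le_of_sq_lt hlam hU (hL.mem ht1) (hL.sq_le hU ht1)),
    ← mul_div_assoc, mul_left_comm]
  have := (hL.lt_y hU ht3).1
  exact div_pos (mul_pos (by linarith) (hz.sign i hi t ht2)) (by positivity)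

theorem RootChain.exists_critical (hz : RootChain lam ε U y w η C Ψ s n z)
    (hd : IsDrift lam U η C Ψ) (hlam : 0 < lam) (hU : IsLowRoot lam U)
    (hs : IsSmall lam U η C N ε) (h : IsShot lam ε y w) (hL : Launch lam ε U y w s) {i : ℕ}
    (hi : i < n) : ∃ c ∈ Ico (z i) (z (i + 1)), w c = 0 ∧ (i = 0 → c = s) ∧
      (∀ t ∈ Ico (z i) c, (-1) ^ i * w t < 0) ∧ ∀ t ∈ Ioc c (z (i + 1)), 0 < (-1) ^ i * w t := by
  obtain ⟨c, hc, hc0, hcs⟩ : ∃ c ∈ Ico (z i) (z (i + 1)), w c = 0 ∧ (i = 0 → c = s) := by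
    cases i with
    | zero => exact ⟨s, ⟨hz.zero.le, hz.zero ▸ hz.lt 0 hi⟩, hL.w_zero, fun _ => rfl⟩
    | succ i =>
      have h1 := hz.w_pos_of_root hd hlam hU hs h hL (i := i) (by omega)
      have h2 := hz.w_pos_of_root hd hlam hU hs h hL hi
      have hc : ContinuousOn (fun t => (-1) ^ (i + 1) * w t) (Icc (z (i + 1)) (z (i + 1 + 1))) :=
        (continuous_const.mul h.cont_w).continuousOn
      obtain ⟨c, hc, hc0⟩ := intermediate_value_Ioo (hz.lt (i + 1) hi).le hc
        (show (0 : ℝ) ∈ Ioo _ _ from ⟨by simp only [pow_succ]; linarith, h2⟩)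
      exact ⟨c, ⟨hc.1.le, hc.2⟩, (mul_eq_zero.mp hc0).resolve_left (by simp),
        fun h => absurd h (by omega)⟩
  refine ⟨c, hc, hc0, hcs, fun t ht => ?_, fun t ht => ?_⟩
  · have := hz.w_lt hlam hs.pos hU h hL hi ht.1 ht.2 hc.2.le
    rwa [hc0, mul_zero] at this
  · have := hz.w_lt hlam hs.pos hU h hL hi hc.1 ht.1 ht.2
    rwa [hc0, mul_zero] at this

/-- `ζ 0 = 0 < ⋯ < ζ N < b` are the zeros of `w` on `[0, b]`, and `w` alternates between them. -/
structure IsCriticalChain (w : ℝ → ℝ) (b : ℝ) (N : ℕ) (ζ : ℕ → ℝ) : Prop where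
  zero : ζ 0 = 0
  lt : ∀ j < N, ζ j < ζ (j + 1)
  lt_end : ζ N < b
  root : ∀ j ≤ N, w (ζ j) = 0
  sign : ∀ j < N, ∀ t ∈ Ioo (ζ j) (ζ (j + 1)), 0 < (-1) ^ (j + 1) * w t
  sign_end : ∀ t ∈ Ioc (ζ N) b, 0 < (-1) ^ (N + 1) * w t

theorem RootChain.exists_isCriticalChain (hz : RootChain lam ε U y w η C Ψ s n z)
    (hd : IsDrift lam U η C Ψ) (hlam : 0 < lam) (hU : IsLowRoot lam U)
    (hs : IsSmall lam U η C N ε) (h : IsShot lam ε y w) (hL : Launch lam ε U y w s) (hs0 : 0 < s)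
    (hn : 0 < n) : ∃ ζ, IsCriticalChain w (z n) n ζ ∧ ζ 1 = s := by
  have hex : ∀ i, ∃ c, i < n → c ∈ Ico (z i) (z (i + 1)) ∧ w c = 0 ∧ (i = 0 → c = s) ∧
      (∀ t ∈ Ico (z i) c, (-1) ^ i * w t < 0) ∧
      ∀ t ∈ Ioc c (z (i + 1)), 0 < (-1) ^ i * w t := fun i => by
    by_cases hi : i < n
    · obtain ⟨c, h1, h2⟩ := hz.exists_critical hd hlam hU hs h hL hi
      exact ⟨c, fun _ => ⟨h1, h2⟩⟩
    · exact ⟨0, fun h => absurd h hi⟩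
  choose c hc using hex
  have hc0 : c 0 = s := (hc 0 hn).2.2.1 rfl
  refine ⟨fun j => if j = 0 then 0 else c (j - 1), ⟨by simp, fun j hj => ?_, ?_, fun j hj => ?_,
    fun j hj t ht => ?_, fun t ht => ?_⟩, by simpa using hc0⟩
  · cases j with
    | zero => simpa [hc0] using hs0
    | succ j => simpa using (hc j (by omega)).1.2.trans_le (hc (j + 1) hj).1.1
  · obtain ⟨n, rfl⟩ : ∃ k, n = k + 1 := ⟨n - 1, by omega⟩
    simpa using (hc n (by omega)).1.2
  · cases j with
    | zero => simpa using h.w0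
    | succ j => simpa using (hc j (by omega)).2.1
  · cases j with
    | zero =>
      simp only [hc0, ↓reduceIte, zero_add, one_ne_zero, Nat.sub_self] at ht
      have := hL.w_neg t ht
      simpa using this
    | succ j =>
      simp only [Nat.add_eq_zero_iff, one_ne_zero, and_false, ↓reduceIte,
        Nat.add_sub_cancel] at ht
      have h1 : (-1 : ℝ) ^ (j + 1 + 1) = (-1) ^ j := by rw [pow_add, pow_succ]; ring
      rw [h1]
      rcases le_or_gt t (z (j + 1)) with h2 | h2
      · exact (hc j (by omega)).2.2.2.2 t ⟨ht.1, h2⟩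
      · have := (hc (j + 1) hj).2.2.2.1 t ⟨h2.le, ht.2⟩
        rw [pow_succ] at this
        linarith
  · obtain ⟨n, rfl⟩ : ∃ k, n = k + 1 := ⟨n - 1, by omega⟩
    have h1 : (-1 : ℝ) ^ (n + 1 + 1) = (-1) ^ n := by rw [pow_add, pow_succ]; ring
    rw [h1]
    simp only [Nat.add_eq_zero_iff, one_ne_zero, and_false, ↓reduceIte, Nat.add_sub_cancel] at ht
    exact (hc n (by omega)).2.2.2.2 t ht

end

section

variable {y w : ℝ → ℝ} {b : ℝ} {N : ℕ} {ζ : ℕ → ℝ}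

theorem IsCriticalChain.le_of_le (hζ : IsCriticalChain w b N ζ) {i j : ℕ} (hij : i ≤ j)
    (hj : j ≤ N) : ζ i ≤ ζ j := by
  induction j, hij using Nat.le_induction with
  | base => exact le_rfl
  | succ j _ ih => exact (ih (by omega)).trans (hζ.lt j (by omega)).le

theorem IsCriticalChain.eq_or_ne (hζ : IsCriticalChain w b N ζ) {t : ℝ} (ht : t ∈ Icc 0 b) :
    (∃ j ≤ N, t = ζ j) ∨ (0 < t ∧ w t ≠ 0) := by
  by_contra! hne
  obtain ⟨h1, h2⟩ := hne
  have hlt : ∀ j ≤ N, ζ j < t := by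
    intro j
    induction j with
    | zero =>
      intro _
      rw [hζ.zero]
      exact lt_of_le_of_ne ht.1 fun h => h1 0 (Nat.zero_le _) (by rw [hζ.zero, ← h])
    | succ j ih =>
      intro hj
      by_contra! hle
      have h3 := ih (by omega)
      have h4 := hζ.sign j (by omega) t ⟨h3, lt_of_le_of_ne hle (h1 _ hj)⟩
      have h5 : 0 ≤ ζ j := hζ.zero ▸ hζ.le_of_le (Nat.zero_le j) (by omega)
      rw [h2 (h5.trans_lt h3), mul_zero] at h4
      exact lt_irrefl _ h4
  have h4 := hζ.sign_end t ⟨hlt N le_rfl, ht.2⟩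
  rw [h2 (hζ.zero ▸ hlt 0 (Nat.zero_le _)), mul_zero] at h4
  exact lt_irrefl _ h4

theorem IsCriticalChain.sign_right (hζ : IsCriticalChain w b N ζ) {j : ℕ} (hj : j ≤ N) :
    ∃ r, ζ j < r ∧ r ≤ b ∧ ∀ t ∈ Ioo (ζ j) r, 0 < (-1) ^ (j + 1) * w t := by
  rcases hj.lt_or_eq with h1 | rfl
  · exact ⟨ζ (j + 1), hζ.lt j h1, (hζ.le_of_le (i := j + 1) h1 le_rfl).trans hζ.lt_end.le,
      hζ.sign j h1⟩
  · exact ⟨b, hζ.lt_end, le_rfl, fun t ht => hζ.sign_end t ⟨ht.1, ht.2.le⟩⟩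

/-- At the points of a critical chain the primitive has strict extrema of alternating type. -/
theorem IsCriticalChain.exists_strict (hζ : IsCriticalChain w b N ζ)
    (hy : ∀ t, HasDerivAt y (w t) t) {j : ℕ} (hj : j ≤ N) :
    ∃ p r, p < ζ j ∧ ζ j < r ∧ r ≤ b ∧ ∀ t ∈ Ioo p r, 0 ≤ t → t ≠ ζ j →
      (-1) ^ (j + 1) * y (ζ j) < (-1) ^ (j + 1) * y t := by
  obtain ⟨r, hr, hrb, hsr⟩ := hζ.sign_right hj
  have hright : ∀ t, ζ j < t → t < r → (-1) ^ (j + 1) * y (ζ j) < (-1) ^ (j + 1) * y t :=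
    fun t h1 h2 => lt_of_hasDerivAt_pos (f := fun t => (-1) ^ (j + 1) * y t) h1
      (fun x _ => (hy x).const_mul _) fun x hx => hsr x ⟨hx.1, hx.2.trans h2⟩
  cases j with
  | zero =>
    refine ⟨-1, r, by rw [hζ.zero]; norm_num, hr, hrb, fun t ht h0 hne => ?_⟩
    exact hright t (lt_of_le_of_ne (by rwa [hζ.zero]) hne.symm) ht.2
  | succ j =>
    refine ⟨ζ j, r, hζ.lt j hj, hr, hrb, fun t ht _ hne => ?_⟩
    rcases hne.lt_or_gt with h1 | h1
    · have := lt_of_hasDerivAt_pos h1 (fun x _ => (hy x).const_mul ((-1) ^ (j + 1)))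
        fun x hx => hζ.sign j hj x ⟨ht.1.trans hx.1, hx.2⟩
      rw [pow_succ _ (j + 1)]
      linarith
    · exact hright t h1 ht.2

end

section

variable {y w : ℝ → ℝ} {b c : ℝ} {N : ℕ} {ζ : ℕ → ℝ}

theorem IsCriticalChain.isLocalMinOn_iff (hζ : IsCriticalChain w b N ζ)
    (hy : ∀ t, HasDerivAt y (w t) t) (hbc : b ≤ c) (k : ℕ) {t : ℝ} (ht : t ∈ Ico 0 b) :
    IsLocalMinOn (fun t => (-1) ^ k * y t) (Icc 0 c) t ↔ ∃ j ≤ N, Even (j + 1 + k) ∧ t = ζ j := by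
  have hk : ((-1 : ℝ) ^ k) * (-1) ^ k = 1 := by rw [← mul_pow]; norm_num
  constructor
  · intro hmin
    rcases hζ.eq_or_ne ⟨ht.1, ht.2.le⟩ with ⟨j, hj, rfl⟩ | ⟨h0, hw⟩
    · refine ⟨j, hj, ?_, rfl⟩
      by_contra hodd
      obtain ⟨p, r, hp, hr, hrb, hstrict⟩ := hζ.exists_strict hy hj
      have h1 : ∀ᶠ x in nhdsWithin (ζ j) (Ioi (ζ j)), x ∈ Ioo (ζ j) r :=
        Ioo_mem_nhdsGT hr
      have h2 : ∀ᶠ x in nhdsWithin (ζ j) (Ioi (ζ j)), (-1) ^ k * y (ζ j) ≤ (-1) ^ k * y x := by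
        have h3 : nhdsWithin (ζ j) (Ioi (ζ j)) ≤ nhdsWithin (ζ j) (Icc 0 c) := by
          refine nhdsWithin_le_of_mem (Filter.mem_of_superset (Ioo_mem_nhdsGT hr) fun x hx => ?_)
          exact ⟨ht.1.trans hx.1.le, (hx.2.le.trans hrb).trans hbc⟩
        exact hmin.filter_mono h3
      obtain ⟨x, hx1, hx2⟩ := (h1.and h2).exists
      have h4 := hstrict x ⟨hp.trans hx1.1, hx1.2⟩ (ht.1.trans hx1.1.le) hx1.1.ne'
      have h5 : (-1 : ℝ) ^ (j + 1) = -(-1) ^ k := by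
        have := (Nat.not_even_iff_odd.mp hodd).neg_one_pow (α := ℝ)
        rw [pow_add] at this
        linear_combination (-1 : ℝ) ^ k * this - (-1) ^ (j + 1) * hk
      rw [h5] at h4
      linarith
    · exfalso
      have h1 : IsLocalMin (fun t => (-1) ^ k * y t) t :=
        hmin.isLocalMin (Icc_mem_nhds h0 (ht.2.trans_le hbc))
      have h2 := h1.hasDerivAt_eq_zero ((hy t).const_mul ((-1) ^ k))
      exact hw ((mul_eq_zero.mp h2).resolve_left (by simp))
  · rintro ⟨j, hj, heven, rfl⟩
    obtain ⟨p, r, hp, hr, -, hstrict⟩ := hζ.exists_strict hy hj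
    have h5 : (-1 : ℝ) ^ k = (-1) ^ (j + 1) := by
      have := heven.neg_one_pow (α := ℝ)
      rw [pow_add] at this
      linear_combination (-1 : ℝ) ^ (j + 1) * hk - (-1) ^ k * this
    filter_upwards [self_mem_nhdsWithin, mem_nhdsWithin_of_mem_nhds (Ioo_mem_nhds hp hr)]
      with x hx1 hx2
    rw [h5]
    rcases _root_.eq_or_ne x (ζ j) with rfl | hne
    · exact le_rfl
    · exact (hstrict x hx2 hx1.1 hne).le

theorem isLocalMinOn_const_sub_iff {f : ℝ → ℝ} {x : ℝ} (hx : x ∈ Icc 0 c) :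
    IsLocalMinOn (fun x => f (c - x)) (Icc 0 c) x ↔ IsLocalMinOn f (Icc 0 c) (c - x) := by
  have hmaps : Icc 0 c ⊆ (fun x => c - x) ⁻¹' Icc 0 c := fun x hx =>
    ⟨sub_nonneg.mpr hx.2, sub_le_self c hx.1⟩
  have hcont : ContinuousOn (fun x => c - x) (Icc 0 c) := by fun_prop
  constructor
  · intro h
    have h1 : IsLocalMinOn (fun x => f (c - x)) (Icc 0 c) ((fun x => c - x) (c - x)) := by
      simpa using h
    simpa [Function.comp_def] using h1.comp_continuousOn hmaps hcont (hmaps hx)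
  · intro h
    exact IsLocalMinOn.comp_continuousOn (g := fun x => c - x) h hmaps hcont hx

theorem IsCriticalChain.isLocalMinOn_const_sub_iff (hζ : IsCriticalChain w b N ζ)
    (hy : ∀ t, HasDerivAt y (w t) t) (hbc : b ≤ c) {x : ℝ} (hx : x ∈ Ioc (c - b) c) :
    IsLocalMinOn (fun x => y (c - x)) (Icc 0 c) x ↔ ∃ j ≤ N, Odd j ∧ x = c - ζ j := by
  have h := hζ.isLocalMinOn_iff hy hbc 0 (t := c - x) ⟨by linarith [hx.2], by linarith [hx.1]⟩
  simp only [pow_zero, one_mul, add_zero, Nat.even_add_one, Nat.not_even_iff_odd] at h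
  rw [_root_.isLocalMinOn_const_sub_iff ⟨by linarith [hx.1], hx.2⟩, h]
  simp only [eq_sub_iff_add_eq, eq_comm, add_comm]

theorem IsCriticalChain.isLocalMaxOn_const_sub_iff (hζ : IsCriticalChain w b N ζ)
    (hy : ∀ t, HasDerivAt y (w t) t) (hbc : b ≤ c) {x : ℝ} (hx : x ∈ Ioc (c - b) c) :
    IsLocalMaxOn (fun x => y (c - x)) (Icc 0 c) x ↔ ∃ j ≤ N, Even j ∧ x = c - ζ j := by
  have h := hζ.isLocalMinOn_iff hy hbc 1 (t := c - x) ⟨by linarith [hx.2], by linarith [hx.1]⟩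
  simp only [pow_one, neg_one_mul, add_assoc, one_add_one_eq_two, Nat.even_add,
    even_two, iff_true] at h
  rw [← _root_.isLocalMinOn_const_sub_iff (f := fun t => -y t) ⟨by linarith [hx.1], hx.2⟩] at h
  have h1 : IsLocalMaxOn (fun x => y (c - x)) (Icc 0 c) x ↔
      IsLocalMinOn (fun x => -y (c - x)) (Icc 0 c) x :=
    ⟨fun h => h.neg, fun h => by simpa using h.neg⟩
  rw [h1, h]
  simp only [eq_sub_iff_add_eq, eq_comm, add_comm]

end

section

variable {lam ε : ℝ} {U y w : ℝ → ℝ} {s : ℝ}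

theorem Launch.lt_of_mem_Ioo (hL : Launch lam ε U y w s) (h : IsShot lam ε y w) {t : ℝ}
    (ht : t ∈ Ioo 0 s) : y s < y t ∧ y t < y 0 := by
  have hanti : ∀ a b, 0 ≤ a → a < b → b ≤ s → y b < y a := fun a b h1 h2 h3 => by
    have := lt_of_hasDerivAt_pos (f := fun t => -y t) h2 (fun x _ => (h.hy x).neg)
      fun x hx => neg_pos.mpr (hL.w_neg x ⟨h1.trans_lt hx.1, hx.2.trans_le h3⟩)
    linarith
  exact ⟨hanti t s ht.1.le ht.2 le_rfl, hanti 0 t le_rfl ht.1 ht.2.le⟩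

theorem Launch.abs_y_le_of_mem_Icc (hL : Launch lam ε U y w s) (h : IsShot lam ε y w)
    (hU : IsLowRoot lam U) {t : ℝ} (ht : t ∈ Icc 0 (π / 2)) : |y t| ≤ √lam := by
  rcases le_or_gt s t with h1 | h1
  · exact hL.abs_y_le hU ⟨h1, ht.2⟩
  · have hys : y s ≤ y t := by
      rcases ht.1.eq_or_lt with rfl | h2
      · have := lt_of_hasDerivAt_pos (f := fun t => -y t) h1 (fun x _ => (h.hy x).neg)
          fun x hx => neg_pos.mpr (hL.w_neg x hx)
        linarith
      · exact (hL.lt_of_mem_Ioo h ⟨h2, h1⟩).1.le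
    have h2 := abs_le.mp (hL.abs_y_le hU ⟨le_rfl, hL.le⟩)
    have h3 := hL.low t ⟨ht.1, h1.le⟩
    have h4 := hU.neg 0
    exact abs_le.mpr ⟨by linarith, by linarith [sqrt_nonneg lam]⟩

theorem IsShot.duffing_reflected (h : IsShot lam ε y w) (hlam : 0 < lam) (hε : 0 < ε)
    (h0 : y (π / 2) = 0) (hle : ∀ t ∈ Icc 0 (π / 2), |y t| ≤ √lam) {t : ℝ} (ht : t ∈ Icc 0 π) :
    ε ^ 2 * deriv (deriv fun x => y (π - x)) t =
      y (π - t) ^ 3 - lam * y (π - t) + cos t := by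
  have ht' : π - t ∈ Icc 0 π := ⟨by linarith [ht.2], by linarith [ht.1]⟩
  have hderiv : deriv (fun x => y (π - x)) = fun x => -w (π - x) :=
    funext fun x => ((h.hy (π - x)).comp_const_sub π x).deriv
  have h2 := ((h.hw (π - t) ht').comp_const_sub π t).neg
  have hroot : √lam ≤ lam + 1 := by nlinarith [sq_sqrt hlam.le, sq_nonneg (√lam - 1)]
  have habs : |y (π - t)| ≤ lam + 1 := by
    refine le_trans ?_ hroot
    rcases le_total t (π / 2) with h1 | h1
    · rw [(h.odd hlam.le h0 ht).1, abs_neg]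
      exact hle t ⟨ht.1, h1⟩
    · exact hle _ ⟨ht'.1, by linarith⟩
  rw [hderiv, HasDerivAt.deriv (f := fun x => -w (π - x)) h2, neg_neg, force_of_abs_le habs,
    cos_pi_sub, sub_neg_eq_add, mul_div_cancel₀ _ (by positivity)]

end

/-- For small `ε` some shot vanishes at `π / 2` and has `N + 1` critical points before it. -/
theorem eventually_exists_isCriticalChain {lam : ℝ} {U : ℝ → ℝ} (hlam : 0 < lam)
    (hU : IsLowRoot lam U) {N : ℕ} (hN : 0 < N) : ∀ᶠ ε in nhdsWithin 0 (Ioi 0),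
      ∃ y w s ζ, IsShot lam ε y w ∧ Launch lam ε U y w s ∧ IsCriticalChain w (π / 2) N ζ ∧
        ζ 1 = s ∧ y 0 < U 0 ∧ y (π / 2) = 0 := by
  obtain ⟨η, C, Ψ, hd⟩ := exists_isDrift hlam hU
  filter_upwards [eventually_isSmall hd hU N, eventually_exists_rootChain hd hlam hU (N + 1)]
    with ε hs hmany
  obtain ⟨y, w, s, z, h, hy0, hL, hz, hzN⟩ := exists_rootChain_end_eq hd hlam hU hs hN hmany
  have hs0 : 0 < s := hL.nonneg.lt_of_ne fun h0 => hy0.ne (hL.start h0.symm)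
  obtain ⟨ζ, hζ, hζ1⟩ := hz.exists_isCriticalChain hd hlam hU hs h hL hs0 hN
  rw [hzN] at hζ
  refine ⟨y, w, s, ζ, h, hL, hζ, hζ1, hy0, ?_⟩
  obtain ⟨n, rfl⟩ : ∃ k, N = k + 1 := ⟨N - 1, by omega⟩
  have hroot := hz.root n (by omega)
  have hlt := hL.lt_y hU (t := π / 2)
    ⟨(hζ1 ▸ hζ.le_of_le (Nat.le_add_left 1 n) le_rfl).trans_lt hζ.lt_end, le_rfl⟩
  rw [hzN, cofactor, hU.at_pi_div_two] at hroot
  rw [hU.at_pi_div_two] at hlt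
  have h1 : y (π / 2) * (y (π / 2) - √lam) = 0 := by
    linear_combination hroot - sq_sqrt hlam.le
  exact (mul_eq_zero.mp h1).resolve_right (by linarith)

/-- "Up wind" layered solutions: for `λ > λ₀ = 3/2^(2/3)` and every positive
integer `m` there is `ε_m > 0` such that for `0 < ε < ε_m` the Duffing equation
has a solution `u` on `[0,π]` with `u'(0) = u'(π) = 0`, `u(π/2) = 0`,
`u'(π/2) < 0`, whose local minimum points in `(π/2,π]` are exactly
`s₁ < ⋯ < s_m` and local maximum points exactly `t₁ < ⋯ < t_m = π`, interlaced
as `π/2 < s₁ < t₁ < ⋯ < s_m < t_m = π`, and with `u' > 0` and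
`U̲(π/2) = −√λ < u < U̲(π)` on `(s_m, π)`; here `U̲(π)` is the least root of
`x³ − λx − 1 = 0`. -/
theorem stmt_17 (lam Ulowpi : ℝ)
    (hlam : (3 : ℝ) / (2 : ℝ) ^ ((2 : ℝ) / 3) < lam)
    (hUlowpiroot : Ulowpi ^ 3 - lam * Ulowpi - 1 = 0)
    (hUlowpileast : ∀ y : ℝ, y ^ 3 - lam * y - 1 = 0 → Ulowpi ≤ y) :
    ∀ m : ℕ, 0 < m → ∃ εm > (0 : ℝ), ∀ ε : ℝ, 0 < ε → ε < εm →
      ∃ u : ℝ → ℝ, ContDiff ℝ 2 u ∧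
        (∀ t ∈ Icc (0 : ℝ) π,
          ε ^ 2 * deriv (deriv u) t = u t ^ 3 - lam * u t + Real.cos t) ∧
        deriv u 0 = 0 ∧ deriv u π = 0 ∧
        u (π / 2) = 0 ∧ deriv u (π / 2) < 0 ∧
        ∃ s t : ℕ → ℝ,
          π / 2 < s 1 ∧
          (∀ i : ℕ, 1 ≤ i → i ≤ m → s i < t i) ∧
          (∀ i : ℕ, 1 ≤ i → i < m → t i < s (i + 1)) ∧
          t m = π ∧
          (∀ x ∈ Ioc (π / 2) π,
            (IsLocalMinOn u (Icc (0 : ℝ) π) x ↔ ∃ i : ℕ, 1 ≤ i ∧ i ≤ m ∧ x = s i)) ∧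
          (∀ x ∈ Ioc (π / 2) π,
            (IsLocalMaxOn u (Icc (0 : ℝ) π) x ↔ ∃ i : ℕ, 1 ≤ i ∧ i ≤ m ∧ x = t i)) ∧
          (∀ x ∈ Ioo (s m) π,
            0 < deriv u x ∧ -Real.sqrt lam < u x ∧ u x < Ulowpi) := by
  intro m hm
  obtain ⟨hlam0, hlam1⟩ := twentyseven_lt_of_lt hlam
  obtain ⟨U, hU⟩ := exists_isLowRoot hlam0 hlam1
  have hU0 := hU.zero_eq_least hUlowpiroot hUlowpileast
  obtain ⟨ε₀, hε₀, hsub⟩ := mem_nhdsGT_iff_exists_Ioo_subset.mp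
    (eventually_exists_isCriticalChain hlam0 hU (N := 2 * m - 1) (by omega))
  refine ⟨ε₀, hε₀, fun ε hε hlt => ?_⟩
  obtain ⟨y, w, s, ζ, h, hL, hζ, hζ1, hy0, hyπ⟩ := hsub ⟨hε, hlt⟩
  have hπ := pi_pos
  have hderiv : deriv (fun x => y (π - x)) = fun x => -w (π - x) :=
    funext fun x => ((h.hy (π - x)).comp_const_sub π x).deriv
  refine ⟨fun x => y (π - x), h.smooth.comp (contDiff_const.sub contDiff_id), fun t ht =>
    h.duffing_reflected hlam0 hε hyπ (fun t ht => hL.abs_y_le_of_mem_Icc h hU ht) ht,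
    ?_, ?_, by simpa only [sub_half] using hyπ, ?_,
    fun i => π - ζ (2 * (m - i) + 1), fun i => π - ζ (2 * (m - i)), ?_, fun i hi him => ?_,
    fun i hi him => ?_, by simp [hζ.zero], fun x hx => ?_, fun x hx => ?_, fun x hx => ?_⟩
  · simp only [hderiv, (h.odd hlam0.le hyπ ⟨le_rfl, hπ.le⟩).2, h.w0, neg_zero]
  · simp only [hderiv, sub_self, h.w0, neg_zero]
  · have h1 := hζ.sign_end (π / 2) ⟨hζ.lt_end, le_rfl⟩
    rw [show 2 * m - 1 + 1 = 2 * m by omega, pow_mul, neg_one_sq, one_pow, one_mul] at h1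
    simpa only [hderiv, sub_half, neg_lt_zero] using h1
  · have h1 := hζ.lt_end
    rw [show 2 * m - 1 = 2 * (m - 1) + 1 by omega] at h1
    simp only
    linarith
  · linarith [hζ.lt (2 * (m - i)) (by omega)]
  · have h1 := hζ.lt (2 * (m - (i + 1)) + 1) (by omega)
    rw [show 2 * (m - (i + 1)) + 1 + 1 = 2 * (m - i) by omega] at h1
    linarith
  · rw [hζ.isLocalMinOn_const_sub_iff h.hy (by linarith) (by rwa [sub_half])]
    constructor
    · rintro ⟨_, hj, ⟨k, rfl⟩, rfl⟩
      exact ⟨m - k, by omega, by omega, by simp only [show m - (m - k) = k by omega]⟩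
    · rintro ⟨i, hi, him, rfl⟩
      exact ⟨_, by omega, ⟨m - i, rfl⟩, rfl⟩
  · rw [hζ.isLocalMaxOn_const_sub_iff h.hy (by linarith) (by rwa [sub_half])]
    constructor
    · rintro ⟨_, hj, ⟨k, rfl⟩, rfl⟩
      exact ⟨m - k, by omega, by omega, by simp only [show 2 * (m - (m - k)) = k + k by omega]⟩
    · rintro ⟨i, hi, him, rfl⟩
      exact ⟨_, by omega, even_two_mul _, rfl⟩
  · simp only [Nat.sub_self, mul_zero, zero_add, hζ1] at hx
    have hx' : π - x ∈ Ioo 0 s := ⟨by linarith [hx.2], by linarith [hx.1]⟩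
    have h1 := hL.lt_of_mem_Ioo h hx'
    have h2 := neg_sqrt_le_lowRoot hU ⟨hL.nonneg, hL.le⟩
    have h3 := hL.gap_pos (hx'.1.trans hx'.2)
    simp only [hderiv, neg_pos]
    exact ⟨hL.w_neg _ hx', by linarith, by linarith⟩
end

section
/- Let ε > 0 and λ > λ₀, and let u be a solution of (∗) on [π/2, π] with u(π/2) = 0 and u'(π/2) = β. (i) If β < −λ/(√2·ε), then either u'(t) < 0 for all t ∈ [π/2, π], or there exists t₀ ∈ (π/2, π) with u(t₀) = U̲(t₀) and u'(t) < 0 for all t ∈ [π/2, t₀]. (ii) Define H(x) := λ·x² − x⁴/2. If β < −√(H(U̲(π)))/ε and t₁ ∈ (π/2, π) is such that u'(t₁) = 0 and u'(t) < 0 for all t ∈ (π/2, t₁), then u(t₁) < U̲(π). -/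
open Real Set

/-- Along a decreasing solution of the Duffing equation, the energy
`ε² u'² + λ u² - u⁴ / 2` does not decrease while `cos ≤ 0`. -/
lemma duffing_energy_le {ε lam : ℝ} {u : ℝ → ℝ} (hu : ContDiff ℝ 2 u)
    (hueq : ∀ t ∈ Icc (π / 2) π,
      ε ^ 2 * deriv (deriv u) t = u t ^ 3 - lam * u t + Real.cos t)
    {s : ℝ} (hs : s ∈ Icc (π / 2) π) (hneg : ∀ t ∈ Ioo (π / 2) s, deriv u t < 0) :
    ε ^ 2 * deriv u (π / 2) ^ 2 + lam * u (π / 2) ^ 2 - u (π / 2) ^ 4 / 2 ≤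
      ε ^ 2 * deriv u s ^ 2 + lam * u s ^ 2 - u s ^ 4 / 2 := by
  have hu1 : Differentiable ℝ u := hu.differentiable (by norm_num)
  have hu2 : Differentiable ℝ (deriv u) := by
    have h : ContDiff ℝ (1 + 1) u := by simpa [one_add_one_eq_two] using hu
    exact (contDiff_succ_iff_deriv.1 h).2.2.differentiable (by norm_num)
  have hderiv : ∀ t, HasDerivAt
      (fun t => ε ^ 2 * deriv u t ^ 2 + lam * u t ^ 2 - u t ^ 4 / 2)
      (2 * deriv u t * (ε ^ 2 * deriv (deriv u) t - (u t ^ 3 - lam * u t))) t := by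
    intro t
    have h1 := (hu1 t).hasDerivAt
    have h2 := (hu2 t).hasDerivAt
    refine HasDerivAt.congr_deriv ((((h2.pow 2).const_mul (ε ^ 2)).add
      ((h1.pow 2).const_mul lam)).sub ((h1.pow 4).div_const 2)) ?_
    push_cast
    ring
  have hmono : MonotoneOn (fun t => ε ^ 2 * deriv u t ^ 2 + lam * u t ^ 2 - u t ^ 4 / 2)
      (Icc (π / 2) s) := by
    refine monotoneOn_of_deriv_nonneg (convex_Icc _ _)
      (fun t _ => (hderiv t).continuousAt.continuousWithinAt)
      (fun t _ => (hderiv t).differentiableAt.differentiableWithinAt) fun t ht => ?_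
    rw [interior_Icc] at ht
    rw [(hderiv t).deriv, hueq t ⟨ht.1.le, ht.2.le.trans hs.2⟩]
    have hcos : Real.cos t ≤ 0 :=
      Real.cos_nonpos_of_pi_div_two_le_of_le ht.1.le (by linarith [ht.2, hs.2, Real.pi_pos])
    have := mul_nonneg_of_nonpos_of_nonpos (hneg t ht).le hcos
    linarith
  exact hmono ⟨le_rfl, hs.1⟩ ⟨hs.1, le_rfl⟩ hs.1

/-- For `λ > 3 / 2^(2/3)` the cubic `x³ - λ x - 1` has a negative root. -/
lemma exists_neg_root_cubic {lam : ℝ} (hlam : (3 : ℝ) / (2 : ℝ) ^ ((2 : ℝ) / 3) < lam) :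
    ∃ y : ℝ, y ^ 3 - lam * y - 1 = 0 ∧ y < 0 := by
  obtain ⟨c, hc, hc3, hc2⟩ : ∃ c : ℝ, 0 < c ∧ c ^ 3 = 2 ∧ (2 : ℝ) ^ ((2 : ℝ) / 3) = c ^ 2 := by
    refine ⟨(2 : ℝ) ^ ((1 : ℝ) / 3), by positivity, ?_, ?_⟩
    · rw [← Real.rpow_natCast, ← Real.rpow_mul (by norm_num)]; norm_num
    · rw [← Real.rpow_natCast, ← Real.rpow_mul (by norm_num)]; norm_num
  rw [hc2] at hlam
  set a := c⁻¹ with ha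
  have ha0 : 0 < a := inv_pos.2 hc
  have ha3 : 2 * a ^ 3 = 1 := by
    rw [ha, inv_pow, hc3]; norm_num
  have hla : 3 * a ^ 2 < lam := by
    rwa [ha, inv_pow, ← div_eq_mul_inv]
  have hlam0 : 0 < lam := by nlinarith
  have ha1 : a ≤ 1 := by
    by_contra! h
    nlinarith [pow_lt_pow_left₀ h zero_le_one three_ne_zero]
  have hivt := intermediate_value_Icc (f := fun y : ℝ => y ^ 3 - lam * y - 1)
    (show -(lam + 1) ≤ -a by linarith) (by fun_prop)
  obtain ⟨y, hy, hy0⟩ := hivt (show (0 : ℝ) ∈ Icc _ _ from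
    ⟨by nlinarith [pow_pos hlam0 3, pow_pos hlam0 2], by nlinarith [mul_pos (sub_pos.2 hla) ha0]⟩)
  exact ⟨y, hy0, by linarith [hy.2]⟩

/-- A continuous function that is negative at `a` and nonnegative somewhere on `[a, b]` has a
first zero there. -/
lemma exists_first_zero {f : ℝ → ℝ} (hf : Continuous f) {a b : ℝ} (ha : f a < 0)
    (h : ∃ t ∈ Icc a b, 0 ≤ f t) :
    ∃ s ∈ Icc a b, f s = 0 ∧ ∀ t ∈ Ioo a s, f t < 0 := by
  have hcomp : IsCompact (Icc a b ∩ {t | 0 ≤ f t}) :=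
    isCompact_Icc.inter_right (isClosed_le continuous_const hf)
  obtain ⟨s, ⟨hs, hs0⟩, hmin⟩ := hcomp.exists_isLeast h
  obtain ⟨z, hz, hz0⟩ := intermediate_value_Icc hs.1 hf.continuousOn ⟨ha.le, hs0⟩
  have hzs : s = z := le_antisymm (hmin ⟨⟨hz.1, hz.2.trans hs.2⟩, hz0.ge⟩) hz.2
  refine ⟨s, hs, hzs ▸ hz0, fun t ht => ?_⟩
  by_contra! h0
  exact absurd (hmin ⟨⟨ht.1.le, ht.2.le.trans hs.2⟩, h0⟩) (not_le.2 ht.2)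

/-- Steep-descent lemma: let `λ > λ₀ = 3/2^(2/3)` and let `u` solve the Duffing
equation on `[π/2, π]` with `u(π/2) = 0` and `u'(π/2) = β`.
(i) If `β < −λ/(√2·ε)`, then either `u' < 0` on all of `[π/2,π]`, or there is
`t₀ ∈ (π/2,π)` with `u(t₀) = U̲(t₀)` (the least root of `x³ − λx + cos t₀ = 0`)
and `u' < 0` on `[π/2, t₀]`.
(ii) With `H(x) = λx² − x⁴/2`: if `β < −√(H(U̲(π)))/ε` and `t₁ ∈ (π/2,π)` is the
first zero of `u'`, then `u(t₁) < U̲(π)`, where `U̲(π)` is the least root of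
`x³ − λx − 1 = 0`. -/
theorem stmt_18 (ε lam β Ulowpi : ℝ) (hε : 0 < ε)
    (hlam : (3 : ℝ) / (2 : ℝ) ^ ((2 : ℝ) / 3) < lam)
    (u : ℝ → ℝ) (hu : ContDiff ℝ 2 u)
    (hueq : ∀ t ∈ Icc (π / 2) π,
      ε ^ 2 * deriv (deriv u) t = u t ^ 3 - lam * u t + Real.cos t)
    (hu0 : u (π / 2) = 0) (huβ : deriv u (π / 2) = β)
    (hUlowpiroot : Ulowpi ^ 3 - lam * Ulowpi - 1 = 0)
    (hUlowpileast : ∀ y : ℝ, y ^ 3 - lam * y - 1 = 0 → Ulowpi ≤ y) :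
    (β < -lam / (Real.sqrt 2 * ε) →
      (∀ t ∈ Icc (π / 2) π, deriv u t < 0) ∨
      (∃ t₀ ∈ Ioo (π / 2) π,
        ((u t₀) ^ 3 - lam * u t₀ + Real.cos t₀ = 0 ∧
          ∀ y : ℝ, y ^ 3 - lam * y + Real.cos t₀ = 0 → u t₀ ≤ y) ∧
        ∀ t ∈ Icc (π / 2) t₀, deriv u t < 0)) ∧
    (β < -Real.sqrt (lam * Ulowpi ^ 2 - Ulowpi ^ 4 / 2) / ε →
      ∀ t₁ ∈ Ioo (π / 2) π, deriv u t₁ = 0 →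
        (∀ t ∈ Ioo (π / 2) t₁, deriv u t < 0) →
        u t₁ < Ulowpi) := by
  have hlam0 : 0 < lam := lt_trans (by positivity) hlam
  have hcont : Continuous (deriv u) := hu.continuous_deriv (by norm_num)
  constructor
  · intro hβ
    left
    have hβε : lam < Real.sqrt 2 * (ε * -β) := by
      have hpos : 0 < Real.sqrt 2 * ε := by positivity
      rw [lt_div_iff₀ hpos] at hβ
      linarith
    have hβ0 : 0 < ε * -β := by
      by_contra! h
      nlinarith [Real.sqrt_nonneg 2]
    have hβneg : deriv u (π / 2) < 0 := by
      rw [huβ]; linarith [pos_of_mul_pos_right hβ0 hε.le]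
    by_contra! h
    obtain ⟨s, hs, hs0, hneg⟩ := exists_first_zero hcont hβneg h
    have hE := duffing_energy_le hu hueq hs hneg
    rw [hs0, hu0, huβ] at hE
    have hsq := pow_lt_pow_left₀ hβε hlam0.le two_ne_zero
    rw [mul_pow, Real.sq_sqrt zero_le_two] at hsq
    nlinarith [sq_nonneg (u s ^ 2 - lam)]
  · intro hβ t₁ ht₁ hd hneg
    have hβε : Real.sqrt (lam * Ulowpi ^ 2 - Ulowpi ^ 4 / 2) < ε * -β := by
      rw [lt_div_iff₀ hε] at hβ
      linarith
    have hE := duffing_energy_le hu hueq ⟨ht₁.1.le, ht₁.2.le⟩ hneg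
    rw [hd, hu0, huβ] at hE
    have hH := Real.lt_sq_of_sqrt_lt hβε
    have hu_nonpos : u t₁ ≤ 0 := by
      have hanti : AntitoneOn u (Icc (π / 2) t₁) :=
        antitoneOn_of_deriv_nonpos (convex_Icc _ _) hu.continuous.continuousOn
          (hu.differentiable (by norm_num)).differentiableOn
          fun t ht => (hneg t (by rwa [interior_Icc] at ht)).le
      simpa [hu0] using hanti ⟨le_rfl, ht₁.1.le⟩ ⟨ht₁.1.le, le_rfl⟩ ht₁.1.le
    obtain ⟨y, hy, hy0⟩ := exists_neg_root_cubic hlam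
    have hm0 : Ulowpi < 0 := (hUlowpileast y hy).trans_lt hy0
    have hm2 : Ulowpi ^ 2 ≤ lam := by
      by_contra! h
      nlinarith
    by_contra! h
    have hsq : u t₁ ^ 2 ≤ Ulowpi ^ 2 := by nlinarith
    nlinarith [mul_nonneg (sub_nonneg.2 hsq)
      (show 0 ≤ lam - (u t₁ ^ 2 + Ulowpi ^ 2) / 2 by linarith)]
end
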